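/- arXiv:1305.6169 — 2 statements merged into one kernel-verified Lean document; each statement's English description precedes it below -/
import Mathlib

section
/- There exists a 3-dimensional compact connected C⁰-submanifold Y ⊂ ℝ³ with nonempty boundary such that the induced boundary distance function ρ_Y (defined as the liminf of infima of lengths of smooth paths in int Y) is finite on Y × Y but fails the triangle inequality, hence is not a metric on Y. -/
open Set Filter Topology ENNReal Real

/-- The infimum of lengths (in the Euclidean metric) of smooth paths joining `x` and `y`
inside the set `S`. -/
noncomputable def infSmoothLength {n : ℕ} (S : Set (EuclideanSpace ℝ (Fin n)))
    (x y : EuclideanSpace ℝ (Fin n)) : ℝ≥0∞ :=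
  sInf { L : ℝ≥0∞ | ∃ γ : ℝ → EuclideanSpace ℝ (Fin n), ContDiff ℝ (⊤ : ℕ∞) γ ∧
      γ 0 = x ∧ γ 1 = y ∧ (∀ t ∈ Icc (0:ℝ) 1, γ t ∈ S) ∧
      L = eVariationOn γ (Icc (0:ℝ) 1) }

/-- `ρ_Y(x,y) = liminf_{x′→x, y′→y; x′,y′ ∈ int Y} inf{l(γ) : γ smooth path in int Y}`. -/
noncomputable def rhoY {n : ℕ} (Y : Set (EuclideanSpace ℝ (Fin n)))
    (x y : EuclideanSpace ℝ (Fin n)) : ℝ≥0∞ :=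
  Filter.liminf (fun p : EuclideanSpace ℝ (Fin n) × EuclideanSpace ℝ (Fin n) =>
      infSmoothLength (interior Y) p.1 p.2)
    ((𝓝 x ⊓ 𝓟 (interior Y)) ×ˢ (𝓝 y ⊓ 𝓟 (interior Y)))

/-- `Y` is a compact connected `n`-dimensional `C⁰`-submanifold with nonempty boundary:
every point of `Y` has a neighborhood whose intersection with `Y` is homeomorphic to an
open subset of the closed half-space of `ℝⁿ`. -/
def IsC0SubmanifoldWithBoundary (n : ℕ) {X : Type*} [TopologicalSpace X] (Y : Set X) : Prop :=
  IsCompact Y ∧ IsConnected Y ∧ (frontier Y).Nonempty ∧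
  ∀ y ∈ Y, ∃ U : Set X, IsOpen U ∧ y ∈ U ∧
    ∃ V : Set {x : EuclideanSpace ℝ (Fin n) // ∀ i : Fin n, (i : ℕ) = 0 → 0 ≤ x i},
      IsOpen V ∧ Nonempty (↥(U ∩ Y) ≃ₜ ↥V)



section Paths

variable {n : ℕ} {S Y : Set (EuclideanSpace ℝ (Fin n))} {a b c : EuclideanSpace ℝ (Fin n)}

theorem infSmoothLength_le {γ : ℝ → EuclideanSpace ℝ (Fin n)} (hγ : ContDiff ℝ (⊤ : ℕ∞) γ)
    (h0 : γ 0 = a) (h1 : γ 1 = b) (hS : ∀ t ∈ Icc (0 : ℝ) 1, γ t ∈ S) :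
    infSmoothLength S a b ≤ eVariationOn γ (Icc (0 : ℝ) 1) :=
  sInf_le ⟨γ, hγ, h0, h1, hS, rfl⟩

theorem infSmoothLength_comm_le : infSmoothLength S a b ≤ infSmoothLength S b a := by
  refine le_sInf ?_
  rintro _ ⟨γ, hγ, h0, h1, hS, rfl⟩
  have hmaps : MapsTo (fun t : ℝ => 1 - t) (Icc 0 1) (Icc 0 1) := by
    intro t ht
    exact ⟨by linarith [ht.2], by linarith [ht.1]⟩
  refine (infSmoothLength_le (γ := γ ∘ fun t => 1 - t) ?_ ?_ ?_ ?_).trans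
    (eVariationOn.comp_le_of_antitoneOn γ _ ?_ hmaps)
  · exact hγ.comp (by fun_prop)
  · simp [h1]
  · simp [h0]
  · exact fun t ht => hS _ (hmaps ht)
  · intro s _ t _ hst
    exact sub_le_sub_left hst 1

theorem infSmoothLength_comm : infSmoothLength S a b = infSmoothLength S b a :=
  le_antisymm infSmoothLength_comm_le infSmoothLength_comm_le

theorem infSmoothLength_triangle :
    infSmoothLength S a c ≤ infSmoothLength S a b + infSmoothLength S b c := by
  refine ENNReal.le_of_forall_pos_le_add ?_
  intro ε hε hfin
  have hab : infSmoothLength S a b ≠ ⊤ := (lt_of_le_of_lt le_self_add hfin).ne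
  have hbc : infSmoothLength S b c ≠ ⊤ := (lt_of_le_of_lt le_add_self hfin).ne
  have hε2 : ((ε : ℝ≥0∞) / 2) ≠ 0 := by
    simpa using hε.ne'
  obtain ⟨_, ⟨γ, hγ, hγ0, hγ1, hγS, rfl⟩, hγL⟩ :=
    sInf_lt_iff.1 (ENNReal.lt_add_right hab hε2)
  obtain ⟨_, ⟨δ, hδ, hδ0, hδ1, hδS, rfl⟩, hδL⟩ :=
    sInf_lt_iff.1 (ENNReal.lt_add_right hbc hε2)
  have hσ : ∀ t : ℝ, smoothTransition t ∈ Icc (0 : ℝ) 1 := fun t =>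
    ⟨smoothTransition.nonneg t, smoothTransition.le_one t⟩
  set η : ℝ → EuclideanSpace ℝ (Fin n) := fun t =>
    γ (smoothTransition (2 * t)) + δ (smoothTransition (2 * t - 1)) - b with hη
  have hη1 : EqOn η (γ ∘ fun t => smoothTransition (2 * t)) (Icc 0 (1 / 2)) := by
    intro t ht
    have : smoothTransition (2 * t - 1) = 0 :=
      smoothTransition.zero_of_nonpos (by linarith [ht.2])
    simp [hη, this, hδ0]
  have hη2 : EqOn η (δ ∘ fun t => smoothTransition (2 * t - 1)) (Icc (1 / 2) 1) := by
    intro t ht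
    have : smoothTransition (2 * t) = 1 :=
      smoothTransition.one_of_one_le (by linarith [ht.1])
    simp [hη, this, hγ1]
  have hσs : ContDiff ℝ (⊤ : ℕ∞) smoothTransition := smoothTransition.contDiff
  have hηc : ContDiff ℝ (⊤ : ℕ∞) η := by
    have h1 : ContDiff ℝ (⊤ : ℕ∞) fun t : ℝ => smoothTransition (2 * t) :=
      hσs.comp (by fun_prop)
    have h2 : ContDiff ℝ (⊤ : ℕ∞) fun t : ℝ => smoothTransition (2 * t - 1) :=
      hσs.comp (by fun_prop)
    exact ((hγ.comp h1).add (hδ.comp h2)).sub contDiff_const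
  have hηS : ∀ t ∈ Icc (0 : ℝ) 1, η t ∈ S := by
    intro t ht
    rcases le_total t (1 / 2) with h | h
    · rw [hη1 ⟨ht.1, h⟩]
      exact hγS _ (hσ _)
    · rw [hη2 ⟨h, ht.2⟩]
      exact hδS _ (hσ _)
  have hη0 : η 0 = a := by
    rw [hη1 ⟨le_rfl, by norm_num⟩]; simp [hγ0]
  have hηe : η 1 = c := by
    rw [hη2 ⟨by norm_num, le_rfl⟩]; norm_num [hδ1]
  refine (infSmoothLength_le hηc hη0 hηe hηS).trans ?_
  have hsplit := eVariationOn.Icc_add_Icc η (s := univ) (a := 0) (b := 1 / 2) (c := (1 : ℝ))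
    (by norm_num) (by norm_num) (mem_univ _)
  simp only [univ_inter] at hsplit
  rw [← hsplit, eVariationOn.congr hη1, eVariationOn.congr hη2]
  have l1 := eVariationOn.comp_le_of_monotoneOn γ (s := Icc 0 1) (t := Icc 0 (1 / 2))
    (fun t : ℝ => smoothTransition (2 * t))
    (fun s _ t _ hst => smoothTransition.monotone (by linarith)) (fun t _ => hσ _)
  have l2 := eVariationOn.comp_le_of_monotoneOn δ (s := Icc 0 1) (t := Icc (1 / 2) 1)
    (fun t : ℝ => smoothTransition (2 * t - 1))
    (fun s _ t _ hst => smoothTransition.monotone (by linarith)) (fun t _ => hσ _)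
  calc _ ≤ (infSmoothLength S a b + ε / 2) + (infSmoothLength S b c + ε / 2) :=
        add_le_add (l1.trans hγL.le) (l2.trans hδL.le)
    _ = infSmoothLength S a b + infSmoothLength S b c + (ε / 2 + ε / 2) := by ring
    _ = _ := by rw [ENNReal.add_halves]

theorem rhoY_le_of_eventually {α β : ℝ → EuclideanSpace ℝ (Fin n)} {C : ℝ≥0∞}
    (hα : Tendsto α (𝓝[>] 0) (𝓝 a)) (hαY : ∀ᶠ s in 𝓝[>] (0 : ℝ), α s ∈ interior Y)
    (hβ : Tendsto β (𝓝[>] 0) (𝓝 b)) (hβY : ∀ᶠ s in 𝓝[>] (0 : ℝ), β s ∈ interior Y)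
    (hC : ∀ᶠ s in 𝓝[>] (0 : ℝ), infSmoothLength (interior Y) (α s) (β s) ≤ C) :
    rhoY Y a b ≤ C := by
  refine liminf_le_of_frequently_le' ?_
  have ht : Tendsto (fun s => (α s, β s)) (𝓝[>] (0 : ℝ))
      ((𝓝 a ⊓ 𝓟 (interior Y)) ×ˢ (𝓝 b ⊓ 𝓟 (interior Y))) :=
    (tendsto_inf.2 ⟨hα, tendsto_principal.2 hαY⟩).prodMk
      (tendsto_inf.2 ⟨hβ, tendsto_principal.2 hβY⟩)
  exact ht.frequently hC.frequently

/-- A curve that is smooth after its starting point and stays in `S` there bounds the intrinsic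
distance from its endpoint to each of its points. -/
theorem infSmoothLength_le_eVariationOn_of_contDiffAt {g : ℝ → EuclideanSpace ℝ (Fin n)}
    (hg : ∀ t ∈ Ioc (0 : ℝ) 1, ContDiffAt ℝ (⊤ : ℕ∞) g t) (hS : ∀ t ∈ Ioc (0 : ℝ) 1, g t ∈ S)
    {s : ℝ} (hs : s ∈ Ioc (0 : ℝ) 1) :
    infSmoothLength S (g s) (g 1) ≤ eVariationOn g (Icc 0 1) := by
  set τ : ℝ → ℝ := fun t => s + (1 - s) * smoothTransition t with hτ
  have hmem : ∀ t, τ t ∈ Ioc (0 : ℝ) 1 := by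
    intro t
    have h0 := smoothTransition.nonneg t
    have h1 := smoothTransition.le_one t
    have hs0 := hs.1
    have hs1 := hs.2
    constructor <;> simp only [hτ] <;> nlinarith
  have hτs : ContDiff ℝ (⊤ : ℕ∞) τ :=
    contDiff_const.add (contDiff_const.mul smoothTransition.contDiff)
  refine (infSmoothLength_le (γ := g ∘ τ) ?_ ?_ ?_ fun t _ => hS _ (hmem t)).trans
    (eVariationOn.comp_le_of_monotoneOn g τ ?_ fun t _ => Ioc_subset_Icc_self (hmem t))
  · exact contDiff_iff_contDiffAt.2 fun t => (hg _ (hmem t)).comp t hτs.contDiffAt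
  · simp [hτ]
  · simp [hτ]
  · intro x _ y _ hxy
    have := smoothTransition.monotone hxy
    have hs1 := hs.2
    simp only [hτ]
    nlinarith

end Paths

section Oscillation

/-- The last passage through `α` before the first passage through `β`. -/
theorem exists_crossing_interval {φ : ℝ → ℝ} {a b α β : ℝ} (hab : a ≤ b)
    (hφ : ContinuousOn φ (Icc a b)) (ha : φ a ≤ α) (hαβ : α ≤ β) (hb : β ≤ φ b) :
    ∃ s t, a ≤ s ∧ s ≤ t ∧ t ≤ b ∧ φ s = α ∧ φ t = β ∧ ∀ x ∈ Icc s t, φ x ∈ Icc α β := by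
  obtain ⟨t, ⟨ht, htβ⟩, htl⟩ : ∃ t, IsLeast (Icc a b ∩ φ ⁻¹' {β}) t := by
    refine IsCompact.exists_isLeast ?_ ?_
    · exact isCompact_Icc.of_isClosed_subset
        (hφ.preimage_isClosed_of_isClosed isClosed_Icc isClosed_singleton) inter_subset_left
    · obtain ⟨t, ht, h⟩ := intermediate_value_Icc hab hφ ⟨ha.trans hαβ, hb⟩
      exact ⟨t, ht, h⟩
  have hφt : ContinuousOn φ (Icc a t) := hφ.mono (Icc_subset_Icc_right ht.2)
  obtain ⟨s, ⟨hs, hsα⟩, hsg⟩ : ∃ s, IsGreatest (Icc a t ∩ φ ⁻¹' {α}) s := by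
    refine IsCompact.exists_isGreatest ?_ ?_
    · exact isCompact_Icc.of_isClosed_subset
        (hφt.preimage_isClosed_of_isClosed isClosed_Icc isClosed_singleton) inter_subset_left
    · obtain ⟨s, hs, h⟩ := intermediate_value_Icc ht.1 hφt ⟨ha, hαβ.trans_eq htβ.symm⟩
      exact ⟨s, hs, h⟩
  have hsα' : φ s = α := hsα
  have htβ' : φ t = β := htβ
  refine ⟨s, t, hs.1, hs.2, ht.2, hsα, htβ, fun x hx => ⟨?_, ?_⟩⟩
  · by_contra! hlt
    obtain ⟨y, hy, hyα⟩ := intermediate_value_Icc hx.2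
      (hφt.mono (Icc_subset_Icc_left (hs.1.trans hx.1))) ⟨hlt.le, hαβ.trans_eq htβ.symm⟩
    have := hsg ⟨⟨(hs.1.trans hx.1).trans hy.1, hy.2⟩, hyα⟩
    have hxs : x = s := le_antisymm (hy.1.trans this) hx.1
    rw [hxs, hsα'] at hlt
    exact lt_irrefl _ hlt
  · by_contra! hlt
    obtain ⟨y, hy, hyβ⟩ := intermediate_value_Icc hx.1
      (hφt.mono (Icc_subset_Icc hs.1 hx.2)) ⟨hsα'.le.trans hαβ, hlt.le⟩
    have := htl ⟨⟨hs.1.trans hy.1, hy.2.trans (hx.2.trans ht.2)⟩, hyβ⟩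
    have hxt : x = t := le_antisymm hx.2 (this.trans hy.2)
    rw [hxt, htβ'] at hlt
    exact lt_irrefl _ hlt

variable {E : Type*} [PseudoEMetricSpace E] {γ : ℝ → E} {φ : ℝ → ℝ} {a b : ℝ} {d : ℝ≥0∞}

theorem nat_mul_le_eVariationOn_of_int_steps (hφ : ContinuousOn φ (Icc a b))
    (H : ∀ s t, a ≤ s → s ≤ t → t ≤ b → ∀ k : ℤ, φ s = k → φ t = k + 1 →
      d ≤ eVariationOn γ (Icc s t)) (hab : a ≤ b) (k : ℤ) (ha : φ a ≤ k) (n : ℕ)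
    (hb : (k : ℝ) + n ≤ φ b) : n * d ≤ eVariationOn γ (Icc a b) := by
  induction n generalizing b with
  | zero => simp
  | succ n ih =>
    push_cast at hb
    obtain ⟨s, t, has, hst, htb, hs, ht, -⟩ := exists_crossing_interval (α := ((k + n : ℤ) : ℝ))
      (β := ((k + n : ℤ) : ℝ) + 1) hab hφ (by push_cast; linarith [n.cast_nonneg (α := ℝ)])
      (by linarith) (by push_cast; linarith)
    have h1 := ih (b := s) (hφ.mono (Icc_subset_Icc_right (hst.trans htb)))
      (fun x y hx hxy hy => H x y hx hxy (hy.trans (hst.trans htb))) has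
      (by rw [hs]; push_cast; exact le_rfl)
    have h2 := H s t has hst htb _ hs ht
    have h3 := eVariationOn.Icc_add_Icc γ (s := univ) has hst (mem_univ _)
    simp only [univ_inter] at h3
    calc ((n + 1 : ℕ) : ℝ≥0∞) * d = n * d + d := by push_cast; ring
      _ ≤ eVariationOn γ (Icc a t) := h3 ▸ add_le_add h1 h2
      _ ≤ _ := eVariationOn.mono _ (Icc_subset_Icc_right htb)

/-- If each passage of `φ` between consecutive integers costs length `d`, a large change
of `φ` costs a large multiple of `d`. -/
theorem nat_mul_le_eVariationOn_of_abs_sub (hφ : ContinuousOn φ (Icc a b)) (hab : a ≤ b)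
    (H : ∀ s t, a ≤ s → s ≤ t → t ≤ b → ∀ k : ℤ,
      (φ s = k ∧ φ t = k + 1) ∨ (φ s = k + 1 ∧ φ t = k) → d ≤ eVariationOn γ (Icc s t))
    (n : ℕ) (hn : (n : ℝ) + 1 ≤ |φ b - φ a|) : n * d ≤ eVariationOn γ (Icc a b) := by
  rcases le_total (φ a) (φ b) with h | h
  · rw [abs_of_nonneg (by linarith)] at hn
    refine nat_mul_le_eVariationOn_of_int_steps hφ
      (fun s t h1 h2 h3 k hs ht => H s t h1 h2 h3 k (.inl ⟨hs, ht⟩)) hab ⌈φ a⌉ (Int.le_ceil _) n ?_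
    linarith [Int.ceil_lt_add_one (φ a)]
  · rw [abs_of_nonpos (by linarith)] at hn
    refine nat_mul_le_eVariationOn_of_int_steps (φ := fun x => -φ x) hφ.neg
      (fun s t h1 h2 h3 k hs ht => H s t h1 h2 h3 (-k - 1) (.inr ⟨?_, ?_⟩)) hab ⌈-φ a⌉
      (Int.le_ceil _) n ?_
    · push_cast; linarith
    · push_cast; linarith
    · linarith [Int.ceil_lt_add_one (-φ a)]

end Oscillation

section Corrugation

/-- The phase of the corrugation at horizontal coordinate `u` and height `v`: its level lines
themselves oscillate rapidly as `v → 0`. -/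
noncomputable def corrugationPhase (u v : ℝ) : ℝ :=
  16 / v * (u / v + cos (π * (40 / v)) / 4)

/-- A corrugation of the `(u, v)`-plane, supported in the sector `4 * u ^ 2 ≤ 3 * v ^ 2`. -/
noncomputable def corrugation (u v : ℝ) : ℝ :=
  v * (smoothTransition (3 - 4 * (u / v) ^ 2) * cos (π * corrugationPhase u v))

theorem abs_corrugation_le (u v : ℝ) : |corrugation u v| ≤ |v| := by
  rw [corrugation, abs_mul, abs_mul, abs_of_nonneg (smoothTransition.nonneg _)]
  exact mul_le_of_le_one_right (abs_nonneg v) (mul_le_one₀ (smoothTransition.le_one _)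
    (abs_nonneg _) (abs_cos_le_one _))

theorem contDiffAt_corrugation {p : ℝ × ℝ} (hp : p.2 ≠ 0) :
    ContDiffAt ℝ (⊤ : ℕ∞) (fun p : ℝ × ℝ => corrugation p.1 p.2) p := by
  have h2 : ContDiffAt ℝ (⊤ : ℕ∞) (fun p : ℝ × ℝ => p.2) p := contDiffAt_snd
  have h1 : ContDiffAt ℝ (⊤ : ℕ∞) (fun p : ℝ × ℝ => p.1 / p.2) p := contDiffAt_fst.div h2 hp
  have hinv : ∀ K : ℝ, ContDiffAt ℝ (⊤ : ℕ∞) (fun p : ℝ × ℝ => K / p.2) p :=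
    fun K => contDiffAt_const.div h2 hp
  have hphase : ContDiffAt ℝ (⊤ : ℕ∞) (fun p : ℝ × ℝ => corrugationPhase p.1 p.2) p :=
    (hinv 16).mul (h1.add (((contDiffAt_const.mul (hinv 40)).cos).div_const 4))
  have hcut : ContDiffAt ℝ (⊤ : ℕ∞)
      (fun p : ℝ × ℝ => smoothTransition (3 - 4 * (p.1 / p.2) ^ 2)) p :=
    smoothTransition.contDiffAt.comp p (contDiffAt_const.sub (contDiffAt_const.mul (h1.pow 2)))
  exact h2.mul (hcut.mul (contDiffAt_const.mul hphase).cos)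

theorem continuous_corrugation : Continuous fun p : ℝ × ℝ => corrugation p.1 p.2 := by
  refine continuous_iff_continuousAt.2 fun p => ?_
  by_cases hp : p.2 = 0
  · have h0 : corrugation p.1 p.2 = 0 := by simp [corrugation, hp]
    rw [ContinuousAt, h0]
    refine squeeze_zero_norm (fun q => abs_corrugation_le q.1 q.2) ?_
    have : Tendsto (fun q : ℝ × ℝ => |q.2|) (𝓝 p) (𝓝 |p.2|) :=
      (continuous_snd.abs).tendsto p
    simpa [hp] using this
  · exact (contDiffAt_corrugation hp).continuousAt

theorem corrugation_eq_zero {u v : ℝ} (h : 3 / 4 ≤ (u / v) ^ 2) : corrugation u v = 0 := by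
  rw [corrugation, smoothTransition.zero_of_nonpos (by linarith)]
  simp

theorem corrugation_eq {u v : ℝ} (h : (u / v) ^ 2 ≤ 1 / 2) :
    corrugation u v = v * cos (π * corrugationPhase u v) := by
  rw [corrugation, smoothTransition.one_of_one_le (by linarith), one_mul]

theorem cos_pi_mul_int_eq (k : ℤ) :
    (cos (π * k) = 1 ∧ cos (π * (k + 1)) = -1) ∨ (cos (π * k) = -1 ∧ cos (π * (k + 1)) = 1) := by
  have h : cos (π * (k + 1)) = -cos (π * k) := by rw [mul_add, mul_one, cos_add_pi]
  have h1 : cos (π * k) = 1 ∨ cos (π * k) = -1 := by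
    rw [← abs_eq zero_le_one, mul_comm]
    exact abs_cos_int_mul_pi k
  rcases h1 with h1 | h1
  · exact .inl ⟨h1, by rw [h, h1]⟩
  · exact .inr ⟨h1, by rw [h, h1, neg_neg]⟩

/-- Descending to the next level at which the oscillation of the level lines is extremal, without
moving much sideways, changes the phase. -/
theorem two_le_abs_corrugationPhase_sub {u u' v v' r : ℝ} {k : ℤ} (hr : 0 < r) (hv : r ≤ v)
    (hv' : r ≤ v') (hv1 : v ≤ 1) (hu : |u| ≤ v / 2)
    (hk : 40 / v = k) (hk' : 40 / v' = k + 1) (huu : |u - u'| ≤ r / 16) :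
    2 ≤ |corrugationPhase u v - corrugationPhase u' v'| := by
  have hv0 : 0 < v := hr.trans_le hv
  have hv0' : 0 < v' := hr.trans_le hv'
  set l := 1 / v with hl
  set l' := 1 / v' with hl'
  have e1 : corrugationPhase u v = 16 * (u * l ^ 2 + l * cos (π * k) / 4) := by
    rw [corrugationPhase, hk, hl]; field_simp
  have e2 : corrugationPhase u' v' = 16 * (u' * l' ^ 2 + l' * cos (π * (k + 1)) / 4) := by
    rw [corrugationPhase, hk', hl']; field_simp
  have hll : l' = l + 1 / 40 := by
    have h1 : 40 * l = k := by rw [← hk, hl]; ring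
    have h2 : 40 * l' = k + 1 := by rw [← hk', hl']; ring
    linarith
  have hl1 : 1 ≤ l := by rw [hl, le_div_iff₀ hv0]; linarith
  have hl1' : 1 ≤ l' := by linarith
  have hrl : r * l' ≤ 1 := by rw [hl', mul_one_div, div_le_one hv0']; exact hv'
  have hD : |u * l ^ 2 - u' * l' ^ 2| ≤ (l + l') / 8 := by
    have hs : u * l ^ 2 - u' * l' ^ 2 = (u - u') * l' ^ 2 + -(u * ((l + l') / 40)) := by
      rw [show (l + l') / 40 = (l' - l) * (l + l') by rw [hll]; ring]; ring
    rw [hs]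
    refine (abs_add_le _ _).trans ?_
    rw [abs_neg, abs_mul, abs_mul, abs_of_nonneg (sq_nonneg l'),
      abs_of_nonneg (by linarith : 0 ≤ (l + l') / 40)]
    have h1 : |u - u'| * l' ^ 2 ≤ l' / 16 := by
      calc |u - u'| * l' ^ 2 ≤ r / 16 * l' ^ 2 := by gcongr
        _ = r * l' * l' / 16 := by ring
        _ ≤ 1 * l' / 16 := by gcongr
        _ = l' / 16 := by ring
    have h2 : |u| * ((l + l') / 40) ≤ 1 / 2 * ((l + l') / 40) := by
      gcongr; linarith
    linarith
  have hD' := abs_le.1 hD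
  rw [e1, e2]
  rcases cos_pi_mul_int_eq k with ⟨h1, h2⟩ | ⟨h1, h2⟩ <;> rw [h1, h2]
  · exact le_abs.2 (.inl (by linarith [hD'.1]))
  · exact le_abs.2 (.inr (by linarith [hD'.2]))

end Corrugation

section Crossing

theorem ofReal_abs_sub_le_eVariationOn {n : ℕ} {γ : ℝ → EuclideanSpace ℝ (Fin n)} {s t : ℝ}
    (hst : s ≤ t) (i : Fin n) :
    ENNReal.ofReal |γ s i - γ t i| ≤ eVariationOn γ (Icc s t) := by
  refine le_trans ?_ (eVariationOn.edist_le γ (left_mem_Icc.2 hst) (right_mem_Icc.2 hst))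
  rw [edist_dist, dist_eq_norm]
  refine ENNReal.ofReal_le_ofReal ?_
  simpa using PiLp.norm_apply_le (γ s - γ t) i

variable {γ : ℝ → EuclideanSpace ℝ (Fin 3)} {a b r : ℝ}

theorem continuousOn_corrugationPhase (hγ : Continuous γ) {S : Set ℝ} (h : ∀ t ∈ S, γ t 2 ≠ 0) :
    ContinuousOn (fun t => corrugationPhase (γ t 0) (γ t 2)) S := by
  have h0 : Continuous fun t => γ t 0 := by fun_prop
  have h2 : Continuous fun t => γ t 2 := by fun_prop
  unfold corrugationPhase
  exact (continuousOn_const.div h2.continuousOn h).mul ((h0.continuousOn.div h2.continuousOn h).add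
    ((continuous_cos.comp_continuousOn (continuousOn_const.mul
      (continuousOn_const.div h2.continuousOn h))).div_const 4))

/-- A curve in a thin slab around the corrugation climbs up and down each time
the phase passes from an integer to the next. -/
theorem nat_mul_le_eVariationOn_of_corrugationPhase (hγ : Continuous γ) (hab : a ≤ b) (hr : 0 < r)
    (h : ∀ t ∈ Icc a b, r ≤ γ t 2 ∧
      |γ t 1 - γ t 2 * cos (π * corrugationPhase (γ t 0) (γ t 2))| ≤ γ t 2 / 2)
    (n : ℕ) (hn : (n : ℝ) + 1 ≤
      |corrugationPhase (γ b 0) (γ b 2) - corrugationPhase (γ a 0) (γ a 2)|) :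
    n * ENNReal.ofReal r ≤ eVariationOn γ (Icc a b) := by
  refine nat_mul_le_eVariationOn_of_abs_sub
    (φ := fun t => corrugationPhase (γ t 0) (γ t 2)) ?_ hab ?_ n hn
  · exact continuousOn_corrugationPhase hγ fun t ht => (hr.trans_le (h t ht).1).ne'
  · intro s t has hst htb k hk
    refine (ENNReal.ofReal_le_ofReal ?_).trans (ofReal_abs_sub_le_eVariationOn hst 1)
    obtain ⟨hs1, hs2⟩ := h s ⟨has, hst.trans htb⟩
    obtain ⟨ht1, ht2⟩ := h t ⟨has.trans hst, htb⟩
    rw [abs_le] at hs2 ht2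
    rcases hk with ⟨k1, k2⟩ | ⟨k1, k2⟩ <;> simp only [] at k1 k2 <;> rw [k1] at hs2 <;>
      rw [k2] at ht2 <;> rcases cos_pi_mul_int_eq k with ⟨h1, h2⟩ | ⟨h1, h2⟩ <;>
      simp only [h1, h2] at hs2 ht2
    · exact le_abs.2 (.inl (by linarith))
    · exact le_abs.2 (.inr (by linarith))
    · exact le_abs.2 (.inr (by linarith))
    · exact le_abs.2 (.inl (by linarith))

/-- Changing the height by a factor of two inside the corrugated sector is expensive. -/
theorem one_le_eVariationOn_of_height (hγ : Continuous γ) (hab : a ≤ b) (hr : 0 < r)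
    (h : ∀ t ∈ Icc a b, r ≤ γ t 2 ∧ γ t 2 ≤ 1 ∧ |γ t 0| ≤ γ t 2 / 2 ∧
      |γ t 1 - γ t 2 * cos (π * corrugationPhase (γ t 0) (γ t 2))| ≤ γ t 2 / 2)
    (hrab : 20 / r ≤ |40 / γ b 2 - 40 / γ a 2|) : 1 ≤ eVariationOn γ (Icc a b) := by
  have hr1 : r ≤ 1 := (h a ⟨le_rfl, hab⟩).1.trans (h a ⟨le_rfl, hab⟩).2.1
  have hri : 1 ≤ 1 / r := by rw [le_div_iff₀ hr]; linarith
  have key := nat_mul_le_eVariationOn_of_abs_sub (γ := γ) (d := ENNReal.ofReal (r / 16))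
    (φ := fun t => 40 / γ t 2) (a := a) (b := b) ?_ hab ?_ ⌈16 / r⌉₊ ?_
  · refine le_trans ?_ key
    rw [← ENNReal.ofReal_natCast, ← ENNReal.ofReal_mul (Nat.cast_nonneg _), ENNReal.one_le_ofReal]
    have := Nat.le_ceil (16 / r)
    calc (1 : ℝ) = 16 / r * (r / 16) := by field_simp
      _ ≤ _ := by gcongr
  · have h2 : Continuous fun t => γ t 2 := by fun_prop
    exact continuousOn_const.div h2.continuousOn fun t ht => (hr.trans_le (h t ht).1).ne'
  · intro s t has hst htb k hk
    by_contra! hlt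
    have hu : |γ s 0 - γ t 0| ≤ r / 16 := by
      by_contra! hu
      exact absurd ((ENNReal.ofReal_le_ofReal hu.le).trans
        (ofReal_abs_sub_le_eVariationOn hst 0)) (not_le.2 hlt)
    obtain ⟨s1, s2, s3, -⟩ := h s ⟨has, hst.trans htb⟩
    obtain ⟨t1, t2, t3, -⟩ := h t ⟨has.trans hst, htb⟩
    have hph : 2 ≤ |corrugationPhase (γ t 0) (γ t 2) - corrugationPhase (γ s 0) (γ s 2)| := by
      rcases hk with ⟨k1, k2⟩ | ⟨k1, k2⟩
      · rw [abs_sub_comm]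
        exact two_le_abs_corrugationPhase_sub hr s1 t1 s2 s3 k1 k2 hu
      · exact two_le_abs_corrugationPhase_sub hr t1 s1 t2 t3 k2 k1 (by rwa [abs_sub_comm])
    have := nat_mul_le_eVariationOn_of_corrugationPhase hγ hst hr
      (fun x hx => ⟨(h x ⟨has.trans hx.1, hx.2.trans htb⟩).1,
        (h x ⟨has.trans hx.1, hx.2.trans htb⟩).2.2.2⟩) 1 (by norm_num; exact hph)
    rw [Nat.cast_one, one_mul] at this
    exact absurd ((ENNReal.ofReal_le_ofReal (by linarith)).trans this) (not_le.2 hlt)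
  · refine le_trans ?_ hrab
    have := Nat.ceil_lt_add_one (by positivity : 0 ≤ 16 / r)
    have e1 : 16 / r = 16 * (1 / r) := by ring
    have e2 : 20 / r = 20 * (1 / r) := by ring
    linarith

/-- Every curve in a thin slab around the corrugation that crosses the corrugated sector has
length at least one. -/
theorem one_le_eVariationOn_of_crossing (hγ : Continuous γ) (hab : a ≤ b)
    (h : ∀ t ∈ Icc a b, 0 < γ t 2 ∧ γ t 2 ≤ 1 ∧
      |γ t 1 - corrugation (γ t 0) (γ t 2)| ≤ γ t 2 / 2)
    (ha : γ a 0 / γ a 2 ≤ -1 / 2) (hb : 1 / 2 ≤ γ b 0 / γ b 2) :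
    1 ≤ eVariationOn γ (Icc a b) := by
  have h0 : Continuous fun t => γ t 0 := by fun_prop
  have h2 : Continuous fun t => γ t 2 := by fun_prop
  obtain ⟨s, t, has, hst, htb, hs, ht, hc⟩ := exists_crossing_interval
    (φ := fun t => γ t 0 / γ t 2) hab
    (h0.continuousOn.div h2.continuousOn fun t ht => (h t ht).1.ne') ha (by norm_num) hb
  have hsub : Icc s t ⊆ Icc a b := Icc_subset_Icc has htb
  refine le_trans ?_ (eVariationOn.mono γ hsub)
  obtain ⟨m, hm, hmin⟩ := isCompact_Icc.exists_isMinOn (nonempty_Icc.2 hst) h2.continuousOn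
  set r := γ m 2 with hr_def
  have hr : 0 < r := (h m (hsub hm)).1
  have hr1 : r ≤ 1 := (h m (hsub hm)).2.1
  have hri : 1 ≤ 1 / r := by rw [le_div_iff₀ hr]; linarith
  have hslab : ∀ x ∈ Icc s t, r ≤ γ x 2 ∧ γ x 2 ≤ 1 ∧ |γ x 0| ≤ γ x 2 / 2 ∧
      |γ x 1 - γ x 2 * cos (π * corrugationPhase (γ x 0) (γ x 2))| ≤ γ x 2 / 2 := by
    intro x hx
    obtain ⟨x1, x2, x3⟩ := h x (hsub hx)
    obtain ⟨c1, c2⟩ := hc x hx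
    rw [corrugation_eq (by nlinarith)] at x3
    refine ⟨hmin hx, x2, ?_, x3⟩
    rw [le_div_iff₀ x1] at c1
    rw [div_le_iff₀ x1] at c2
    exact abs_le.2 ⟨by linarith, by linarith⟩
  by_cases hmax : ∀ x ∈ Icc s t, γ x 2 ≤ 2 * r
  · have hns := neg_one_le_cos (π * (40 / γ s 2))
    have hs1 := cos_le_one (π * (40 / γ s 2))
    have hnt := neg_one_le_cos (π * (40 / γ t 2))
    have ht1 := cos_le_one (π * (40 / γ t 2))
    have hsm := left_mem_Icc.2 hst
    have htm := right_mem_Icc.2 hst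
    have hbound : ∀ x ∈ Icc s t, 2 / r ≤ 4 / γ x 2 := fun x hx => by
      rw [div_le_div_iff₀ hr (hr.trans_le (hslab x hx).1)]
      linarith [hmax x hx]
    have hps : corrugationPhase (γ s 0) (γ s 2) ≤ -(2 / r) := by
      have h16 : 0 < 16 / γ s 2 := div_pos (by norm_num) (h s (hsub hsm)).1
      have e : 16 / γ s 2 = 4 * (4 / γ s 2) := by ring
      have := hbound s hsm
      simp only [] at hs
      rw [corrugationPhase, hs]
      nlinarith
    have hpt : 2 / r ≤ corrugationPhase (γ t 0) (γ t 2) := by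
      have h16 : 0 < 16 / γ t 2 := div_pos (by norm_num) (h t (hsub htm)).1
      have e : 16 / γ t 2 = 4 * (4 / γ t 2) := by ring
      have := hbound t htm
      simp only [] at ht
      rw [corrugationPhase, ht]
      nlinarith
    have hceil := Nat.ceil_lt_add_one (by positivity : 0 ≤ 1 / r)
    have e2 : 2 / r = 2 * (1 / r) := by ring
    refine le_trans ?_ (nat_mul_le_eVariationOn_of_corrugationPhase hγ hst hr
      (fun x hx => ⟨(hslab x hx).1, (hslab x hx).2.2.2⟩) ⌈1 / r⌉₊
      (le_abs.2 (.inl (by linarith))))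
    rw [← ENNReal.ofReal_natCast, ← ENNReal.ofReal_mul (Nat.cast_nonneg _), ENNReal.one_le_ofReal]
    have := Nat.le_ceil (1 / r)
    calc (1 : ℝ) = 1 / r * r := by field_simp
      _ ≤ _ := by gcongr
  · push Not at hmax
    obtain ⟨M, hM, hMr⟩ := hmax
    have hends : |40 / r - 40 / (2 * r)| = 20 / r := by
      rw [show 40 / r - 40 / (2 * r) = 20 / r by field_simp; ring]
      exact abs_of_pos (by positivity)
    rcases le_total m M with hmM | hMm
    · obtain ⟨x, y, hx, hxy, hy, hxe, hye, -⟩ := exists_crossing_interval (φ := fun t => γ t 2)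
        (α := r) (β := 2 * r) hmM h2.continuousOn le_rfl (by linarith) hMr.le
      have hsub' : Icc x y ⊆ Icc s t := Icc_subset_Icc (hm.1.trans hx) (hy.trans hM.2)
      simp only [] at hxe hye
      refine (one_le_eVariationOn_of_height hγ hxy hr (fun z hz => hslab z (hsub' hz)) ?_).trans
        (eVariationOn.mono γ hsub')
      rw [hxe, hye, abs_sub_comm, hends]
    · obtain ⟨x, y, hx, hxy, hy, hxe, hye, -⟩ := exists_crossing_interval (φ := fun t => -γ t 2)
        (α := -(2 * r)) (β := -r) hMm h2.neg.continuousOn (by linarith) (by linarith) le_rfl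
      have hsub' : Icc x y ⊆ Icc s t := Icc_subset_Icc (hM.1.trans hx) (hy.trans hm.2)
      simp only [neg_inj] at hxe hye
      refine (one_le_eVariationOn_of_height hγ hxy hr (fun z hz => hslab z (hsub' hz)) ?_).trans
        (eVariationOn.mono γ hsub')
      rw [hxe, hye, hends]

end Crossing

section HalfSpaceCharts

/-- The closed half-space of `ℝ³`. -/
abbrev HalfSpace3 : Type :=
  {x : EuclideanSpace ℝ (Fin 3) // ∀ i : Fin 3, (i : ℕ) = 0 → 0 ≤ x i}

theorem norm_add_single_sq (x : EuclideanSpace ℝ (Fin 3)) (c : ℝ) :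
    ‖x + EuclideanSpace.single 0 c‖ ^ 2 = ‖x‖ ^ 2 + 2 * c * x 0 + c ^ 2 := by
  simp only [EuclideanSpace.norm_sq_eq, Fin.sum_univ_three, Real.norm_eq_abs, sq_abs]
  simp
  ring

theorem single_zero_add (a b : ℝ) : EuclideanSpace.single (0 : Fin 3) a +
    EuclideanSpace.single 0 b = EuclideanSpace.single 0 (a + b) := by
  ext i
  by_cases h : i = 0 <;> simp [h]

theorem single_zero_neg (a : ℝ) :
    -EuclideanSpace.single (0 : Fin 3) a = EuclideanSpace.single 0 (-a) := by
  ext i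
  by_cases h : i = 0 <;> simp [h]

theorem HalfSpace3.add_single_ne_zero (z : HalfSpace3) :
    z.1 + EuclideanSpace.single 0 (1 / 2) ≠ 0 := by
  intro h
  have hz : 0 ≤ z.1 0 := z.2 0 rfl
  have h0 := congrArg (fun w : EuclideanSpace ℝ (Fin 3) => w 0) h
  simp at h0
  linarith

/-- The closed unit ball without one boundary point is homeomorphic to a closed half-space,
by inversion at that point. -/
noncomputable def puncturedBallHomeomorph :
    ↥({-EuclideanSpace.single 0 1}ᶜ ∩ Metric.closedBall (0 : EuclideanSpace ℝ (Fin 3)) 1) ≃ₜ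
      HalfSpace3 where
  toFun x := ⟨(‖x.1 + EuclideanSpace.single 0 1‖ ^ 2)⁻¹ • (x.1 + EuclideanSpace.single 0 1) +
      EuclideanSpace.single 0 (-1 / 2), by
    intro i hi
    obtain rfl : i = 0 := Fin.ext hi
    have hne : x.1 + EuclideanSpace.single 0 1 ≠ 0 := fun h => x.2.1 (eq_neg_of_add_eq_zero_left h)
    have hpos : 0 < ‖x.1 + EuclideanSpace.single 0 1‖ ^ 2 := by positivity
    have hb : ‖x.1‖ ≤ 1 := by simpa using x.2.2
    have hle : ‖x.1 + EuclideanSpace.single 0 1‖ ^ 2 ≤ 2 * (x.1 0 + 1) := by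
      rw [norm_add_single_sq]
      nlinarith [norm_nonneg x.1]
    simp only [PiLp.add_apply, PiLp.smul_apply, smul_eq_mul, PiLp.single_apply, if_true]
    rw [inv_mul_eq_div]
    have : 1 / 2 ≤ (x.1 0 + 1) / ‖x.1 + EuclideanSpace.single 0 1‖ ^ 2 := by
      rw [le_div_iff₀ hpos]; linarith
    linarith⟩
  invFun z := ⟨(‖z.1 + EuclideanSpace.single 0 (1 / 2)‖ ^ 2)⁻¹ •
      (z.1 + EuclideanSpace.single 0 (1 / 2)) + EuclideanSpace.single 0 (-1), by
    have hz : 0 ≤ z.1 0 := z.2 0 rfl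
    set y := z.1 + EuclideanSpace.single 0 (1 / 2) with hy
    have hy0 : 1 / 2 ≤ y 0 := by simp [hy, hz]
    have hyn : y ≠ 0 := by rintro h; rw [h] at hy0; norm_num at hy0
    have hpos : 0 < ‖y‖ ^ 2 := by positivity
    refine ⟨?_, ?_⟩
    · intro h
      rw [mem_singleton_iff, single_zero_neg, add_eq_right, smul_eq_zero] at h
      exact h.elim (by positivity) hyn
    · rw [mem_closedBall_zero_iff, ← sq_le_one_iff₀ (norm_nonneg _), norm_add_single_sq,
        norm_smul, PiLp.smul_apply, norm_inv, norm_pow, norm_norm, smul_eq_mul]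
      have : (‖y‖ ^ 2)⁻¹ * ‖y‖ = ‖y‖⁻¹ := by field_simp
      rw [this, inv_pow]
      have := mul_le_mul_of_nonneg_left hy0 (inv_nonneg.2 hpos.le)
      linarith⟩
  left_inv x := by
    have hne : x.1 + EuclideanSpace.single 0 1 ≠ 0 := fun h => x.2.1 (eq_neg_of_add_eq_zero_left h)
    refine Subtype.ext ?_
    have e : ∀ w : EuclideanSpace ℝ (Fin 3),
        w + EuclideanSpace.single 0 (-1 / 2) + EuclideanSpace.single 0 (1 / 2) = w := by
      intro w
      rw [add_assoc, single_zero_add]; norm_num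
    simp only [e, norm_smul, norm_inv, norm_pow, norm_norm, smul_smul]
    have hpos : 0 < ‖x.1 + EuclideanSpace.single 0 1‖ := by positivity
    have : (((‖x.1 + EuclideanSpace.single 0 1‖ ^ 2)⁻¹ * ‖x.1 + EuclideanSpace.single 0 1‖) ^ 2)⁻¹ *
        (‖x.1 + EuclideanSpace.single 0 1‖ ^ 2)⁻¹ = 1 := by
      field_simp
    rw [this, one_smul, add_assoc, single_zero_add]
    norm_num
  right_inv z := by
    have hyn := HalfSpace3.add_single_ne_zero z
    refine Subtype.ext ?_
    have e : ∀ w : EuclideanSpace ℝ (Fin 3),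
        w + EuclideanSpace.single 0 (-1) + EuclideanSpace.single 0 1 = w := by
      intro w
      rw [add_assoc, single_zero_add]; norm_num
    simp only [e, norm_smul, norm_inv, norm_pow, norm_norm, smul_smul]
    set y := z.1 + EuclideanSpace.single 0 (1 / 2) with hy
    have hpos : 0 < ‖y‖ := by positivity
    have : (((‖y‖ ^ 2)⁻¹ * ‖y‖) ^ 2)⁻¹ * (‖y‖ ^ 2)⁻¹ = 1 := by
      field_simp
    rw [this, one_smul, hy, add_assoc, single_zero_add]
    norm_num
  continuous_toFun := by
    refine Continuous.subtype_mk ?_ _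
    have hc : Continuous fun x : ↥({-EuclideanSpace.single 0 1}ᶜ ∩
        Metric.closedBall (0 : EuclideanSpace ℝ (Fin 3)) 1) =>
        x.1 + EuclideanSpace.single 0 1 := continuous_subtype_val.add continuous_const
    refine (((hc.norm.pow 2).inv₀ fun x => ?_).smul hc).add continuous_const
    have hne : x.1 + EuclideanSpace.single 0 1 ≠ 0 := fun h => x.2.1 (eq_neg_of_add_eq_zero_left h)
    exact pow_ne_zero 2 (norm_ne_zero_iff.2 hne)
  continuous_invFun := by
    refine Continuous.subtype_mk ?_ _
    have hc : Continuous fun z : HalfSpace3 =>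
        z.1 + EuclideanSpace.single 0 (1 / 2) := continuous_subtype_val.add continuous_const
    refine (((hc.norm.pow 2).inv₀ fun z => ?_).smul hc).add continuous_const
    have hyn := HalfSpace3.add_single_ne_zero z
    exact pow_ne_zero 2 (norm_ne_zero_iff.2 hyn)

theorem exists_chart_of_homeomorph_closedBall
    (Θ : EuclideanSpace ℝ (Fin 3) ≃ₜ EuclideanSpace ℝ (Fin 3)) {x : EuclideanSpace ℝ (Fin 3)}
    (hx : x ≠ Θ (-EuclideanSpace.single 0 1)) :
    ∃ U : Set (EuclideanSpace ℝ (Fin 3)), IsOpen U ∧ x ∈ U ∧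
      ∃ V : Set HalfSpace3, IsOpen V ∧
        Nonempty (↥(U ∩ Θ '' Metric.closedBall 0 1) ≃ₜ ↥V) := by
  refine ⟨Θ '' {-EuclideanSpace.single 0 1}ᶜ, Θ.isOpenMap _ isOpen_compl_singleton, ?_, univ,
    isOpen_univ, ⟨?_⟩⟩
  · rw [Θ.image_eq_preimage_symm]
    intro h
    exact hx (by rw [← show Θ.symm x = _ from h, Θ.apply_symm_apply])
  · exact (Homeomorph.setCongr (image_inter Θ.injective).symm).trans
      ((Θ.image _).symm.trans (puncturedBallHomeomorph.trans (Homeomorph.Set.univ _).symm))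

/-- The image of a convex body under a homeomorphism of `ℝ³` is a submanifold with boundary. -/
theorem isC0SubmanifoldWithBoundary_image_convex
    (Φ : EuclideanSpace ℝ (Fin 3) ≃ₜ EuclideanSpace ℝ (Fin 3)) {K : Set (EuclideanSpace ℝ (Fin 3))}
    (hK : Convex ℝ K) (hKc : IsCompact K) (hKi : (interior K).Nonempty) :
    IsC0SubmanifoldWithBoundary 3 (Φ '' K) := by
  have hne : K.Nonempty := hKi.mono interior_subset
  refine ⟨hKc.image Φ.continuous, (hK.isConnected hne).image Φ Φ.continuous.continuousOn, ?_, ?_⟩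
  · rw [nonempty_iff_ne_empty, Ne, ← isClopen_iff_frontier_eq_empty, isClopen_iff]
    rintro (h | h)
    · exact (hne.image Φ).ne_empty h
    · exact noncompact_univ (EuclideanSpace ℝ (Fin 3)) (h ▸ hKc.image Φ.continuous)
  · obtain ⟨e, -, he, -⟩ := exists_homeomorph_image_interior_closure_frontier_eq_unitBall hK hKi
      hKc.isBounded
    rw [hKc.isClosed.closure_eq] at he
    set Θ := e.symm.trans Φ with hΘ
    have hΘK : Φ '' K = Θ '' Metric.closedBall 0 1 := by
      rw [← he, image_image]
      simp [hΘ]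
    intro y _
    by_cases hy : y = Θ (-EuclideanSpace.single 0 1)
    · set Θ' := (Homeomorph.neg (EuclideanSpace ℝ (Fin 3))).trans Θ with hΘ'
      have hΘK' : Φ '' K = Θ' '' Metric.closedBall 0 1 := by
        rw [hΘK, show (Θ' : EuclideanSpace ℝ (Fin 3) → _) = Θ ∘ Neg.neg from rfl, image_comp]
        congr 1
        rw [image_neg_eq_neg, neg_closedBall, neg_zero]
      rw [hΘK']
      refine exists_chart_of_homeomorph_closedBall Θ' ?_
      rw [hy]
      intro h
      have := Θ.injective (h : Θ _ = Θ (- -EuclideanSpace.single 0 1))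
      have h0 := congrArg (fun w : EuclideanSpace ℝ (Fin 3) => w 0) this
      norm_num at h0
    · rw [hΘK]
      exact exists_chart_of_homeomorph_closedBall Θ hy

end HalfSpaceCharts

section ShearedPyramid

theorem eVariationOn_le_of_lipschitzOnWith {E : Type*} [PseudoEMetricSpace E] {g : ℝ → E}
    {K : NNReal} (h : LipschitzOnWith K g (Icc 0 1)) : eVariationOn g (Icc 0 1) ≤ K := by
  have hid : eVariationOn (id : ℝ → ℝ) (Icc 0 1) ≤ 1 := by
    simp
  calc eVariationOn (g ∘ id) (Icc 0 1) ≤ K * eVariationOn id (Icc (0 : ℝ) 1) :=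
        h.comp_eVariationOn_le (mapsTo_id _)
    _ ≤ K * 1 := by gcongr
    _ = K := mul_one _

/-- The homeomorphism of `ℝ³` shifting the middle coordinate by the corrugation. -/
noncomputable def shear : EuclideanSpace ℝ (Fin 3) ≃ₜ EuclideanSpace ℝ (Fin 3) where
  toFun q := q + corrugation (q 0) (q 2) • EuclideanSpace.single 1 1
  invFun q := q - corrugation (q 0) (q 2) • EuclideanSpace.single 1 1
  left_inv q := by simp
  right_inv q := by simp
  continuous_toFun := continuous_id.add ((continuous_corrugation.comp
    (f := fun q : EuclideanSpace ℝ (Fin 3) => (q 0, q 2)) (by fun_prop)).smul continuous_const)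
  continuous_invFun := continuous_id.sub ((continuous_corrugation.comp
    (f := fun q : EuclideanSpace ℝ (Fin 3) => (q 0, q 2)) (by fun_prop)).smul continuous_const)

theorem shear_apply (q : EuclideanSpace ℝ (Fin 3)) :
    shear q = q + corrugation (q 0) (q 2) • EuclideanSpace.single 1 1 := rfl

theorem shear_apply_zero (q : EuclideanSpace ℝ (Fin 3)) : shear q 0 = q 0 := by simp [shear_apply]

theorem shear_apply_one (q : EuclideanSpace ℝ (Fin 3)) :
    shear q 1 = q 1 + corrugation (q 0) (q 2) := by
  simp [shear_apply]

theorem shear_apply_two (q : EuclideanSpace ℝ (Fin 3)) : shear q 2 = q 2 := by simp [shear_apply]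

theorem contDiffAt_shear {q : EuclideanSpace ℝ (Fin 3)} (hq : q 2 ≠ 0) :
    ContDiffAt ℝ (⊤ : ℕ∞) shear q := by
  have h : ContDiffAt ℝ (⊤ : ℕ∞) (fun q : EuclideanSpace ℝ (Fin 3) => (q 0, q 2)) q := by fun_prop
  exact contDiffAt_id.add ((ContDiffAt.comp (f := fun q : EuclideanSpace ℝ (Fin 3) => (q 0, q 2)) q
    (contDiffAt_corrugation hq) h).smul contDiffAt_const)

theorem shear_smul {b : EuclideanSpace ℝ (Fin 3)} (hb : 3 / 4 ≤ (b 0 / b 2) ^ 2) (t : ℝ) :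
    shear (t • b) = t • b := by
  have h : corrugation (t * b 0) (t * b 2) = 0 := by
    rcases eq_or_ne t 0 with rfl | ht
    · simp [corrugation]
    · exact corrugation_eq_zero (by rwa [mul_div_mul_left _ _ ht])
  simp [shear_apply, h]

/-- A pyramid with apex at the origin. -/
def pyramid : Set (EuclideanSpace ℝ (Fin 3)) := {q | |q 0| ≤ q 2 ∧ |q 1| ≤ q 2 / 2 ∧ q 2 ≤ 1}

theorem convex_pyramid : Convex ℝ pyramid := by
  intro p hp q hq s t hs ht hst
  simp only [pyramid, mem_ofPred_eq, abs_le, PiLp.add_apply, PiLp.smul_apply, smul_eq_mul] at *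
  obtain ⟨⟨p1, p2⟩, ⟨p3, p4⟩, p5⟩ := hp
  obtain ⟨⟨q1, q2⟩, ⟨q3, q4⟩, q5⟩ := hq
  refine ⟨⟨?_, ?_⟩, ⟨?_, ?_⟩, ?_⟩ <;> nlinarith

theorem isCompact_pyramid : IsCompact pyramid := by
  refine Metric.isCompact_of_isClosed_isBounded ?_ ?_
  · have hc : ∀ i, Continuous fun q : EuclideanSpace ℝ (Fin 3) => q i := fun i => by fun_prop
    exact (isClosed_le (hc 0).abs (hc 2)).inter
      ((isClosed_le (hc 1).abs ((hc 2).div_const 2)).inter (isClosed_le (hc 2) continuous_const))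
  · refine isBounded_iff_forall_norm_le.2 ⟨2, fun q ⟨h0, h1, h2⟩ => ?_⟩
    refine abs_le_of_sq_le_sq' ?_ (by norm_num) |>.2
    rw [EuclideanSpace.norm_sq_eq, Fin.sum_univ_three]
    simp only [Real.norm_eq_abs]
    have h3 : |q 2| ≤ 1 := abs_le.2 ⟨by linarith [abs_nonneg (q 0)], h2⟩
    nlinarith [abs_nonneg (q 0), abs_nonneg (q 1), abs_nonneg (q 2)]

theorem mem_interior_pyramid {q : EuclideanSpace ℝ (Fin 3)} (h0 : |q 0| < q 2)
    (h1 : |q 1| < q 2 / 2) (h2 : q 2 < 1) : q ∈ interior pyramid := by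
  refine mem_interior.2 ⟨{q | |q 0| < q 2 ∧ |q 1| < q 2 / 2 ∧ q 2 < 1},
    fun q h => ⟨h.1.le, h.2.1.le, h.2.2.le⟩, ?_, h0, h1, h2⟩
  have hc : ∀ i, Continuous fun q : EuclideanSpace ℝ (Fin 3) => q i := fun i => by fun_prop
  exact (isOpen_lt (hc 0).abs (hc 2)).inter
    ((isOpen_lt (hc 1).abs ((hc 2).div_const 2)).inter (isOpen_lt (hc 2) continuous_const))

theorem eq_zero_of_mem_pyramid {q : EuclideanSpace ℝ (Fin 3)} (hq : q ∈ pyramid) (h2 : q 2 = 0) :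
    q = 0 := by
  obtain ⟨h0, h1, -⟩ := hq
  rw [h2] at h0 h1
  ext i
  fin_cases i
  · simpa using h0
  · simpa using h1
  · simpa using h2

theorem pos_of_mem_interior_pyramid {q : EuclideanSpace ℝ (Fin 3)} (hq : q ∈ interior pyramid) :
    0 < q 2 := by
  refine ((abs_nonneg _).trans (interior_subset hq).1).lt_of_ne' fun h2 => ?_
  have hc : Tendsto (fun t : ℝ => q - t • EuclideanSpace.single 2 1) (𝓝[>] 0) (𝓝 q) := by
    have : Continuous fun t : ℝ => q - t • (EuclideanSpace.single 2 1 : EuclideanSpace ℝ (Fin 3)) := by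
      fun_prop
    simpa using (this.tendsto 0).mono_left nhdsWithin_le_nhds
  obtain ⟨t, ht, ht0⟩ := ((hc.eventually (mem_interior_iff_mem_nhds.1 hq)).and
    self_mem_nhdsWithin).exists
  have h := (abs_nonneg _).trans ht.1
  have ht0' : 0 < t := ht0
  simp [h2] at h
  linarith

theorem interior_image_shear : interior (shear '' pyramid) = shear '' interior pyramid :=
  (shear.image_interior _).symm

theorem mem_interior_image_shear {p : EuclideanSpace ℝ (Fin 3)}
    (hp : p ∈ interior (shear '' pyramid)) :
    0 < p 2 ∧ p 2 ≤ 1 ∧ |p 1 - corrugation (p 0) (p 2)| ≤ p 2 / 2 := by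
  rw [interior_image_shear] at hp
  obtain ⟨q, hq, rfl⟩ := hp
  have h := interior_subset hq
  simp only [shear_apply_zero, shear_apply_one, shear_apply_two, add_sub_cancel_right]
  exact ⟨pos_of_mem_interior_pyramid hq, h.2.2, h.2.1⟩

variable {q b : EuclideanSpace ℝ (Fin 3)}

theorem shear_segment_mem_interior (hq : q ∈ pyramid) (hb : b ∈ interior pyramid) {t : ℝ}
    (ht : t ∈ Ioc (0 : ℝ) 1) : shear (q + t • (b - q)) ∈ interior (shear '' pyramid) := by
  rw [interior_image_shear]
  exact mem_image_of_mem _ (convex_pyramid.add_smul_sub_mem_interior hq hb ht)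

theorem contDiffAt_shear_segment {t : ℝ} (h : (q + t • (b - q)) 2 ≠ 0) :
    ContDiffAt ℝ (⊤ : ℕ∞) (fun t : ℝ => shear (q + t • (b - q))) t :=
  ContDiffAt.comp (f := fun t : ℝ => q + t • (b - q)) t (contDiffAt_shear h) (by fun_prop)

theorem tendsto_shear_segment :
    Tendsto (fun t : ℝ => shear (q + t • (b - q))) (𝓝[>] 0) (𝓝 (shear q)) := by
  have h : Continuous fun t : ℝ => shear (q + t • (b - q)) :=
    shear.continuous.comp (by fun_prop)
  simpa using (h.tendsto 0).mono_left nhdsWithin_le_nhds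

theorem infSmoothLength_shear_segment_le (hq : q ∈ pyramid) (hb : b ∈ interior pyramid) {s : ℝ}
    (hs : s ∈ Ioc (0 : ℝ) 1) :
    infSmoothLength (interior (shear '' pyramid)) (shear (q + s • (b - q))) (shear b) ≤
      eVariationOn (fun t : ℝ => shear (q + t • (b - q))) (Icc 0 1) := by
  have h := infSmoothLength_le_eVariationOn_of_contDiffAt
    (g := fun t : ℝ => shear (q + t • (b - q))) (S := interior (shear '' pyramid))
    (fun t ht => contDiffAt_shear_segment
      (pos_of_mem_interior_pyramid (convex_pyramid.add_smul_sub_mem_interior hq hb ht)).ne')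
    (fun t ht => shear_segment_mem_interior hq hb ht) hs
  simpa using h

theorem eVariationOn_smul_const_le_enorm (b : EuclideanSpace ℝ (Fin 3)) :
    eVariationOn (fun t : ℝ => t • b) (Icc 0 1) ≤ ‖b‖ₑ := by
  refine eVariationOn_le_of_lipschitzOnWith (K := ‖b‖₊) (LipschitzWith.lipschitzOnWith ?_)
  refine LipschitzWith.of_dist_le_mul fun s t => ?_
  rw [dist_eq_norm, ← sub_smul, norm_smul, dist_eq_norm, mul_comm, coe_nnnorm]

theorem eVariationOn_shear_segment_lt_top (hq : q ∈ pyramid) (hb : b ∈ interior pyramid)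
    (hb' : 3 / 4 ≤ (b 0 / b 2) ^ 2) :
    eVariationOn (fun t : ℝ => shear (q + t • (b - q))) (Icc 0 1) < ⊤ := by
  rcases eq_or_ne (q 2) 0 with h2 | h2
  · rw [eq_zero_of_mem_pyramid hq h2]
    simp only [zero_add, sub_zero, shear_smul hb']
    exact (eVariationOn_smul_const_le_enorm b).trans_lt enorm_lt_top
  · have hg : ContDiffOn ℝ (⊤ : ℕ∞) (fun t : ℝ => shear (q + t • (b - q))) (Icc 0 1) := by
      refine fun t ht => (contDiffAt_shear_segment ?_).contDiffWithinAt
      rcases ht.1.eq_or_lt with rfl | h0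
      · simpa using h2
      · exact (pos_of_mem_interior_pyramid
          (convex_pyramid.add_smul_sub_mem_interior hq hb ⟨h0, ht.2⟩)).ne'
    obtain ⟨K, hK⟩ := hg.exists_lipschitzOnWith (by simp) (convex_Icc 0 1) isCompact_Icc
    exact (eVariationOn_le_of_lipschitzOnWith hK).trans_lt ENNReal.coe_lt_top

theorem rhoY_image_shear_lt_top {p q b : EuclideanSpace ℝ (Fin 3)} (hp : p ∈ pyramid)
    (hq : q ∈ pyramid) (hb : b ∈ interior pyramid)
    (hb' : 3 / 4 ≤ (b 0 / b 2) ^ 2) : rhoY (shear '' pyramid) (shear p) (shear q) < ⊤ := by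
  have hI : ∀ᶠ s in 𝓝[>] (0 : ℝ), s ∈ Ioc (0 : ℝ) 1 := Ioc_mem_nhdsGT one_pos
  refine (rhoY_le_of_eventually (tendsto_shear_segment (b := b))
    (hI.mono fun s hs => shear_segment_mem_interior hp hb hs) (tendsto_shear_segment (b := b))
    (hI.mono fun s hs => shear_segment_mem_interior hq hb hs)
    (hI.mono fun s hs => infSmoothLength_triangle.trans (add_le_add
      (infSmoothLength_shear_segment_le hp hb hs)
      (infSmoothLength_comm.trans_le (infSmoothLength_shear_segment_le hq hb hs))))).trans_lt ?_
  exact ENNReal.add_lt_top.2 ⟨eVariationOn_shear_segment_lt_top hp hb hb',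
    eVariationOn_shear_segment_lt_top hq hb hb'⟩

theorem rhoY_apex_le (hb : b ∈ interior pyramid) (hb' : 3 / 4 ≤ (b 0 / b 2) ^ 2) :
    rhoY (shear '' pyramid) b 0 ≤ ‖b‖ₑ ∧ rhoY (shear '' pyramid) 0 b ≤ ‖b‖ₑ := by
  have hI : ∀ᶠ s in 𝓝[>] (0 : ℝ), s ∈ Ioc (0 : ℝ) 1 := Ioc_mem_nhdsGT one_pos
  have h0 : (0 : EuclideanSpace ℝ (Fin 3)) ∈ pyramid := by simp [pyramid]
  have hbb : shear b = b := by simpa using shear_smul hb' 1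
  have hbY : b ∈ interior (shear '' pyramid) := by
    rw [interior_image_shear]
    exact ⟨b, hb, hbb⟩
  have ht : Tendsto (fun s : ℝ => s • b) (𝓝[>] 0) (𝓝 0) := by
    have h := tendsto_shear_segment (q := 0) (b := b)
    have h00 : shear 0 = 0 := by simpa using shear_smul hb' 0
    simpa only [zero_add, sub_zero, shear_smul hb', h00] using h
  have hmem : ∀ᶠ s in 𝓝[>] (0 : ℝ), s • b ∈ interior (shear '' pyramid) :=
    hI.mono fun s hs => by
      simpa [shear_smul hb'] using shear_segment_mem_interior h0 hb hs
  have hle : ∀ᶠ s in 𝓝[>] (0 : ℝ),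
      infSmoothLength (interior (shear '' pyramid)) (s • b) b ≤ ‖b‖ₑ :=
    hI.mono fun s hs => by
      have h := infSmoothLength_shear_segment_le h0 hb hs
      simp only [zero_add, sub_zero, shear_smul hb', hbb] at h
      exact h.trans (eVariationOn_smul_const_le_enorm b)
  exact ⟨rhoY_le_of_eventually tendsto_const_nhds (.of_forall fun _ => hbY) ht hmem
      (hle.mono fun s hs => infSmoothLength_comm.trans_le hs),
    rhoY_le_of_eventually ht hmem tendsto_const_nhds (.of_forall fun _ => hbY) hle⟩

theorem one_le_rhoY_image_shear {x z : EuclideanSpace ℝ (Fin 3)} (hx2 : x 2 ≠ 0) (hz2 : z 2 ≠ 0)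
    (hx : x 0 / x 2 < -1 / 2) (hz : 1 / 2 < z 0 / z 2) :
    1 ≤ rhoY (shear '' pyramid) x z := by
  have hcont : ∀ w : EuclideanSpace ℝ (Fin 3), w 2 ≠ 0 →
      Tendsto (fun p : EuclideanSpace ℝ (Fin 3) => p 0 / p 2) (𝓝 w) (𝓝 (w 0 / w 2)) :=
    fun w hw => ContinuousAt.div (f := fun p : EuclideanSpace ℝ (Fin 3) => p 0)
      (g := fun p : EuclideanSpace ℝ (Fin 3) => p 2)
      (by fun_prop) (by fun_prop) hw
  have hx' := ((hcont x hx2).eventually (gt_mem_nhds hx)).filter_mono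
    (inf_le_left (b := 𝓟 (interior (shear '' pyramid))))
  have hz' := ((hcont z hz2).eventually (lt_mem_nhds hz)).filter_mono
    (inf_le_left (b := 𝓟 (interior (shear '' pyramid))))
  refine le_liminf_of_le (by isBoundedDefault) ((hx'.prod_mk hz').mono ?_)
  rintro ⟨p, q⟩ ⟨hp, hq⟩
  refine le_sInf ?_
  rintro _ ⟨γ, hγ, rfl, rfl, hS, rfl⟩
  exact one_le_eVariationOn_of_crossing hγ.continuous zero_le_one
    (fun t ht => mem_interior_image_shear (hS t ht)) hp.le hq.le

end ShearedPyramid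
/-- there is a compact connected 3-dimensional `C⁰`-submanifold `Y ⊆ ℝ³`
with nonempty boundary such that the induced function `ρ_Y` is finite on `Y × Y` but
fails the triangle inequality, hence is not a metric on `Y`. -/
theorem stmt1 :
    ∃ Y : Set (EuclideanSpace ℝ (Fin 3)),
      IsC0SubmanifoldWithBoundary 3 Y ∧
      (∀ x ∈ Y, ∀ y ∈ Y, rhoY Y x y < ⊤) ∧
      ¬ (∀ x ∈ Y, ∀ y ∈ Y, ∀ z ∈ Y, rhoY Y x z ≤ rhoY Y x y + rhoY Y y z) := by
  have hval : ∀ c : ℝ, (![c, 0, 1 / 10] : Fin 3 → ℝ) 2 = 1 / 10 := fun _ => rfl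
  have hmem : ∀ c : ℝ, |c| = 9 / 100 →
      (!₂[c, 0, 1 / 10] : EuclideanSpace ℝ (Fin 3)) ∈ interior pyramid := by
    intro c hc
    refine mem_interior_pyramid ?_ ?_ ?_ <;> norm_num [hc, hval]
  have hsector : ∀ c : ℝ, |c| = 9 / 100 →
      3 / 4 ≤ ((!₂[c, 0, 1 / 10] : EuclideanSpace ℝ (Fin 3)) 0 /
        (!₂[c, 0, 1 / 10] : EuclideanSpace ℝ (Fin 3)) 2) ^ 2 := by
    intro c hc
    have hc2 : c ^ 2 = (9 / 100) ^ 2 := by rw [← hc, sq_abs]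
    norm_num [div_pow, mul_pow, hc2, hval]
  have hnorm : ∀ c : ℝ, |c| = 9 / 100 →
      ‖(!₂[c, 0, 1 / 10] : EuclideanSpace ℝ (Fin 3))‖ₑ ≤ ENNReal.ofReal (1 / 5) := by
    intro c hc
    have hc2 : c ^ 2 = (9 / 100) ^ 2 := by rw [← hc, sq_abs]
    rw [← ofReal_norm]
    refine ENNReal.ofReal_le_ofReal (abs_le_of_sq_le_sq' ?_ (by norm_num)).2
    rw [EuclideanSpace.norm_sq_eq, Fin.sum_univ_three]
    norm_num [hc2, hval]
  have hY : ∀ c : ℝ, |c| = 9 / 100 →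
      (!₂[c, 0, 1 / 10] : EuclideanSpace ℝ (Fin 3)) ∈ shear '' pyramid := fun c hc =>
    ⟨_, interior_subset (hmem c hc), by simpa using shear_smul (hsector c hc) 1⟩
  have habs : |(9 / 100 : ℝ)| = 9 / 100 := by norm_num
  have habs' : |(-(9 / 100) : ℝ)| = 9 / 100 := by norm_num
  refine ⟨shear '' pyramid, isC0SubmanifoldWithBoundary_image_convex shear convex_pyramid
    isCompact_pyramid ⟨_, hmem _ habs⟩, ?_, fun h => ?_⟩
  · rintro _ ⟨p, hp, rfl⟩ _ ⟨q, hq, rfl⟩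
    exact rhoY_image_shear_lt_top hp hq (hmem _ habs) (hsector _ habs)
  · have h0 : (0 : EuclideanSpace ℝ (Fin 3)) ∈ shear '' pyramid :=
      ⟨0, by simp [pyramid], by simpa using shear_smul (hsector _ habs) 0⟩
    have htri := h _ (hY _ habs') 0 h0 _ (hY _ habs)
    have h1 := one_le_rhoY_image_shear (x := !₂[-(9 / 100), 0, 1 / 10])
      (z := !₂[9 / 100, 0, 1 / 10]) (by norm_num [hval])
      (by norm_num [hval]) (by norm_num [hval]) (by norm_num [hval])
    have hx := (rhoY_apex_le (hmem _ habs') (hsector _ habs')).1.trans (hnorm _ habs')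
    have hz := (rhoY_apex_le (hmem _ habs) (hsector _ habs)).2.trans (hnorm _ habs)
    have h2 := h1.trans (htri.trans (add_le_add hx hz))
    rw [← ENNReal.ofReal_add (by norm_num) (by norm_num), ENNReal.one_le_ofReal] at h2
    norm_num at h2
end

section
/- There exists a compact geodesic metric space (Y, ρ) and a Riemannian length structure l on Y with l ≤-compatible paths such that every ρ-geodesic γ : [0,L] → Y satisfies l(γ|[s,t]) ≤ t − s, but equality may fail for n ≥ 3: i.e., there exists Y ⊂ ℝ³ as in the construction with ρ_Y a metric where a ρ_Y-shortest curve γ between two points has Riemannian (Euclidean) length strictly less than its ρ_Y-length. In particular (Y, ρ_Y) is a metric space with an intrinsic metric in the sense that distances are realized by ρ_Y-geodesics, yet it is not a length space with respect to the ambient Riemannian length. -/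
open Set Filter Topology ENNReal Real

theorem le_eVariationOn_of_locally_le_edist {E : Type*} [PseudoEMetricSpace E]
    {e : E → E → ℝ≥0∞} {U : Set E} (he : ∀ x ∈ U, e x x = 0)
    (htri : ∀ x y z, e x z ≤ e x y + e y z)
    (hloc : ∀ p ∈ U, ∃ N ∈ 𝓝 p, ∀ x ∈ N, ∀ y ∈ N, e x y ≤ edist x y)
    {γ : ℝ → E} {a b : ℝ} (hab : a ≤ b) (hγ : ContinuousOn γ (Icc a b))
    (hU : ∀ t ∈ Icc a b, γ t ∈ U) : e (γ a) (γ b) ≤ eVariationOn γ (Icc a b) := by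
  choose! N hN hNe using hloc
  have hc : Continuous (fun t : Icc a b => γ t) := continuousOn_iff_continuous_domRestrict.1 hγ
  obtain ⟨t, ht0, htm, ⟨m, hm⟩, ht⟩ := exists_monotone_Icc_subset_open_cover_Icc hab
    (c := fun i : Icc a b => (fun s : Icc a b => γ s) ⁻¹' interior (N (γ i)))
    (fun i => isOpen_interior.preimage hc) (fun i _ => mem_iUnion.2 ⟨i, by
      simpa using mem_interior_iff_mem_nhds.2 (hN _ (hU i i.2))⟩)
  have key : ∀ n, e (γ a) (γ (t n)) ≤ eVariationOn γ (Icc a (t n)) := by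
    intro n
    induction n with
    | zero => simp [ht0, he (γ a) (hU a ⟨le_rfl, hab⟩)]
    | succ n ih =>
      obtain ⟨i, hi⟩ := ht n
      have hle : t n ≤ t (n + 1) := htm n.le_succ
      have h1 := hi ⟨le_rfl, hle⟩
      have h2 := hi ⟨hle, le_rfl⟩
      have h3 := hNe _ (hU i i.2) _ (interior_subset h1) _ (interior_subset h2)
      have h4 := eVariationOn.Icc_add_Icc γ (s := univ) (t n).2.1
        (show (t n : ℝ) ≤ t (n + 1) from hle) (mem_univ _)
      simp only [univ_inter] at h4
      rw [← h4]
      refine (htri _ (γ (t n)) _).trans (add_le_add ih (h3.trans ?_))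
      exact eVariationOn.edist_le γ ⟨le_rfl, hle⟩ ⟨hle, le_rfl⟩
  simpa [hm m le_rfl] using key m

theorem eVariationOn_Icc_le_of_edist_le {E : Type*} [PseudoEMetricSpace E] {γ : ℝ → E}
    {f : ℝ → ℝ} {a b : ℝ} (hab : a ≤ b)
    (h : ∀ s t, a ≤ s → s ≤ t → t ≤ b → edist (γ s) (γ t) ≤ ENNReal.ofReal (f t - f s))
    (hf : MonotoneOn f (Icc a b)) :
    eVariationOn γ (Icc a b) ≤ ENNReal.ofReal (f b - f a) := by
  refine iSup_le fun p => ?_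
  obtain ⟨n, u, hu, hus⟩ := p
  have hle : ∀ k, u k ≤ u (k + 1) := fun k => hu k.le_succ
  calc ∑ i ∈ Finset.range n, edist (γ (u (i + 1))) (γ (u i))
      ≤ ∑ i ∈ Finset.range n, ENNReal.ofReal (f (u (i + 1)) - f (u i)) :=
        Finset.sum_le_sum fun i _ => by
          rw [edist_comm]; exact h _ _ (hus i).1 (hle i) (hus (i + 1)).2
    _ = ENNReal.ofReal (∑ i ∈ Finset.range n, (f (u (i + 1)) - f (u i))) :=
        (ENNReal.ofReal_sum_of_nonneg fun i _ =>
          sub_nonneg.2 (hf (hus i) (hus (i + 1)) (hle i))).symm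
    _ ≤ ENNReal.ofReal (f b - f a) := by
        rw [Finset.sum_range_sub (fun i => f (u i))]
        refine ENNReal.ofReal_le_ofReal (sub_le_sub ?_ ?_)
        · exact hf (hus n) ⟨hab, le_rfl⟩ (hus n).2
        · exact hf ⟨le_rfl, hab⟩ (hus 0) (hus 0).1

local notation "E³" => EuclideanSpace ℝ (Fin 3)

section InfSmoothLength

variable {n : ℕ} {S : Set (EuclideanSpace ℝ (Fin n))} {x y z : EuclideanSpace ℝ (Fin n)}

theorem edist_le_infSmoothLength : edist x y ≤ infSmoothLength S x y := by
  refine le_sInf ?_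
  rintro L ⟨γ, -, rfl, rfl, -, rfl⟩
  exact eVariationOn.edist_le γ (by simp) (by simp)

theorem infSmoothLength_le_symm : infSmoothLength S x y ≤ infSmoothLength S y x := by
  refine le_sInf ?_
  rintro L ⟨γ, hγ, rfl, rfl, hS, rfl⟩
  refine sInf_le ⟨fun t => γ (1 - t), hγ.comp (contDiff_const.sub contDiff_id), by simp, by simp,
    fun t ht => hS _ ⟨by linarith [ht.2], by linarith [ht.1]⟩, ?_⟩
  have h := eVariationOn.comp_eq_of_antitoneOn γ (t := Icc (0:ℝ) 1) (fun t => 1 - t)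
    (fun a _ b _ hab => by show 1 - b ≤ 1 - a; linarith)
  have h2 : (fun t : ℝ => 1 - t) '' Icc (0:ℝ) 1 = Icc 0 1 := by simp
  rw [h2] at h
  exact h.symm

theorem infSmoothLength_comm_s19 : infSmoothLength S x y = infSmoothLength S y x :=
  le_antisymm infSmoothLength_le_symm infSmoothLength_le_symm

theorem infSmoothLength_triangle_s19 :
    infSmoothLength S x z ≤ infSmoothLength S x y + infSmoothLength S y z := by
  have key : ∀ L₁ ∈ { L : ℝ≥0∞ | ∃ γ : ℝ → EuclideanSpace ℝ (Fin n), ContDiff ℝ (⊤ : ℕ∞) γ ∧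
      γ 0 = x ∧ γ 1 = y ∧ (∀ t ∈ Icc (0:ℝ) 1, γ t ∈ S) ∧ L = eVariationOn γ (Icc (0:ℝ) 1) },
      ∀ L₂ ∈ { L : ℝ≥0∞ | ∃ γ : ℝ → EuclideanSpace ℝ (Fin n), ContDiff ℝ (⊤ : ℕ∞) γ ∧
      γ 0 = y ∧ γ 1 = z ∧ (∀ t ∈ Icc (0:ℝ) 1, γ t ∈ S) ∧ L = eVariationOn γ (Icc (0:ℝ) 1) },
      infSmoothLength S x z ≤ L₁ + L₂ := by
    rintro _ ⟨γ₁, h₁, rfl, rfl, hS₁, rfl⟩ _ ⟨γ₂, h₂, h12, rfl, hS₂, rfl⟩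
    set σ := Real.smoothTransition
    set γ : ℝ → EuclideanSpace ℝ (Fin n) :=
      fun t => γ₁ (σ (2 * t)) + γ₂ (σ (2 * t - 1)) - γ₁ 1 with hγ
    have hσI : ∀ t, σ t ∈ Icc (0:ℝ) 1 := fun t =>
      ⟨Real.smoothTransition.nonneg t, Real.smoothTransition.le_one t⟩
    have hl : ∀ t ≤ (1/2 : ℝ), γ t = γ₁ (σ (2 * t)) := by
      intro t ht
      have : σ (2 * t - 1) = 0 := Real.smoothTransition.zero_of_nonpos (by linarith)
      simp [hγ, this, h12]
    have hr : ∀ t, (1/2 : ℝ) ≤ t → γ t = γ₂ (σ (2 * t - 1)) := by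
      intro t ht
      have : σ (2 * t) = 1 := Real.smoothTransition.one_of_one_le (by linarith)
      simp [hγ, this]
    have hsm : ContDiff ℝ (⊤ : ℕ∞) γ := by
      have hσ : ContDiff ℝ (⊤ : ℕ∞) σ := Real.smoothTransition.contDiff
      exact ((h₁.comp (hσ.comp (contDiff_const.mul contDiff_id))).add
        (h₂.comp (hσ.comp ((contDiff_const.mul contDiff_id).sub contDiff_const)))).sub contDiff_const
    have hmem : eVariationOn γ (Icc 0 1) ≤
        eVariationOn γ₁ (Icc 0 1) + eVariationOn γ₂ (Icc 0 1) := by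
      have h4 := eVariationOn.Icc_add_Icc γ (s := univ) (a := 0) (b := 1/2) (c := 1)
        (by norm_num) (by norm_num) (mem_univ _)
      simp only [univ_inter] at h4
      rw [← h4]
      refine add_le_add ?_ ?_
      · rw [eVariationOn.congr (g := γ₁ ∘ fun t => σ (2 * t)) (fun t ht => hl t ht.2)]
        refine eVariationOn.comp_le_of_monotoneOn _ _ (fun s _ t _ hst => ?_) fun t _ => hσI _
        exact Real.smoothTransition.monotone (by linarith)
      · rw [eVariationOn.congr (g := γ₂ ∘ fun t => σ (2 * t - 1)) (fun t ht => hr t ht.1)]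
        refine eVariationOn.comp_le_of_monotoneOn _ _ (fun s _ t _ hst => ?_) fun t _ => hσI _
        exact Real.smoothTransition.monotone (by linarith)
    refine le_trans (sInf_le ⟨γ, hsm, ?_, ?_, fun t _ => ?_, rfl⟩) hmem
    · rw [hl 0 (by norm_num)]; simp [σ]
    · rw [hr 1 (by norm_num)]; norm_num [σ]
    · rcases le_total t (1/2) with h | h
      · rw [hl t h]; exact hS₁ _ (hσI _)
      · rw [hr t h]; exact hS₂ _ (hσI _)
  unfold infSmoothLength at *
  rw [ENNReal.sInf_add]
  refine le_iInf₂ fun L₁ h₁ => ?_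
  rw [ENNReal.add_sInf]
  exact le_iInf₂ fun L₂ h₂ => key L₁ h₁ L₂ h₂

theorem infSmoothLength_le_edist_of_segment_subset (h : segment ℝ x y ⊆ S) :
    infSmoothLength S x y ≤ edist x y := by
  refine le_trans (sInf_le ⟨fun t => x + t • (y - x), contDiff_const.add
    (contDiff_id.smul contDiff_const), by simp, by simp, fun t ht => h ?_, rfl⟩) ?_
  · rw [segment_eq_image']; exact ⟨t, ht, rfl⟩
  · refine (eVariationOn_Icc_le_of_edist_le (f := fun t => t * dist x y) zero_le_one ?_ ?_).trans ?_
    · intro s t _ hst _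
      rw [edist_dist]
      refine ENNReal.ofReal_le_ofReal (le_of_eq ?_)
      rw [dist_add_left, dist_eq_norm, ← sub_smul, norm_smul, Real.norm_eq_abs, abs_sub_comm,
        abs_of_nonneg (sub_nonneg.2 hst), dist_comm x y, dist_eq_norm]
      ring
    · intro s _ t _ hst
      exact mul_le_mul_of_nonneg_right hst dist_nonneg
    · simp [edist_dist]

theorem infSmoothLength_self (h : x ∈ S) : infSmoothLength S x x = 0 := by
  have := infSmoothLength_le_edist_of_segment_subset (S := S) (x := x) (y := x) (by simpa)
  simpa using this

theorem infSmoothLength_le_eVariationOn (hS : IsOpen S) {γ : ℝ → EuclideanSpace ℝ (Fin n)}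
    {a b : ℝ} (hab : a ≤ b) (hγ : ContinuousOn γ (Icc a b)) (hU : ∀ t ∈ Icc a b, γ t ∈ S) :
    infSmoothLength S (γ a) (γ b) ≤ eVariationOn γ (Icc a b) := by
  refine le_eVariationOn_of_locally_le_edist (U := S) (fun x hx => infSmoothLength_self hx)
    (fun x y z => infSmoothLength_triangle_s19) (fun p hp => ?_) hab hγ hU
  obtain ⟨ε, hε, hb⟩ := Metric.isOpen_iff.1 hS p hp
  refine ⟨_, Metric.ball_mem_nhds p hε, fun x hx y hy => ?_⟩
  exact infSmoothLength_le_edist_of_segment_subset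
    (((convex_ball p ε).segment_subset hx hy).trans hb)

theorem infSmoothLength_le_of_edist_le (hS : IsOpen S) {γ : ℝ → EuclideanSpace ℝ (Fin n)}
    {f : ℝ → ℝ} {a b : ℝ} (hab : a ≤ b) (hU : ∀ t ∈ Icc a b, γ t ∈ S)
    (hγ : ContinuousOn γ (Icc a b))
    (h : ∀ s t, a ≤ s → s ≤ t → t ≤ b → dist (γ s) (γ t) ≤ f t - f s) :
    infSmoothLength S (γ a) (γ b) ≤ ENNReal.ofReal (f b - f a) := by
  refine (infSmoothLength_le_eVariationOn hS hab hγ hU).trans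
    (eVariationOn_Icc_le_of_edist_le hab (fun s t h1 h2 h3 => ?_) fun s hs t ht hst => ?_)
  · rw [edist_dist]; exact ENNReal.ofReal_le_ofReal (h s t h1 h2 h3)
  · linarith [h s t hs.1 hst ht.2, dist_nonneg (x := γ s) (y := γ t)]

theorem edist_map_le_infSmoothLength {F : EuclideanSpace ℝ (Fin n) → ℝ}
    (hF : ∀ p ∈ S, ∃ N ∈ 𝓝 p, ∀ x ∈ N, ∀ y ∈ N, dist (F x) (F y) ≤ dist x y) :
    edist (F x) (F y) ≤ infSmoothLength S x y := by
  refine le_sInf ?_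
  rintro L ⟨γ, hγ, rfl, rfl, hS, rfl⟩
  refine le_eVariationOn_of_locally_le_edist (e := fun x y => edist (F x) (F y)) (U := S)
    (by simp) (fun x y z => edist_triangle _ _ _) (fun p hp => ?_) zero_le_one
    hγ.continuous.continuousOn hS
  obtain ⟨N, hN, h⟩ := hF p hp
  refine ⟨N, hN, fun x hx y hy => ?_⟩
  rw [edist_dist, edist_dist]
  exact ENNReal.ofReal_le_ofReal (h x hx y hy)

end InfSmoothLength

section RhoY

variable {n : ℕ} {Y : Set (EuclideanSpace ℝ (Fin n))}

/-- Interior points close to a common point of `Y` are joined by short paths inside `Y`. -/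
def InteriorLocallyShort (Y : Set (EuclideanSpace ℝ (Fin n))) : Prop :=
  ∀ p ∈ Y, ∀ ε : ℝ, 0 < ε → ∃ N ∈ 𝓝 p, ∀ x ∈ N ∩ interior Y, ∀ y ∈ N ∩ interior Y,
    infSmoothLength (interior Y) x y ≤ ENNReal.ofReal ε

theorem rhoY_comm (x y : EuclideanSpace ℝ (Fin n)) : rhoY Y x y = rhoY Y y x := by
  unfold rhoY
  rw [Filter.prod_comm]
  simp only [Filter.liminf, Filter.map_map]
  congr 2
  funext p
  exact infSmoothLength_comm_s19

theorem neBot_nhds_inf_interior (hcl : Y ⊆ closure (interior Y)) {x : EuclideanSpace ℝ (Fin n)}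
    (hx : x ∈ Y) : (𝓝 x ⊓ 𝓟 (interior Y)).NeBot :=
  mem_closure_iff_nhdsWithin_neBot.1 (hcl hx)

/-- Under local shortness, `rhoY` is the limit of interior distances. -/
theorem rhoY_approx (hcl : Y ⊆ closure (interior Y)) (hloc : InteriorLocallyShort Y)
    {x y : EuclideanSpace ℝ (Fin n)} (hx : x ∈ Y) (hy : y ∈ Y) {ε : ℝ} (hε : 0 < ε) :
    ∃ N ∈ 𝓝 x, ∃ M ∈ 𝓝 y, ∀ p ∈ N ∩ interior Y, ∀ q ∈ M ∩ interior Y,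
      rhoY Y x y ≤ infSmoothLength (interior Y) p q + ENNReal.ofReal ε ∧
      infSmoothLength (interior Y) p q ≤ rhoY Y x y + ENNReal.ofReal ε := by
  have := neBot_nhds_inf_interior hcl hx
  have := neBot_nhds_inf_interior hcl hy
  obtain ⟨N, hN, hNs⟩ := hloc x hx (ε / 2) (by positivity)
  obtain ⟨M, hM, hMs⟩ := hloc y hy (ε / 2) (by positivity)
  have hεε : ENNReal.ofReal (ε / 2) + ENNReal.ofReal (ε / 2) = ENNReal.ofReal ε := by
    rw [← ENNReal.ofReal_add (by positivity) (by positivity)]; congr 1; ring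
  have hcmp : ∀ p ∈ N ∩ interior Y, ∀ q ∈ M ∩ interior Y, ∀ p' ∈ N ∩ interior Y,
      ∀ q' ∈ M ∩ interior Y, infSmoothLength (interior Y) p q ≤
        infSmoothLength (interior Y) p' q' + ENNReal.ofReal ε := by
    intro p hp q hq p' hp' q' hq'
    calc infSmoothLength (interior Y) p q
        ≤ infSmoothLength (interior Y) p p' + (infSmoothLength (interior Y) p' q' +
          infSmoothLength (interior Y) q' q) :=
          infSmoothLength_triangle_s19.trans (add_le_add_right infSmoothLength_triangle_s19 _)
      _ ≤ ENNReal.ofReal (ε / 2) + (infSmoothLength (interior Y) p' q' +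
          ENNReal.ofReal (ε / 2)) :=
          add_le_add (hNs _ hp _ hp') (add_le_add_right (hMs _ hq' _ hq) _)
      _ = _ := by rw [← hεε]; ring
  have hev : ∀ᶠ r : EuclideanSpace ℝ (Fin n) × EuclideanSpace ℝ (Fin n) in
      (𝓝 x ⊓ 𝓟 (interior Y)) ×ˢ (𝓝 y ⊓ 𝓟 (interior Y)),
      r.1 ∈ N ∩ interior Y ∧ r.2 ∈ M ∩ interior Y :=
    Filter.prod_mem_prod (Filter.inter_mem_inf hN (mem_principal_self _))
      (Filter.inter_mem_inf hM (mem_principal_self _))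
  refine ⟨N, hN, M, hM, fun p hp q hq => ⟨?_, ?_⟩⟩
  · refine Filter.liminf_le_of_frequently_le' (Filter.Eventually.frequently ?_)
    filter_upwards [hev] with r hr
    exact hcmp _ hr.1 _ hr.2 _ hp _ hq
  · rw [← tsub_le_iff_right]
    refine Filter.le_liminf_of_le (by isBoundedDefault) ?_
    filter_upwards [hev] with r hr
    rw [tsub_le_iff_right]
    exact hcmp _ hp _ hq _ hr.1 _ hr.2

theorem exists_mem_inter_interior (hcl : Y ⊆ closure (interior Y))
    {x : EuclideanSpace ℝ (Fin n)} (hx : x ∈ Y) {N : Set (EuclideanSpace ℝ (Fin n))}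
    (hN : N ∈ 𝓝 x) : ∃ p, p ∈ N ∩ interior Y :=
  mem_closure_iff_nhds.1 (hcl hx) N hN

theorem rhoY_lt_top (hcl : Y ⊆ closure (interior Y)) (hloc : InteriorLocallyShort Y)
    (hfin : ∀ p ∈ interior Y, ∀ q ∈ interior Y, infSmoothLength (interior Y) p q < ⊤)
    {x y : EuclideanSpace ℝ (Fin n)} (hx : x ∈ Y) (hy : y ∈ Y) : rhoY Y x y < ⊤ := by
  obtain ⟨N, hN, M, hM, h⟩ := rhoY_approx hcl hloc hx hy one_pos
  obtain ⟨p, hp⟩ := exists_mem_inter_interior hcl hx hN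
  obtain ⟨q, hq⟩ := exists_mem_inter_interior hcl hy hM
  exact (h p hp q hq).1.trans_lt (ENNReal.add_lt_top.2 ⟨hfin _ hp.2 _ hq.2, ENNReal.ofReal_lt_top⟩)

theorem rhoY_triangle (hcl : Y ⊆ closure (interior Y)) (hloc : InteriorLocallyShort Y)
    {x y z : EuclideanSpace ℝ (Fin n)} (hx : x ∈ Y) (hy : y ∈ Y) (hz : z ∈ Y) :
    rhoY Y x z ≤ rhoY Y x y + rhoY Y y z := by
  refine ENNReal.le_of_forall_pos_le_add fun ε hε _ => ?_
  have hε3 : (0:ℝ) < ε / 3 := by have : (0:ℝ) < ε := hε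
                                 positivity
  obtain ⟨N₁, hN₁, M₁, hM₁, h₁⟩ := rhoY_approx hcl hloc hx hz hε3
  obtain ⟨N₂, hN₂, M₂, hM₂, h₂⟩ := rhoY_approx hcl hloc hx hy hε3
  obtain ⟨N₃, hN₃, M₃, hM₃, h₃⟩ := rhoY_approx hcl hloc hy hz hε3
  obtain ⟨p, hp, hpi⟩ := exists_mem_inter_interior hcl hx (inter_mem hN₁ hN₂)
  obtain ⟨q, hq, hqi⟩ := exists_mem_inter_interior hcl hy (inter_mem hM₂ hN₃)
  obtain ⟨r, hr, hri⟩ := exists_mem_inter_interior hcl hz (inter_mem hM₁ hM₃)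
  have e3 : ENNReal.ofReal (ε/3) + ENNReal.ofReal (ε/3) + ENNReal.ofReal (ε/3) = ε := by
    rw [← ENNReal.ofReal_add hε3.le hε3.le, ← ENNReal.ofReal_add (by positivity) hε3.le]
    rw [show (ε/3 + ε/3 + ε/3 : ℝ) = ε by ring, ENNReal.ofReal_coe_nnreal]
  calc rhoY Y x z ≤ infSmoothLength (interior Y) p r + ENNReal.ofReal (ε/3) :=
        (h₁ p ⟨hp.1, hpi⟩ r ⟨hr.1, hri⟩).1
    _ ≤ (infSmoothLength (interior Y) p q + infSmoothLength (interior Y) q r)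
        + ENNReal.ofReal (ε/3) := add_le_add_left infSmoothLength_triangle_s19 _
    _ ≤ ((rhoY Y x y + ENNReal.ofReal (ε/3)) + (rhoY Y y z + ENNReal.ofReal (ε/3)))
        + ENNReal.ofReal (ε/3) := by
        gcongr
        · exact (h₂ p ⟨hp.2, hpi⟩ q ⟨hq.1, hqi⟩).2
        · exact (h₃ q ⟨hq.2, hqi⟩ r ⟨hr.2, hri⟩).2
    _ = rhoY Y x y + rhoY Y y z + (ENNReal.ofReal (ε/3) + ENNReal.ofReal (ε/3) +
          ENNReal.ofReal (ε/3)) := by ring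
    _ = _ := by rw [e3]

theorem le_rhoY_of_tendsto {F : EuclideanSpace ℝ (Fin n) → ℝ}
    (hF : ∀ p ∈ interior Y, ∃ N ∈ 𝓝 p, ∀ x ∈ N, ∀ y ∈ N, dist (F x) (F y) ≤ dist x y)
    {x y : EuclideanSpace ℝ (Fin n)} {a b : ℝ} (hcl : Y ⊆ closure (interior Y)) (hx : x ∈ Y)
    (hy : y ∈ Y) (hFx : Tendsto F (𝓝 x ⊓ 𝓟 (interior Y)) (𝓝 a))
    (hFy : Tendsto F (𝓝 y ⊓ 𝓟 (interior Y)) (𝓝 b)) : edist a b ≤ rhoY Y x y := by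
  have := neBot_nhds_inf_interior hcl hx
  have := neBot_nhds_inf_interior hcl hy
  have ht : Tendsto (fun p : EuclideanSpace ℝ (Fin n) × EuclideanSpace ℝ (Fin n) =>
      edist (F p.1) (F p.2)) ((𝓝 x ⊓ 𝓟 (interior Y)) ×ˢ (𝓝 y ⊓ 𝓟 (interior Y)))
      (𝓝 (edist a b)) :=
    (hFx.comp tendsto_fst).edist (hFy.comp tendsto_snd)
  rw [← ht.liminf_eq]
  exact Filter.liminf_le_liminf (Eventually.of_forall fun p => edist_map_le_infSmoothLength hF)

theorem edist_le_rhoY (hcl : Y ⊆ closure (interior Y))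
    {x y : EuclideanSpace ℝ (Fin n)} (hx : x ∈ Y) (hy : y ∈ Y) : edist x y ≤ rhoY Y x y := by
  have := neBot_nhds_inf_interior hcl hx
  have := neBot_nhds_inf_interior hcl hy
  have ht : Tendsto (fun p : EuclideanSpace ℝ (Fin n) × EuclideanSpace ℝ (Fin n) =>
      edist p.1 p.2) ((𝓝 x ⊓ 𝓟 (interior Y)) ×ˢ (𝓝 y ⊓ 𝓟 (interior Y)))
      (𝓝 (edist x y)) :=
    (tendsto_fst.mono_right inf_le_left).edist (tendsto_snd.mono_right inf_le_left)
  rw [← ht.liminf_eq]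
  exact Filter.liminf_le_liminf (Eventually.of_forall fun p => edist_le_infSmoothLength)

theorem rhoY_eq_zero_iff (hcl : Y ⊆ closure (interior Y)) (hloc : InteriorLocallyShort Y)
    {x y : EuclideanSpace ℝ (Fin n)} (hx : x ∈ Y) (hy : y ∈ Y) : rhoY Y x y = 0 ↔ x = y := by
  constructor
  · intro h
    have := edist_le_rhoY hcl hx hy
    rw [h] at this
    exact edist_le_zero.1 this
  · rintro rfl
    refine le_antisymm (ENNReal.le_of_forall_pos_le_add fun ε hε _ => ?_) zero_le
    have hε' : (0:ℝ) < ε := hε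
    obtain ⟨N, hN, M, hM, h⟩ := rhoY_approx hcl hloc hx hx hε'
    obtain ⟨p, hp, hpi⟩ := exists_mem_inter_interior hcl hx (inter_mem hN hM)
    have := (h p ⟨hp.1, hpi⟩ p ⟨hp.2, hpi⟩).1
    rwa [infSmoothLength_self hpi, ENNReal.ofReal_coe_nnreal] at this

theorem rhoY_le_of_tendsto (hcl : Y ⊆ closure (interior Y)) (hloc : InteriorLocallyShort Y)
    {x y : EuclideanSpace ℝ (Fin n)} (hx : x ∈ Y) (hy : y ∈ Y)
    {u v : ℕ → EuclideanSpace ℝ (Fin n)} {l : ℕ → ℝ} {L : ℝ} (hu : Tendsto u atTop (𝓝 x))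
    (hv : Tendsto v atTop (𝓝 y)) (hui : ∀ᶠ k in atTop, u k ∈ interior Y)
    (hvi : ∀ᶠ k in atTop, v k ∈ interior Y) (hl : Tendsto l atTop (𝓝 L))
    (h : ∀ᶠ k in atTop, infSmoothLength (interior Y) (u k) (v k) ≤ ENNReal.ofReal (l k)) :
    rhoY Y x y ≤ ENNReal.ofReal L := by
  refine ENNReal.le_of_forall_pos_le_add fun ε hε _ => ?_
  have hε' : (0:ℝ) < ε := hε
  obtain ⟨N, hN, M, hM, hNM⟩ := rhoY_approx hcl hloc hx hy hε'
  have ht : Tendsto (fun k => ENNReal.ofReal (l k) + ε) atTop (𝓝 (ENNReal.ofReal L + ε)) :=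
    (ENNReal.tendsto_ofReal hl).add tendsto_const_nhds
  refine ge_of_tendsto ht ?_
  filter_upwards [hu hN, hv hM, hui, hvi, h] with k h1 h2 h3 h4 h5
  have := (hNM _ ⟨h1, h3⟩ _ ⟨h2, h4⟩).1
  rw [ENNReal.ofReal_coe_nnreal] at this
  exact this.trans (add_le_add_left h5 _)

end RhoY

section Manifold

theorem norm_sq_fin_three (v : E³) : ‖v‖ ^ 2 = v 0 ^ 2 + v 1 ^ 2 + v 2 ^ 2 := by
  rw [EuclideanSpace.norm_sq_eq, Fin.sum_univ_three]
  simp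

theorem scaled_inversion_involutive {v : E³} (hv : v ≠ 0) :
    (2 / ‖(2 / ‖v‖ ^ 2) • v‖ ^ 2) • ((2 / ‖v‖ ^ 2) • v) = v := by
  have h : ‖v‖ ≠ 0 := norm_ne_zero_iff.2 hv
  rw [norm_smul, smul_smul, norm_div, norm_pow, norm_norm, Real.norm_ofNat]
  have : 2 / (2 / ‖v‖ ^ 2 * ‖v‖) ^ 2 * (2 / ‖v‖ ^ 2) = 1 := by field_simp
  rw [this, one_smul]

/-- The preimage of the closed unit ball minus a boundary point is homeomorphic to the closed
half-space. -/
theorem exists_homeomorph_half_space (Ψ : E³ ≃ₜ E³) :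
    Nonempty (↥({x | Ψ x + EuclideanSpace.single 0 1 ≠ 0} ∩ Ψ ⁻¹' Metric.closedBall 0 1) ≃ₜ
      ↥(univ : Set {x : E³ // ∀ i : Fin 3, (i : ℕ) = 0 → 0 ≤ x i})) := by
  set e : E³ := EuclideanSpace.single 0 1 with he
  have he0 : e 0 = 1 := by simp [e]
  have he1 : e 1 = 0 := by simp [e]
  have he2 : e 2 = 0 := by simp [e]
  have hball : ∀ v : E³, v - e ∈ Metric.closedBall (0 : E³) 1 ↔ ‖v‖ ^ 2 ≤ 2 * v 0 := by
    intro v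
    rw [mem_closedBall_zero_iff, ← abs_norm, ← sq_le_one_iff_abs_le_one, norm_sq_fin_three,
      norm_sq_fin_three]
    simp only [PiLp.sub_apply, he0, he1, he2]
    constructor <;> intro h <;> nlinarith
  have hw : ∀ x : {x : E³ // ∀ i : Fin 3, (i : ℕ) = 0 → 0 ≤ x i}, (x : E³) + e ≠ 0 := by
    intro x hx
    have h0 := x.2 0 rfl
    have := congrArg (fun y : E³ => y 0) hx
    simp only [PiLp.add_apply, he0, PiLp.zero_apply] at this
    linarith
  have hpos : ∀ {v : E³}, v ≠ 0 → 0 < ‖v‖ := fun h => norm_pos_iff.2 h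
  refine ⟨{ toFun := fun x => ⟨⟨(2 / ‖Ψ x + e‖ ^ 2) • (Ψ x + e) - e, ?_⟩, trivial⟩
            invFun := fun x => ⟨Ψ.symm ((2 / ‖(x : E³) + e‖ ^ 2) • ((x : E³) + e) - e), ?_, ?_⟩
            left_inv := ?_
            right_inv := ?_
            continuous_toFun := ?_
            continuous_invFun := ?_ }⟩
  · intro i hi
    obtain rfl : i = 0 := Fin.ext hi
    have h1 := (hball (Ψ x + e)).1 (by rw [add_sub_cancel_right]; exact x.2.2)
    have h2 := hpos x.2.1
    simp only [PiLp.sub_apply, PiLp.smul_apply, smul_eq_mul, he0, sub_nonneg]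
    rw [div_mul_eq_mul_div, le_div_iff₀ (by positivity)]
    linarith
  · have h2 := hpos (hw x)
    have : (2 / ‖(x : E³) + e‖ ^ 2) • ((x : E³) + e) ≠ 0 :=
      smul_ne_zero (by positivity) (hw x)
    simpa using this
  · have h2 := hpos (hw x)
    rw [mem_preimage, Ψ.apply_symm_apply, hball, norm_smul, mul_pow, norm_div, norm_pow, norm_norm,
      Real.norm_ofNat]
    have h3 : 1 ≤ ((x : E³) + e) 0 := by
      have := x.1.2 0 rfl
      simp only [PiLp.add_apply, he0]; linarith
    simp only [PiLp.smul_apply, smul_eq_mul]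
    have : (2 / ‖(x : E³) + e‖ ^ 2) ^ 2 * ‖(x : E³) + e‖ ^ 2 = 2 * (2 / ‖(x : E³) + e‖ ^ 2 * 1) := by
      field_simp
    rw [this]
    gcongr
  · intro x
    apply Subtype.ext
    simp only [sub_add_cancel]
    rw [scaled_inversion_involutive x.2.1, add_sub_cancel_right, Ψ.symm_apply_apply]
  · intro x
    apply Subtype.ext
    apply Subtype.ext
    simp only [Ψ.apply_symm_apply, sub_add_cancel]
    rw [scaled_inversion_involutive (hw x), add_sub_cancel_right]
  · refine Continuous.subtype_mk (Continuous.subtype_mk ?_ _) _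
    have hc : Continuous fun x : ↥({x | Ψ x + e ≠ 0} ∩ Ψ ⁻¹' Metric.closedBall 0 1) =>
        Ψ x + e := by fun_prop
    exact ((continuous_const.div (hc.norm.pow 2) fun x => (pow_pos (hpos x.2.1) 2).ne').smul hc).sub
      continuous_const
  · refine Continuous.subtype_mk (Ψ.symm.continuous.comp ?_) _
    have hc : Continuous fun x : ↥(univ : Set {x : E³ // ∀ i : Fin 3, (i : ℕ) = 0 → 0 ≤ x i}) =>
        (x : E³) + e := by fun_prop
    exact ((continuous_const.div (hc.norm.pow 2) fun x => (pow_pos (hpos (hw x)) 2).ne').smul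
      hc).sub continuous_const

theorem isC0SubmanifoldWithBoundary_preimage_closedBall (Ψ : E³ ≃ₜ E³) :
    IsC0SubmanifoldWithBoundary 3 (Ψ ⁻¹' Metric.closedBall 0 1) := by
  have hconn : IsConnected (Metric.closedBall (0 : E³) 1) :=
    ⟨⟨0, by simp⟩, (convex_closedBall 0 1).isPreconnected⟩
  refine ⟨?_, ?_, ?_, fun y hy => ?_⟩
  · exact Ψ.isCompact_preimage.2 (isCompact_closedBall _ _)
  · rw [← Ψ.image_symm]; exact hconn.image _ Ψ.symm.continuous.continuousOn
  · rw [← Ψ.preimage_frontier]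
    refine Nonempty.preimage ?_ Ψ.surjective
    rw [frontier_closedBall _ one_ne_zero]
    exact ⟨EuclideanSpace.single 0 1, by simp⟩
  · by_cases h : Ψ y + EuclideanSpace.single 0 1 ≠ 0
    · exact ⟨{x | Ψ x + EuclideanSpace.single 0 1 ≠ 0},
        isOpen_ne_fun (by fun_prop) continuous_const, h, univ, isOpen_univ,
        exists_homeomorph_half_space Ψ⟩
    · let Φ : E³ ≃ₜ E³ := Ψ.trans (Homeomorph.neg _)
      have hΦ : ∀ x, Φ x = - Ψ x := fun x => rfl
      have hpre : Φ ⁻¹' Metric.closedBall 0 1 = Ψ ⁻¹' Metric.closedBall 0 1 := by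
        ext x; simp [hΦ]
      rw [← hpre]
      refine ⟨{x | Φ x + EuclideanSpace.single 0 1 ≠ 0},
        isOpen_ne_fun (by fun_prop) continuous_const, ?_, univ, isOpen_univ,
        exists_homeomorph_half_space Φ⟩
      push Not at h
      have h1 := eq_neg_of_add_eq_zero_left h
      intro h2
      have h3 := congrArg (fun y : E³ => y 0) h2
      simp [hΦ, h1] at h3

theorem isC0SubmanifoldWithBoundary_preimage (Θ : E³ ≃ₜ E³) {K : Set E³} (hK : Convex ℝ K)
    (hc : IsCompact K) (hne : (interior K).Nonempty) :
    IsC0SubmanifoldWithBoundary 3 (Θ ⁻¹' K) := by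
  obtain ⟨e, -, he, -⟩ := exists_homeomorph_image_interior_closure_frontier_eq_unitBall hK hne
    hc.isBounded
  rw [hc.isClosed.closure_eq] at he
  have : Θ ⁻¹' K = (Θ.trans e) ⁻¹' Metric.closedBall 0 1 := by
    rw [← he]
    ext x
    simp
  rw [this]
  exact isC0SubmanifoldWithBoundary_preimage_closedBall _

end Manifold

section Region

/-- The point of `ℝ³` with the given coordinates. -/
noncomputable def pt (x y z : ℝ) : E³ := !₂[x, y, z]

@[simp] theorem pt_zero (x y z : ℝ) : pt x y z 0 = x := rfl
@[simp] theorem pt_one (x y z : ℝ) : pt x y z 1 = y := rfl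
@[simp] theorem pt_two (x y z : ℝ) : pt x y z 2 = z := rfl

theorem pt_eta (p : E³) : pt (p 0) (p 1) (p 2) = p := by
  ext i; fin_cases i <;> rfl

theorem continuous_pt {X : Type*} [TopologicalSpace X] {f g h : X → ℝ} (hf : Continuous f)
    (hg : Continuous g) (hh : Continuous h) : Continuous fun t => pt (f t) (g t) (h t) := by
  refine (PiLp.continuous_toLp 2 _).comp (continuous_pi fun i => ?_)
  fin_cases i
  exacts [hf, hg, hh]

theorem continuous_coord (i : Fin 3) : Continuous fun p : E³ => p i := by fun_prop

theorem dist_pt_sq (p q : E³) :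
    dist p q ^ 2 = (p 0 - q 0) ^ 2 + (p 1 - q 1) ^ 2 + (p 2 - q 2) ^ 2 := by
  rw [dist_eq_norm, norm_sq_fin_three]
  simp

theorem dist_le_abs_add (p q : E³) : dist p q ≤ |p 0 - q 0| + |p 1 - q 1| + |p 2 - q 2| := by
  refine le_of_sq_le_sq ?_ (by positivity)
  rw [dist_pt_sq]
  nlinarith [abs_nonneg (p 0 - q 0), abs_nonneg (p 1 - q 1), abs_nonneg (p 2 - q 2),
    mul_nonneg (abs_nonneg (p 0 - q 0)) (abs_nonneg (p 1 - q 1)),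
    mul_nonneg (abs_nonneg (p 0 - q 0)) (abs_nonneg (p 2 - q 2)),
    mul_nonneg (abs_nonneg (p 1 - q 1)) (abs_nonneg (p 2 - q 2)),
    sq_abs (p 0 - q 0), sq_abs (p 1 - q 1), sq_abs (p 2 - q 2)]

theorem strictMono_fifth : StrictMono fun y : ℝ => y ^ 5 := Odd.strictMono_pow (by decide)

theorem surjective_fifth : Function.Surjective fun y : ℝ => y ^ 5 := by
  intro b
  have h : 1 + |b| ≤ (1 + |b|) ^ 5 := le_self_pow₀ (by linarith [abs_nonneg b]) (by norm_num)
  refine mem_range_of_exists_le_of_exists_ge (by fun_prop) ⟨-(1 + |b|), ?_⟩ ⟨1 + |b|, ?_⟩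
  · rw [Odd.neg_pow (by decide)]; linarith [neg_abs_le b]
  · linarith [le_abs_self b]

/-- The order-preserving homeomorphism `y ↦ y ^ 5` of the line. -/
noncomputable def fifthPower : ℝ ≃ₜ ℝ :=
  (strictMono_fifth.orderIsoOfSurjective _ surjective_fifth).toHomeomorph

theorem fifthPower_apply (y : ℝ) : fifthPower y = y ^ 5 := rfl

variable {φ : ℝ → ℝ → ℝ}

/-- The shear of `ℝ³` straightening the graph of `φ` and rescaling the other directions. -/
noncomputable def straighten (hφ : Continuous fun q : ℝ × ℝ => φ q.1 q.2) : E³ ≃ₜ E³ where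
  toFun p := pt (p 0) (p 1 ^ 5) (2 ^ 14 * (p 2 - φ (p 0) (p 1)))
  invFun q := pt (q 0) (fifthPower.symm (q 1)) (q 2 / 2 ^ 14 + φ (q 0) (fifthPower.symm (q 1)))
  left_inv p := by
    simp only [pt_zero, pt_one, pt_two, ← fifthPower_apply, Homeomorph.symm_apply_apply]
    rw [mul_div_cancel_left₀ _ (by norm_num), sub_add_cancel, pt_eta]
  right_inv q := by
    simp only [pt_zero, pt_one, pt_two, ← fifthPower_apply, Homeomorph.apply_symm_apply]
    rw [add_sub_cancel_right, mul_div_cancel₀ _ (by norm_num), pt_eta]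
  continuous_toFun := by
    have : Continuous fun p : E³ => φ (p 0) (p 1) :=
      hφ.comp ((continuous_coord 0).prodMk (continuous_coord 1))
    refine continuous_pt ?_ ?_ ?_ <;> fun_prop
  continuous_invFun := by
    have h1 : Continuous fun p : E³ => fifthPower.symm (p 1) :=
      fifthPower.symm.continuous.comp (continuous_coord 1)
    have : Continuous fun p : E³ => φ (p 0) (fifthPower.symm (p 1)) :=
      hφ.comp ((continuous_coord 0).prodMk h1)
    refine continuous_pt ?_ h1 ?_ <;> fun_prop

/-- The straightened model of the region. -/
def wedge : Set E³ := {q | |q 0| ≤ 1 ∧ q 1 ≤ 1 ∧ |q 2| ≤ q 1}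

/-- The region around the graph of `φ` whose thickness decays like `y ^ 5`. -/
def foldRegion (φ : ℝ → ℝ → ℝ) : Set E³ :=
  {p | |p 0| ≤ 1 ∧ p 1 ≤ 1 ∧ 2 ^ 14 * |p 2 - φ (p 0) (p 1)| ≤ p 1 ^ 5}

theorem convex_wedge : Convex ℝ wedge := by
  rintro p ⟨hp0, hp1, hp2⟩ q ⟨hq0, hq1, hq2⟩ a b ha hb hab
  rw [abs_le] at hp0 hq0 hp2 hq2
  refine ⟨abs_le.2 ⟨?_, ?_⟩, ?_, abs_le.2 ⟨?_, ?_⟩⟩ <;>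
    simp only [PiLp.add_apply, PiLp.smul_apply, smul_eq_mul] <;>
    nlinarith

theorem isCompact_wedge : IsCompact wedge := by
  refine Metric.isCompact_of_isClosed_isBounded ?_ ?_
  · have h0 := continuous_coord 0
    have h1 := continuous_coord 1
    have h2 := continuous_coord 2
    exact (isClosed_le h0.abs continuous_const).inter
      ((isClosed_le h1 continuous_const).inter (isClosed_le h2.abs h1))
  · refine (Metric.isBounded_closedBall (x := (0 : E³)) (r := 3)).subset ?_
    rintro q ⟨h0, h1, h2⟩
    rw [Metric.mem_closedBall]
    refine (dist_le_abs_add q 0).trans ?_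
    have h3 : |q 1| ≤ 1 := abs_le.2 ⟨by linarith [abs_nonneg (q 2)], h1⟩
    simp only [PiLp.zero_apply, sub_zero]
    linarith

theorem interior_wedge : interior wedge = {q | |q 0| < 1 ∧ q 1 < 1 ∧ |q 2| < q 1} := by
  refine Subset.antisymm (fun q hq => ?_) (interior_maximal ?_ ?_)
  · have key : ∀ d : E³, ∃ t : ℝ, 0 < t ∧ q + t • d ∈ wedge := by
      intro d
      have hc : Tendsto (fun t : ℝ => q + t • d) (𝓝[>] 0) (𝓝 q) := by
        have : Continuous fun t : ℝ => q + t • d := by fun_prop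
        simpa using (this.tendsto 0).mono_left nhdsWithin_le_nhds
      obtain ⟨t, h1, h2⟩ := ((hc.eventually (mem_interior_iff_mem_nhds.1 hq)).and
        self_mem_nhdsWithin).exists
      exact ⟨t, h2, h1⟩
    obtain ⟨t₁, ht₁, h₁, -, -⟩ := key (pt 1 0 0)
    obtain ⟨t₂, ht₂, h₂, -, -⟩ := key (pt (-1) 0 0)
    obtain ⟨t₃, ht₃, -, h₃, -⟩ := key (pt 0 1 0)
    obtain ⟨t₄, ht₄, -, -, h₄⟩ := key (pt 0 (-1) 0)
    simp only [PiLp.add_apply, PiLp.smul_apply, smul_eq_mul, pt_zero, pt_one, pt_two] at h₁ h₂ h₃ h₄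
    rw [abs_le] at h₁ h₂
    rw [mul_zero, add_zero] at h₄
    exact ⟨abs_lt.2 ⟨by linarith, by linarith⟩, by linarith, by linarith⟩
  · exact fun q ⟨h0, h1, h2⟩ => ⟨h0.le, h1.le, h2.le⟩
  · have h0 := continuous_coord 0
    have h1 := continuous_coord 1
    have h2 := continuous_coord 2
    exact (isOpen_lt h0.abs continuous_const).inter
      ((isOpen_lt h1 continuous_const).inter (isOpen_lt h2.abs h1))

theorem nonempty_interior_wedge : (interior wedge).Nonempty := by
  rw [interior_wedge]
  exact ⟨pt 0 (1/2) 0, by simp; norm_num⟩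

theorem foldRegion_eq (hφ : Continuous fun q : ℝ × ℝ => φ q.1 q.2) :
    foldRegion φ = straighten hφ ⁻¹' wedge := by
  ext p
  have := strictMono_fifth.le_iff_le (a := p 1) (b := 1)
  simp only [one_pow] at this
  simp [foldRegion, wedge, straighten, abs_mul, this]

theorem interior_foldRegion (hφ : Continuous fun q : ℝ × ℝ => φ q.1 q.2) :
    interior (foldRegion φ) =
    {p | |p 0| < 1 ∧ p 1 < 1 ∧ 2 ^ 14 * |p 2 - φ (p 0) (p 1)| < p 1 ^ 5} := by
  rw [foldRegion_eq hφ, ← Homeomorph.preimage_interior, interior_wedge]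
  ext p
  have := strictMono_fifth.lt_iff_lt (a := p 1) (b := 1)
  simp only [one_pow] at this
  simp [straighten, abs_mul, this]

theorem foldRegion_subset_closure_interior
    (hφ : Continuous fun q : ℝ × ℝ => φ q.1 q.2) :
    foldRegion φ ⊆ closure (interior (foldRegion φ)) := by
  rw [foldRegion_eq hφ, ← Homeomorph.preimage_interior, ← Homeomorph.preimage_closure,
    convex_wedge.closure_interior_eq_closure_of_nonempty_interior nonempty_interior_wedge]
  exact preimage_mono subset_closure

theorem isC0SubmanifoldWithBoundary_foldRegion
    (hφ : Continuous fun q : ℝ × ℝ => φ q.1 q.2) :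
    IsC0SubmanifoldWithBoundary 3 (foldRegion φ) := by
  rw [foldRegion_eq hφ]
  exact isC0SubmanifoldWithBoundary_preimage _ convex_wedge isCompact_wedge nonempty_interior_wedge

end Region

section NearestInteger

/-- The distance of a real number to the nearest integer. -/
noncomputable def nd (t : ℝ) : ℝ := |t - round t|

theorem nd_nonneg (t : ℝ) : 0 ≤ nd t := abs_nonneg _

theorem nd_le (t : ℝ) (k : ℤ) : nd t ≤ |t - k| := round_le t k

theorem nd_eq {t : ℝ} {k : ℤ} (h : |t - k| ≤ 1 / 2) : nd t = |t - k| := by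
  refine le_antisymm (nd_le t k) ?_
  by_cases hk : round t = k
  · rw [nd, hk]
  · have h1 : (1:ℝ) ≤ |(round t : ℝ) - k| := by
      have : (1:ℤ) ≤ |round t - k| := Int.one_le_abs (sub_ne_zero.2 hk)
      exact_mod_cast this
    have h2 : |(round t : ℝ) - k| ≤ |t - k| + nd t := by
      rw [nd, abs_sub_comm t (round t), add_comm]
      exact abs_sub_le _ _ _
    linarith

theorem nd_le_add (s t : ℝ) : nd s ≤ nd t + |s - t| := by
  refine (nd_le s (round t)).trans ?_
  rw [nd, add_comm]
  exact abs_sub_le _ _ _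

theorem abs_nd_sub_le (s t : ℝ) : |nd s - nd t| ≤ |s - t| := by
  rw [abs_sub_le_iff]
  constructor
  · linarith [nd_le_add s t]
  · have := nd_le_add t s
    rw [abs_sub_comm t s] at this
    linarith

theorem nd_refined {t : ℝ} (h : nd t ≤ 1 / 4096) : 3 / 8 ≤ nd (512 * t + 511 / 2) := by
  have h1 : |512 * t + 511 / 2 - (512 * round t + 255 : ℤ)| = |512 * (t - round t) + 1 / 2| := by
    push_cast; congr 1; ring
  unfold nd at h
  obtain ⟨ha, hb⟩ := abs_le.1 h
  have h2 := nd_le_add ((512 * round t + 255 : ℤ) + 1 / 2 : ℝ) (512 * t + 511 / 2)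
  have h3 : nd ((512 * round t + 255 : ℤ) + 1 / 2 : ℝ) = 1 / 2 := by
    rw [nd_eq (k := 512 * round t + 255)] <;> rw [add_sub_cancel_left] <;> norm_num
  have h4 : |((512 * round t + 255 : ℤ) + 1 / 2 : ℝ) - (512 * t + 511 / 2)| ≤ 1 / 8 := by
    push_cast
    rw [abs_le]; constructor <;> linarith
  linarith

end NearestInteger

section Folds

/-- The period of the folds at scale `a`. -/
noncomputable def per (a : ℝ) : ℝ := a ^ 3 / 1024

/-- The half-width of the folds at scale `a`. -/
noncomputable def wid (a : ℝ) : ℝ := a * per a / 4096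

/-- The safety margin for heights at scale `a`. -/
noncomputable def mar (a : ℝ) : ℝ := a ^ 5 / 8

/-- The effective height of the folds at scale `a`. -/
noncomputable def eff (a : ℝ) : ℝ := (3 * per a / (1 - a / 2) - per a + 2 * wid a) / 2

/-- The height of the folds at scale `a`. -/
noncomputable def hgt (a : ℝ) : ℝ := eff a + 2 * mar a

/-- A periodic train of steep tents at scale `a`. -/
noncomputable def tent (a x : ℝ) : ℝ := hgt a * max 0 (1 - per a * nd (x / per a - 1 / 2) / wid a)

variable {a : ℝ}

theorem per_pos (h : 0 < a) : 0 < per a := by unfold per; positivity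

theorem wid_pos (h : 0 < a) : 0 < wid a := by unfold wid; have := per_pos h; positivity

theorem mar_pos (h : 0 < a) : 0 < mar a := by unfold mar; positivity

theorem wid_le (h : 0 < a) (h1 : a ≤ 1) : wid a ≤ per a / 4096 := by
  unfold wid; have := per_pos h; gcongr; nlinarith

theorem eff_eq (h1 : a ≤ 1) : (1 - a / 2) * (2 * eff a + per a - 2 * wid a) = 3 * per a := by
  have : 1 - a / 2 ≠ 0 := by linarith
  rw [show 2 * eff a + per a - 2 * wid a = 3 * per a / (1 - a / 2) by unfold eff; ring,
    mul_div_cancel₀ _ this]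

theorem eff_ge (h : 0 < a) (h1 : a ≤ 1) : per a ≤ eff a := by
  have := per_pos h
  have h2 := wid_pos h
  have h3 : 3 * per a ≤ 3 * per a / (1 - a / 2) := by
    rw [le_div_iff₀ (by linarith)]; nlinarith
  unfold eff; linarith

theorem eff_le (h : 0 < a) (h1 : a ≤ 1) : eff a ≤ 3 * per a := by
  have := per_pos h
  have h2 := wid_le h h1
  have h3 : 3 * per a / (1 - a / 2) ≤ 6 * per a := by
    rw [div_le_iff₀ (by linarith)]; nlinarith
  unfold eff; linarith

theorem eff_pos (h : 0 < a) (h1 : a ≤ 1) : 0 < eff a := (per_pos h).trans_le (eff_ge h h1)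

theorem hgt_pos (h : 0 < a) (h1 : a ≤ 1) : 0 < hgt a := by
  unfold hgt; linarith [eff_pos h h1, mar_pos h]

theorem hgt_le (h : 0 < a) (h1 : a ≤ 1) : hgt a ≤ a ^ 2 / 2 := by
  have h2 := eff_le h h1
  unfold per at h2
  unfold hgt mar
  have h3 : a ^ 3 ≤ a ^ 2 := pow_le_pow_of_le_one h.le h1 (by norm_num)
  have h5 : a ^ 5 ≤ a ^ 2 := pow_le_pow_of_le_one h.le h1 (by norm_num)
  nlinarith [sq_nonneg a]

theorem tent_nonneg (h : 0 < a) (h1 : a ≤ 1) (x : ℝ) : 0 ≤ tent a x :=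
  mul_nonneg (hgt_pos h h1).le (le_max_left _ _)

theorem tent_le (h : 0 < a) (h1 : a ≤ 1) (x : ℝ) : tent a x ≤ hgt a := by
  refine mul_le_of_le_one_right (hgt_pos h h1).le (max_le zero_le_one ?_)
  have := nd_nonneg (x / per a - 1 / 2)
  have h2 := per_pos h
  have h3 := wid_pos h
  have : 0 ≤ per a * nd (x / per a - 1 / 2) / wid a := by positivity
  linarith

theorem abs_tent_sub_le (h : 0 < a) (h1 : a ≤ 1) (x x' : ℝ) :
    |tent a x - tent a x'| ≤ hgt a / wid a * |x - x'| := by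
  have h0 := hgt_pos h h1
  have h2 := per_pos h
  have h3 := wid_pos h
  unfold tent
  rw [← mul_sub, abs_mul, abs_of_pos h0, div_mul_eq_mul_div (hgt a), mul_div_assoc (hgt a)]
  refine mul_le_mul_of_nonneg_left ?_ h0.le
  refine (abs_max_sub_max_le_max _ _ _ _).trans ?_
  rw [sub_self, abs_zero, max_eq_right (abs_nonneg _),
    show (1 - per a * nd (x / per a - 1 / 2) / wid a - (1 - per a * nd (x' / per a - 1 / 2) / wid a)) =
      per a * (nd (x' / per a - 1 / 2) - nd (x / per a - 1 / 2)) / wid a by ring,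
    abs_div, abs_mul, abs_of_pos h2, abs_of_pos h3]
  gcongr
  calc per a * |nd (x' / per a - 1 / 2) - nd (x / per a - 1 / 2)|
      ≤ per a * |x' / per a - 1 / 2 - (x / per a - 1 / 2)| := by
        exact mul_le_mul_of_nonneg_left (abs_nd_sub_le _ _) h2.le
    _ = |x - x'| := by
        rw [← abs_of_pos h2, ← abs_mul, abs_of_pos h2, abs_sub_comm]
        congr 1; field_simp; ring

theorem tent_eq_zero (h : 0 < a) {x : ℝ} (hx : wid a ≤ per a * nd (x / per a - 1 / 2)) :
    tent a x = 0 := by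
  have h3 := wid_pos h
  unfold tent
  rw [max_eq_left, mul_zero]
  have : 1 ≤ per a * nd (x / per a - 1 / 2) / wid a := by rwa [one_le_div h3]
  linarith

/-- The centre of a fold. -/
noncomputable def ctr (a : ℝ) (j : ℤ) : ℝ := per a * (j + 1 / 2)

theorem per_mul_nd_eq (h : 0 < a) {x : ℝ} {j : ℤ} (hx : |x - ctr a j| ≤ per a / 2) :
    per a * nd (x / per a - 1 / 2) = |x - ctr a j| := by
  have h2 := per_pos h
  have h4 : x - ctr a j = per a * (x / per a - 1 / 2 - j) := by
    unfold ctr; field_simp; ring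
  rw [h4, abs_mul, abs_of_pos h2] at hx ⊢
  rw [nd_eq]
  by_contra! h5
  nlinarith

theorem tent_eq (h : 0 < a) {x : ℝ} {j : ℤ} (hx : |x - ctr a j| ≤ per a / 2) :
    tent a x = hgt a * max 0 (1 - |x - ctr a j| / wid a) := by
  rw [tent, per_mul_nd_eq h hx]

/-- Points near folds at scale `a` are far from folds at scale `a / 8`. -/
theorem wid_lt_of_le_wid (h : 0 < a) (h1 : a ≤ 1) {x : ℝ}
    (hx : per a * nd (x / per a - 1 / 2) ≤ wid a) :
    wid (a / 8) < per (a / 8) * nd (x / per (a / 8) - 1 / 2) := by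
  have h2 := per_pos h
  have h3 := wid_le h h1
  have h4 : per (a / 8) = per a / 512 := by unfold per; ring
  have h5 := wid_le (a := a / 8) (by positivity) (by linarith)
  have h6 : nd (x / per a - 1 / 2) ≤ 1 / 4096 := by
    by_contra! h7
    nlinarith
  have h8 := nd_refined h6
  have h9 : x / per (a / 8) - 1 / 2 = 512 * (x / per a - 1 / 2) + 511 / 2 := by
    rw [h4]; field_simp; ring
  rw [h9]
  rw [h4] at h5 ⊢
  nlinarith

end Folds

section Cutoff

/-- A cutoff, equal to `1` on `[1/4, 4]` and supported in `[1/8, 8]`. -/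
noncomputable def cut (v : ℝ) : ℝ := max 0 (min 1 (min (8 * v - 1) ((8 - v) / 4)))

theorem cut_nonneg (v : ℝ) : 0 ≤ cut v := le_max_left _ _

theorem cut_le_one (v : ℝ) : cut v ≤ 1 := max_le zero_le_one (min_le_left _ _)

theorem cut_eq_one {v : ℝ} (h : 1 / 4 ≤ v) (h' : v ≤ 4) : cut v = 1 := by
  unfold cut
  rw [min_eq_left, max_eq_right zero_le_one]
  exact le_min (by linarith) (by linarith)

theorem cut_eq_zero_of_le {v : ℝ} (h : v ≤ 1 / 8) : cut v = 0 :=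
  max_eq_left ((min_le_right _ _).trans ((min_le_left _ _).trans (by linarith)))

theorem cut_eq_zero_of_ge {v : ℝ} (h : 8 ≤ v) : cut v = 0 :=
  max_eq_left ((min_le_right _ _).trans ((min_le_right _ _).trans (by linarith)))

theorem abs_cut_sub_le (v v' : ℝ) : |cut v - cut v'| ≤ 8 * |v - v'| := by
  have hn := abs_nonneg (v - v')
  have h1 : |(8 * v - 1) - (8 * v' - 1)| ≤ 8 * |v - v'| := by
    rw [show (8 * v - 1) - (8 * v' - 1) = 8 * (v - v') by ring, abs_mul]; norm_num
  have h2 : |(8 - v) / 4 - (8 - v') / 4| ≤ 8 * |v - v'| := by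
    rw [show (8 - v) / 4 - (8 - v') / 4 = -((v - v') / 4) by ring, abs_neg, abs_div]
    norm_num; linarith
  unfold cut
  refine (abs_max_sub_max_le_max _ _ _ _).trans (max_le (by simp) ?_)
  refine (abs_min_sub_min_le_max _ _ _ _).trans (max_le (by simp) ?_)
  exact (abs_min_sub_min_le_max _ _ _ _).trans (max_le h1 h2)

theorem continuous_cut : Continuous cut := by unfold cut; fun_prop

end Cutoff

section Profile

/-- The scale of the `n`-th wave. -/
noncomputable def sc (n : ℕ) : ℝ := (1 / 8) ^ n

theorem sc_pos (n : ℕ) : 0 < sc n := by unfold sc; positivity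

theorem sc_le_one (n : ℕ) : sc n ≤ 1 := pow_le_one₀ (by norm_num) (by norm_num)

theorem sc_succ (n : ℕ) : sc (n + 1) = sc n / 8 := by unfold sc; rw [pow_succ]; ring

theorem sc_mul_pow (n : ℕ) : 8 ^ n * sc n = 1 := by
  unfold sc; rw [← mul_pow]; norm_num

theorem summable_sc : Summable sc := summable_geometric_of_lt_one (by norm_num) (by norm_num)

theorem tsum_sc : ∑' n, sc n = 8 / 7 := by
  unfold sc; rw [tsum_geometric_of_lt_one (by norm_num) (by norm_num)]; norm_num

theorem tendsto_sc : Tendsto sc atTop (𝓝 0) :=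
  tendsto_pow_atTop_nhds_zero_of_lt_one (by norm_num) (by norm_num)

/-- The profile: at height `y` comparable to `8⁻ⁿ` it has the folds of scale `8⁻ⁿ`. -/
noncomputable def prof (x y : ℝ) : ℝ := ∑' n, cut (8 ^ n * y) * tent (sc n) x

theorem abs_prof_term_le (x y : ℝ) (n : ℕ) : |cut (8 ^ n * y) * tent (sc n) x| ≤ sc n ^ 2 / 2 := by
  have h0 := sc_pos n
  have h1 := sc_le_one n
  rw [abs_mul, abs_of_nonneg (cut_nonneg _), abs_of_nonneg (tent_nonneg h0 h1 x)]
  calc cut (8 ^ n * y) * tent (sc n) x ≤ 1 * (sc n ^ 2 / 2) :=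
        mul_le_mul (cut_le_one _) ((tent_le h0 h1 x).trans (hgt_le h0 h1)) (tent_nonneg h0 h1 x)
          zero_le_one
    _ = _ := one_mul _

theorem summable_sc_sq : Summable fun n => sc n ^ 2 / 2 := by
  refine Summable.of_nonneg_of_le (fun n => by positivity) (fun n => ?_) summable_sc
  nlinarith [sc_pos n, sc_le_one n]

theorem summable_prof (x y : ℝ) : Summable fun n => cut (8 ^ n * y) * tent (sc n) x :=
  Summable.of_norm_bounded summable_sc_sq (abs_prof_term_le x y)

theorem continuous_tent (n : ℕ) : Continuous (tent (sc n)) := by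
  refine (LipschitzWith.of_dist_le_mul (K := (hgt (sc n) / wid (sc n)).toNNReal)
    fun x y => ?_).continuous
  rw [Real.coe_toNNReal _ (div_nonneg (hgt_pos (sc_pos n) (sc_le_one n)).le
    (wid_pos (sc_pos n)).le)]
  exact abs_tent_sub_le (sc_pos n) (sc_le_one n) x y

theorem continuous_prof : Continuous fun q : ℝ × ℝ => prof q.1 q.2 := by
  refine continuous_tsum (fun n => ?_) summable_sc_sq fun n q => abs_prof_term_le q.1 q.2 n
  exact (continuous_cut.comp (by fun_prop)).mul ((continuous_tent n).comp continuous_fst)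

theorem abs_prof_sub_le_snd (x y y' : ℝ) : |prof x y - prof x y'| ≤ 5 * |y - y'| := by
  unfold prof
  rw [← (summable_prof x y).tsum_sub (summable_prof x y')]
  have hb : ∀ n, ‖cut (8 ^ n * y) * tent (sc n) x - cut (8 ^ n * y') * tent (sc n) x‖ ≤
      4 * |y - y'| * sc n := by
    intro n
    have h0 := sc_pos n
    have h1 := sc_le_one n
    have h2 := abs_cut_sub_le (8 ^ n * y) (8 ^ n * y')
    rw [← mul_sub, abs_mul (8 ^ n), abs_of_pos (show (0:ℝ) < 8 ^ n by positivity)] at h2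
    rw [← sub_mul, Real.norm_eq_abs, abs_mul, abs_of_nonneg (tent_nonneg h0 h1 x)]
    calc |cut (8 ^ n * y) - cut (8 ^ n * y')| * tent (sc n) x
        ≤ (8 * (8 ^ n * |y - y'|)) * (sc n ^ 2 / 2) :=
          mul_le_mul h2 ((tent_le h0 h1 x).trans (hgt_le h0 h1)) (tent_nonneg h0 h1 x)
            (by positivity)
      _ = 4 * |y - y'| * sc n * (8 ^ n * sc n) := by ring
      _ = _ := by rw [sc_mul_pow, mul_one]
  refine (tsum_of_norm_bounded (summable_sc.mul_left _).hasSum hb).trans ?_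
  rw [tsum_mul_left, tsum_sc]
  nlinarith [abs_nonneg (y - y')]

theorem exists_abs_prof_sub_le_fst {c : ℝ} (hc : 0 < c) :
    ∃ L : ℝ, 0 ≤ L ∧ ∀ y, c ≤ y → ∀ x x', |prof x y - prof x' y| ≤ L * |x - x'| := by
  obtain ⟨N, hN⟩ := pow_unbounded_of_one_lt (8 / c) (by norm_num : (1:ℝ) < 8)
  have hq : ∀ n, 0 ≤ hgt (sc n) / wid (sc n) := fun n =>
    div_nonneg (hgt_pos (sc_pos n) (sc_le_one n)).le (wid_pos (sc_pos n)).le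
  refine ⟨∑ n ∈ Finset.range N, hgt (sc n) / wid (sc n),
    Finset.sum_nonneg fun n _ => hq n, fun y hy x x' => ?_⟩
  have hz : ∀ x, ∀ n ∉ Finset.range N, cut (8 ^ n * y) * tent (sc n) x = 0 := by
    intro x n hn
    rw [cut_eq_zero_of_ge, zero_mul]
    have h1 : (8:ℝ) ^ N ≤ 8 ^ n := pow_le_pow_right₀ (by norm_num) (by simpa using hn)
    calc (8:ℝ) = 8 / c * c := by field_simp
      _ ≤ 8 ^ n * y := mul_le_mul (hN.le.trans h1) hy hc.le (by positivity)
  unfold prof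
  rw [tsum_eq_sum (hz x), tsum_eq_sum (hz x'), ← Finset.sum_sub_distrib, Finset.sum_mul]
  refine (Finset.abs_sum_le_sum_abs _ _).trans (Finset.sum_le_sum fun n _ => ?_)
  rw [← mul_sub, abs_mul, abs_of_nonneg (cut_nonneg _)]
  calc cut (8 ^ n * y) * |tent (sc n) x - tent (sc n) x'|
      ≤ 1 * |tent (sc n) x - tent (sc n) x'| := by gcongr; exact cut_le_one _
    _ ≤ _ := by rw [one_mul]; exact abs_tent_sub_le (sc_pos n) (sc_le_one n) x x'

theorem cut_eq_zero_of_far {m n : ℕ} {y : ℝ} (h : m + 2 ≤ n ∨ n + 2 ≤ m)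
    (h1 : 1 / 4 ≤ 8 ^ n * y) (h2 : 8 ^ n * y ≤ 4) : cut (8 ^ m * y) = 0 := by
  have hy : 0 < y := by
    by_contra! hy
    have : (8:ℝ) ^ n * y ≤ 0 := mul_nonpos_of_nonneg_of_nonpos (by positivity) hy
    linarith
  rcases h with h | h
  · have h3 : (8:ℝ) ^ (m + 2) ≤ 8 ^ n := pow_le_pow_right₀ (by norm_num) h
    rw [pow_add] at h3
    exact cut_eq_zero_of_le (by nlinarith)
  · have h3 : (8:ℝ) ^ (n + 2) ≤ 8 ^ m := pow_le_pow_right₀ (by norm_num) h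
    rw [pow_add] at h3
    exact cut_eq_zero_of_ge (by nlinarith)

theorem prof_eq_tent {n : ℕ} {x y : ℝ} (h1 : 1 / 4 ≤ 8 ^ n * y) (h2 : 8 ^ n * y ≤ 4)
    (hx : per (sc n) * nd (x / per (sc n) - 1 / 2) ≤ wid (sc n)) : prof x y = tent (sc n) x := by
  unfold prof
  rw [tsum_eq_single n, cut_eq_one h1 h2, one_mul]
  intro m hm
  by_cases hf : m + 2 ≤ n ∨ n + 2 ≤ m
  · rw [cut_eq_zero_of_far hf h1 h2, zero_mul]
  · have : m = n + 1 ∨ n = m + 1 := by omega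
    rcases this with rfl | rfl
    · have h3 := wid_lt_of_le_wid (sc_pos n) (sc_le_one n) hx
      rw [← sc_succ] at h3
      rw [tent_eq_zero (sc_pos _) h3.le, mul_zero]
    · by_contra h0
      have h3 : per (sc m) * nd (x / per (sc m) - 1 / 2) ≤ wid (sc m) := by
        by_contra! h3
        exact h0 (by rw [tent_eq_zero (sc_pos m) h3.le, mul_zero])
      have h6 := wid_lt_of_le_wid (sc_pos m) (sc_le_one m) h3
      rw [← sc_succ] at h6
      exact absurd hx (not_le.2 h6)

theorem prof_sc (n : ℕ) (x : ℝ) : prof x (sc n) = tent (sc n) x := by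
  unfold prof
  rw [tsum_eq_single n, sc_mul_pow, cut_eq_one (by norm_num) (by norm_num), one_mul]
  intro m hm
  rcases lt_or_gt_of_ne hm with h | h
  · have h3 : (8:ℝ) ^ (m + 1) ≤ 8 ^ n := pow_le_pow_right₀ (by norm_num) h
    rw [pow_succ] at h3
    rw [cut_eq_zero_of_le, zero_mul]
    nlinarith [sc_mul_pow n, sc_pos n]
  · have h3 : (8:ℝ) ^ (n + 1) ≤ 8 ^ m := pow_le_pow_right₀ (by norm_num) h
    rw [pow_succ] at h3
    rw [cut_eq_zero_of_ge, zero_mul]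
    nlinarith [sc_mul_pow n, sc_pos n]

end Profile

section Moves

/-- The region used for the counterexample. -/
noncomputable def region : Set E³ := foldRegion prof

theorem mem_interior_region {p : E³} : p ∈ interior region ↔
    |p 0| < 1 ∧ p 1 < 1 ∧ 2 ^ 14 * |p 2 - prof (p 0) (p 1)| < p 1 ^ 5 := by
  rw [region, interior_foldRegion continuous_prof]; rfl

theorem pos_of_mem_interior_region {p : E³} (hp : p ∈ interior region) : 0 < p 1 := by
  have h := (mem_interior_region.1 hp).2.2
  have h2 : 0 < p 1 ^ 5 := lt_of_le_of_lt (by positivity) h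
  exact (Odd.pow_pos_iff (by decide)).1 h2

theorem nonneg_of_mem_region {p : E³} (hp : p ∈ region) : 0 ≤ p 1 := by
  have h2 : 0 ≤ p 1 ^ 5 := le_trans (by positivity) hp.2.2
  exact (Odd.pow_nonneg_iff (by decide)).1 h2

/-- Points of the region in coordinates adapted to it. -/
noncomputable def rpt (x y r : ℝ) : E³ := pt x y (prof x y + r * (y ^ 5 / 2 ^ 14))

theorem rpt_mem {x y r : ℝ} (hx : |x| < 1) (hy : 0 < y) (hy1 : y < 1) (hr : |r| < 1) :
    rpt x y r ∈ interior region := by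
  rw [mem_interior_region]
  refine ⟨hx, hy1, ?_⟩
  simp only [rpt, pt_zero, pt_one, pt_two, add_sub_cancel_left]
  have h5 : 0 < y ^ 5 := by positivity
  rw [abs_mul, abs_of_pos (show 0 < y ^ 5 / 2 ^ 14 by positivity)]
  nlinarith

/-- The normalized vertical coordinate. -/
noncomputable def rco (p : E³) : ℝ := 2 ^ 14 * (p 2 - prof (p 0) (p 1)) / p 1 ^ 5

theorem rpt_rco {p : E³} (hp : 0 < p 1) : rpt (p 0) (p 1) (rco p) = p := by
  have h : prof (p 0) (p 1) + rco p * (p 1 ^ 5 / 2 ^ 14) = p 2 := by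
    unfold rco; field_simp; ring
  rw [rpt, h, pt_eta]

theorem abs_rco_lt {p : E³} (hp : p ∈ interior region) : |rco p| < 1 := by
  have h0 := pos_of_mem_interior_region hp
  have h5 : 0 < p 1 ^ 5 := by positivity
  have h := (mem_interior_region.1 hp).2.2
  unfold rco
  rw [abs_div, abs_mul, abs_of_pos h5, div_lt_one h5]
  simpa using h

theorem infSmoothLength_le_of_lipschitz {S : Set E³} (hS : IsOpen S) {γ : ℝ → E³} {a b K : ℝ}
    (hU : ∀ t ∈ uIcc a b, γ t ∈ S)
    (h : ∀ s ∈ uIcc a b, ∀ t ∈ uIcc a b, dist (γ s) (γ t) ≤ K * |s - t|) :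
    infSmoothLength S (γ a) (γ b) ≤ ENNReal.ofReal (K * |a - b|) := by
  wlog hab : a ≤ b generalizing a b
  · rw [infSmoothLength_comm_s19, abs_sub_comm]
    rw [uIcc_comm] at hU h
    exact this hU h (le_of_not_ge hab)
  rw [uIcc_of_le hab] at hU h
  have hc : ContinuousOn γ (Icc a b) := by
    refine (LipschitzOnWith.of_dist_le_mul (K := K.toNNReal) fun s hs t ht => ?_).continuousOn
    exact (h s hs t ht).trans (mul_le_mul_of_nonneg_right (Real.le_coe_toNNReal K) (abs_nonneg _))
  refine (infSmoothLength_le_of_edist_le (f := fun t => K * t) hS hab hU hc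
    fun s t h1 h2 h3 => ?_).trans (le_of_eq ?_)
  · have := h s ⟨h1, h2.trans h3⟩ t ⟨h1.trans h2, h3⟩
    rwa [abs_sub_comm, abs_of_nonneg (sub_nonneg.2 h2), mul_sub] at this
  · rw [abs_sub_comm, abs_of_nonneg (sub_nonneg.2 hab), mul_sub]

theorem abs_lt_one_of_mem_uIcc {a b t : ℝ} (ha : |a| < 1) (hb : |b| < 1) (ht : t ∈ uIcc a b) :
    |t| < 1 := by
  rw [abs_lt] at *
  exact ⟨(lt_min ha.1 hb.1).trans_le ht.1, ht.2.trans_lt (max_lt ha.2 hb.2)⟩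

variable {x x' y y' r r' : ℝ}

theorem infSmoothLength_rpt_thd (hx : |x| < 1) (hy : 0 < y) (hy1 : y < 1) (hr : |r| < 1)
    (hr' : |r'| < 1) : infSmoothLength (interior region) (rpt x y r) (rpt x y r') ≤
      ENNReal.ofReal (y * |r - r'|) := by
  refine infSmoothLength_le_of_lipschitz (γ := fun r => rpt x y r) isOpen_interior
    (fun t ht => rpt_mem hx hy hy1 (abs_lt_one_of_mem_uIcc hr hr' ht)) fun s _ t _ => ?_
  refine (dist_le_abs_add _ _).trans ?_
  simp only [rpt, pt_zero, pt_one, pt_two, sub_self, abs_zero, zero_add, add_sub_add_left_eq_sub]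
  rw [← sub_mul, abs_mul, mul_comm, abs_of_pos (by positivity)]
  refine mul_le_mul_of_nonneg_right ?_ (abs_nonneg _)
  have : y ^ 5 ≤ y := by simpa using pow_le_pow_of_le_one hy.le hy1.le (show 1 ≤ 5 by norm_num)
  linarith

theorem abs_pow_five_sub_le (hy : 0 < y) (hy1 : y < 1) (hy' : 0 < y') (hy1' : y' < 1) :
    |y ^ 5 - y' ^ 5| ≤ 5 * |y - y'| := by
  rw [show y ^ 5 - y' ^ 5 = (y ^ 4 + y ^ 3 * y' + y ^ 2 * y' ^ 2 + y * y' ^ 3 + y' ^ 4) * (y - y') by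
    ring, abs_mul]
  refine mul_le_mul_of_nonneg_right ?_ (abs_nonneg _)
  rw [abs_of_pos (by positivity)]
  have h1 : y ^ 4 ≤ 1 := pow_le_one₀ hy.le hy1.le
  have h2 : y' ^ 4 ≤ 1 := pow_le_one₀ hy'.le hy1'.le
  have h3 : y ^ 3 * y' ≤ 1 := mul_le_one₀ (pow_le_one₀ hy.le hy1.le) hy'.le hy1'.le
  have h4 : y ^ 2 * y' ^ 2 ≤ 1 :=
    mul_le_one₀ (pow_le_one₀ hy.le hy1.le) (by positivity) (pow_le_one₀ hy'.le hy1'.le)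
  have h5 : y * y' ^ 3 ≤ 1 := mul_le_one₀ hy1.le (by positivity) (pow_le_one₀ hy'.le hy1'.le)
  linarith

theorem infSmoothLength_rpt_snd (hx : |x| < 1) (hy : 0 < y) (hy1 : y < 1) (hy' : 0 < y')
    (hy1' : y' < 1) (hr : |r| < 1) :
    infSmoothLength (interior region) (rpt x y r) (rpt x y' r) ≤ ENNReal.ofReal (7 * |y - y'|) := by
  have hI : ∀ t ∈ uIcc y y', 0 < t ∧ t < 1 := fun t ht =>
    ⟨(lt_min hy hy').trans_le ht.1, ht.2.trans_lt (max_lt hy1 hy1')⟩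
  refine infSmoothLength_le_of_lipschitz (γ := fun y => rpt x y r) isOpen_interior
    (fun t ht => rpt_mem hx (hI t ht).1 (hI t ht).2 hr) fun s hs t ht => ?_
  refine (dist_le_abs_add _ _).trans ?_
  simp only [rpt, pt_zero, pt_one, pt_two, sub_self, abs_zero, zero_add]
  have h1 := abs_prof_sub_le_snd x s t
  have h2 := abs_pow_five_sub_le (hI s hs).1 (hI s hs).2 (hI t ht).1 (hI t ht).2
  have h3 : |prof x s + r * (s ^ 5 / 2 ^ 14) - (prof x t + r * (t ^ 5 / 2 ^ 14))| ≤
      |prof x s - prof x t| + |r| * (|s ^ 5 - t ^ 5| / 2 ^ 14) := by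
    rw [show prof x s + r * (s ^ 5 / 2 ^ 14) - (prof x t + r * (t ^ 5 / 2 ^ 14)) =
      (prof x s - prof x t) + r * ((s ^ 5 - t ^ 5) / 2 ^ 14) by ring]
    refine (abs_add_le _ _).trans (le_of_eq ?_)
    rw [abs_mul, abs_div, abs_of_pos (show (0:ℝ) < 2 ^ 14 by positivity)]
  have h4 : |r| * (|s ^ 5 - t ^ 5| / 2 ^ 14) ≤ 1 * (|s ^ 5 - t ^ 5| / 2 ^ 14) :=
    mul_le_mul_of_nonneg_right hr.le (by positivity)
  linarith [abs_nonneg (s - t)]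

theorem exists_infSmoothLength_rpt_fst {c : ℝ} (hc : 0 < c) : ∃ L : ℝ, 0 ≤ L ∧ ∀ x x' y r : ℝ,
    |x| < 1 → |x'| < 1 → c ≤ y → y < 1 → |r| < 1 →
    infSmoothLength (interior region) (rpt x y r) (rpt x' y r) ≤ ENNReal.ofReal (L * |x - x'|) := by
  obtain ⟨L, hL, h⟩ := exists_abs_prof_sub_le_fst hc
  refine ⟨1 + L, by positivity, fun x x' y r hx hx' hy hy1 hr => ?_⟩
  refine infSmoothLength_le_of_lipschitz (γ := fun x => rpt x y r) isOpen_interior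
    (fun t ht => rpt_mem (abs_lt_one_of_mem_uIcc hx hx' ht) (hc.trans_le hy) hy1 hr)
    fun s _ t _ => ?_
  refine (dist_le_abs_add _ _).trans ?_
  simp only [rpt, pt_zero, pt_one, pt_two, sub_self, abs_zero, add_zero, add_sub_add_right_eq_sub]
  linarith [h y hy s t]

end Moves

section Travel

theorem tent_monotoneOn_or_antitoneOn {a : ℝ} (h : 0 < a) (h1 : a ≤ 1) (q : ℤ) :
    MonotoneOn (tent a) (Icc (q * (per a / 2)) ((q + 1) * (per a / 2))) ∨
    AntitoneOn (tent a) (Icc (q * (per a / 2)) ((q + 1) * (per a / 2))) := by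
  have h2 := per_pos h
  have h3 := wid_pos h
  have h4 := hgt_pos h h1
  rcases Int.even_or_odd' q with ⟨j, rfl | rfl⟩
  · left
    intro s hs t ht hst
    push_cast at hs ht
    have hc : ctr a j = (2 * j + 1) * (per a / 2) := by unfold ctr; ring
    have es : |s - ctr a j| = ctr a j - s := by
      rw [abs_of_nonpos (by linarith [hs.2])]; ring
    have et : |t - ctr a j| = ctr a j - t := by
      rw [abs_of_nonpos (by linarith [ht.2])]; ring
    rw [tent_eq h (j := j) (by rw [es]; linarith [hs.1]),
      tent_eq h (j := j) (by rw [et]; linarith [ht.1]), es, et]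
    gcongr
  · right
    intro s hs t ht hst
    push_cast at hs ht
    have hc : ctr a j = (2 * j + 1) * (per a / 2) := by unfold ctr; ring
    have es : |s - ctr a j| = s - ctr a j := abs_of_nonneg (by linarith [hs.1])
    have et : |t - ctr a j| = t - ctr a j := abs_of_nonneg (by linarith [ht.1])
    rw [tent_eq h (j := j) (x := s) (by rw [es]; linarith [hs.2]),
      tent_eq h (j := j) (x := t) (by rw [et]; linarith [ht.2]), es, et]
    gcongr

variable {n : ℕ} {x x' : ℝ}

theorem rpt_sc (n : ℕ) (x : ℝ) : rpt x (sc n) 0 = pt x (sc n) (tent (sc n) x) := by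
  rw [rpt, prof_sc, zero_mul, add_zero]

theorem sc_lt_one (hn : 1 ≤ n) : sc n < 1 := pow_lt_one₀ (by norm_num) (by norm_num) (by omega)

theorem infSmoothLength_half_cell (hn : 1 ≤ n) {q : ℤ} (hxx : x ≤ x') (hx : |x| < 1) (hx' : |x'| < 1)
    (hq : q * (per (sc n) / 2) ≤ x) (hq' : x' ≤ (q + 1) * (per (sc n) / 2)) :
    infSmoothLength (interior region) (rpt x (sc n) 0) (rpt x' (sc n) 0) ≤
      ENNReal.ofReal (x' - x + hgt (sc n)) := by
  have h0 := sc_pos n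
  have h1 := sc_le_one n
  have hmem : ∀ t ∈ Icc x x', rpt t (sc n) 0 ∈ interior region := fun t ht =>
    rpt_mem (abs_lt_one_of_mem_uIcc hx hx' (by rwa [uIcc_of_le hxx])) h0 (sc_lt_one hn) (by simp)
  have hcont : ContinuousOn (fun t => rpt t (sc n) 0) (Icc x x') := by
    simp only [rpt_sc]
    exact (continuous_pt continuous_id continuous_const (continuous_tent n)).continuousOn
  have hd : ∀ s t, s ≤ t → dist (rpt s (sc n) 0) (rpt t (sc n) 0) ≤
      (t - s) + |tent (sc n) s - tent (sc n) t| := by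
    intro s t hst
    refine (dist_le_abs_add _ _).trans ?_
    simp only [rpt_sc, pt_zero, pt_one, pt_two, sub_self, abs_zero, add_zero]
    rw [abs_sub_comm s t, abs_of_nonneg (sub_nonneg.2 hst)]
  have hsub : ∀ t ∈ Icc x x', t ∈ Icc (q * (per (sc n) / 2)) ((q + 1) * (per (sc n) / 2)) :=
    fun t ht => ⟨hq.trans ht.1, ht.2.trans hq'⟩
  have e1 := tent_nonneg h0 h1 x
  have e2 := tent_nonneg h0 h1 x'
  have e3 := tent_le h0 h1 x
  have e4 := tent_le h0 h1 x'
  rcases tent_monotoneOn_or_antitoneOn h0 h1 q with hm | hm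
  · refine (infSmoothLength_le_of_edist_le (f := fun t => t + tent (sc n) t) isOpen_interior hxx
      hmem hcont fun s t hs hst ht => (hd s t hst).trans ?_).trans (ENNReal.ofReal_le_ofReal ?_)
    · have := hm (hsub s ⟨hs, hst.trans ht⟩) (hsub t ⟨hs.trans hst, ht⟩) hst
      rw [abs_of_nonpos (by linarith)]; linarith
    · linarith
  · refine (infSmoothLength_le_of_edist_le (f := fun t => t - tent (sc n) t) isOpen_interior hxx
      hmem hcont fun s t hs hst ht => (hd s t hst).trans ?_).trans (ENNReal.ofReal_le_ofReal ?_)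
    · have := hm (hsub s ⟨hs, hst.trans ht⟩) (hsub t ⟨hs.trans hst, ht⟩) hst
      rw [abs_of_nonneg (by linarith)]; linarith
    · linarith

theorem infSmoothLength_cells (hn : 1 ≤ n) {q : ℤ} (hx : |x| < 1) (hq : q * (per (sc n) / 2) ≤ x)
    (hq1 : x ≤ (q + 1) * (per (sc n) / 2)) (k : ℕ) :
    ∀ x', x ≤ x' → |x'| < 1 → x' ≤ (q + k + 1) * (per (sc n) / 2) →
    infSmoothLength (interior region) (rpt x (sc n) 0) (rpt x' (sc n) 0) ≤
      ENNReal.ofReal (x' - x + (k + 1) * hgt (sc n)) := by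
  have hD := per_pos (sc_pos n)
  have hH := hgt_pos (sc_pos n) (sc_le_one n)
  induction k with
  | zero =>
    intro x' hxx hx' hk
    simpa using infSmoothLength_half_cell hn hxx hx hx' hq (by simpa using hk)
  | succ k ih =>
    intro x' hxx hx' hk
    push_cast at hk ⊢
    rcases le_total x' ((q + k + 1) * (per (sc n) / 2)) with h | h
    · refine (ih x' hxx hx' h).trans (ENNReal.ofReal_le_ofReal ?_)
      linarith
    · set m : ℝ := (q + k + 1) * (per (sc n) / 2) with hm
      have hxm : x ≤ m := by
        refine hq1.trans ?_
        have : (0:ℝ) ≤ k * (per (sc n) / 2) := by positivity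
        rw [hm]; linarith
      have hm1 : |m| < 1 :=
        abs_lt_one_of_mem_uIcc hx hx' (by rw [uIcc_of_le hxx]; exact ⟨hxm, h⟩)
      refine (infSmoothLength_triangle_s19 (y := rpt m (sc n) 0)).trans ?_
      refine (add_le_add (ih m hxm hm1 le_rfl) (infSmoothLength_half_cell hn (q := q + k + 1) h hm1
        hx' (by push_cast; rfl) (by push_cast; linarith))).trans (le_of_eq ?_)
      rw [← ENNReal.ofReal_add]
      · congr 1; ring
      · have : 0 ≤ m - x := by linarith
        positivity
      · linarith

theorem infSmoothLength_travel (hn : 1 ≤ n) (hx : |x| < 1) (hx' : |x'| < 1) :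
    infSmoothLength (interior region) (rpt x (sc n) 0) (rpt x' (sc n) 0) ≤
      ENNReal.ofReal ((1 + 2 * (hgt (sc n) / per (sc n))) * |x - x'| + 2 * hgt (sc n)) := by
  wlog hxx : x ≤ x' generalizing x x'
  · rw [infSmoothLength_comm_s19, abs_sub_comm]; exact this hx' hx (le_of_not_ge hxx)
  have hD := per_pos (sc_pos n)
  have hH := hgt_pos (sc_pos n) (sc_le_one n)
  set D := per (sc n)
  set q := ⌊x / (D / 2)⌋ with hq
  have h1 : q * (D / 2) ≤ x := by
    rw [← le_div_iff₀ (by positivity)]; exact Int.floor_le _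
  have h2 : x ≤ (q + 1) * (D / 2) := by
    rw [← div_le_iff₀ (by positivity)]; exact (Int.lt_floor_add_one _).le
  set k := ⌈x' / (D / 2) - q - 1⌉₊ with hk
  have h3 : x' ≤ (q + k + 1) * (D / 2) := by
    have := Nat.le_ceil (x' / (D / 2) - q - 1)
    rw [← hk] at this
    rw [← div_le_iff₀ (by positivity)]; linarith
  have h4 : (k : ℝ) ≤ 2 * (x' - x) / D + 1 := by
    rcases le_total 0 (x' / (D / 2) - q - 1) with h | h
    · have h5 := Nat.ceil_lt_add_one h
      have h6 : x / (D / 2) ≤ q + 1 := (Int.lt_floor_add_one _).le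
      have h7 : 2 * (x' - x) / D = x' / (D / 2) - x / (D / 2) := by field_simp
      rw [← hk] at h5
      linarith
    · rw [hk, Nat.ceil_eq_zero.2 h]
      have : 0 ≤ x' - x := by linarith
      push_cast
      positivity
  refine (infSmoothLength_cells hn hx h1 h2 k x' hxx hx' h3).trans (ENNReal.ofReal_le_ofReal ?_)
  rw [abs_sub_comm, abs_of_nonneg (by linarith)]
  have h5 := mul_le_mul_of_nonneg_right h4 hH.le
  have h6 : (2 * (x' - x) / D + 1) * hgt (sc n) = 2 * (hgt (sc n) / D) * (x' - x) + hgt (sc n) := by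
    field_simp
  linarith

end Travel

section UpperBounds

theorem hgt_div_per {a : ℝ} (h : 0 < a) :
    hgt a / per a = (3 / (1 - a / 2) - 1 + a / 2048) / 2 + 256 * a ^ 2 := by
  have h2 := per_pos h
  have e1 : eff a / per a = (3 / (1 - a / 2) - 1 + a / 2048) / 2 := by
    unfold eff wid
    field_simp
    ring
  have e2 : 2 * mar a / per a = 256 * a ^ 2 := by
    unfold mar per
    field_simp
    ring
  rw [hgt, add_div, e1, e2]

theorem tendsto_hgt_div_per : Tendsto (fun n => hgt (sc n) / per (sc n)) atTop (𝓝 1) := by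
  simp only [hgt_div_per (sc_pos _)]
  have h : ContinuousAt (fun a : ℝ => (3 / (1 - a / 2) - 1 + a / 2048) / 2 + 256 * a ^ 2) 0 := by
    fun_prop (disch := norm_num)
  have := h.tendsto.comp tendsto_sc
  norm_num at this
  exact this

theorem tendsto_hgt : Tendsto (fun n => hgt (sc n)) atTop (𝓝 0) := by
  refine squeeze_zero (fun n => (hgt_pos (sc_pos n) (sc_le_one n)).le)
    (fun n => (hgt_le (sc_pos n) (sc_le_one n)).trans ?_) tendsto_sc
  nlinarith [sc_pos n, sc_le_one n]

theorem infSmoothLength_to_level {n : ℕ} (hn : 1 ≤ n) {p : E³} (hp : p ∈ interior region) :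
    infSmoothLength (interior region) p (rpt (p 0) (sc n) 0) ≤
      ENNReal.ofReal (8 * p 1 + 7 * sc n) := by
  have h0 := pos_of_mem_interior_region hp
  obtain ⟨hx, hy, -⟩ := mem_interior_region.1 hp
  have hr := abs_rco_lt hp
  have h1 : infSmoothLength (interior region) p (rpt (p 0) (p 1) 0) ≤ ENNReal.ofReal (p 1) := by
    have := infSmoothLength_rpt_thd hx h0 hy hr (r' := 0) (by simp)
    rw [rpt_rco h0] at this
    refine this.trans (ENNReal.ofReal_le_ofReal ?_)
    rw [sub_zero]
    exact mul_le_of_le_one_right h0.le hr.le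
  have h2 := infSmoothLength_rpt_snd hx h0 hy (sc_pos n) (sc_lt_one hn) (r := 0) (by simp)
  refine infSmoothLength_triangle_s19.trans ((add_le_add h1 h2).trans ?_)
  rw [← ENNReal.ofReal_add h0.le (by positivity)]
  refine ENNReal.ofReal_le_ofReal ?_
  have : |p 1 - sc n| ≤ p 1 + sc n :=
    abs_le.2 ⟨by linarith [sc_pos n], by linarith [sc_pos n]⟩
  linarith

theorem infSmoothLength_global {p q : E³} (hp : p ∈ interior region) (hq : q ∈ interior region) :
    infSmoothLength (interior region) p q ≤
      ENNReal.ofReal (8 * (p 1 + q 1) + 3 * |p 0 - q 0|) := by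
  have hp0 := pos_of_mem_interior_region hp
  have hq0 := pos_of_mem_interior_region hq
  have hlim : Tendsto (fun n => ENNReal.ofReal ((8 * p 1 + 7 * sc n) +
      ((1 + 2 * (hgt (sc n) / per (sc n))) * |p 0 - q 0| + 2 * hgt (sc n)) +
      (8 * q 1 + 7 * sc n))) atTop (𝓝 (ENNReal.ofReal ((8 * p 1 + 7 * 0) +
      ((1 + 2 * 1) * |p 0 - q 0| + 2 * 0) + (8 * q 1 + 7 * 0)))) := by
    refine ENNReal.tendsto_ofReal ?_
    exact (((tendsto_sc.const_mul 7).const_add _).add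
      ((((tendsto_hgt_div_per.const_mul 2).const_add 1).mul_const _).add
        (tendsto_hgt.const_mul 2))).add ((tendsto_sc.const_mul 7).const_add _)
  rw [show (8 * p 1 + 7 * 0) + ((1 + 2 * 1) * |p 0 - q 0| + 2 * 0) + (8 * q 1 + 7 * 0) =
    8 * (p 1 + q 1) + 3 * |p 0 - q 0| by ring] at hlim
  refine ge_of_tendsto hlim ?_
  filter_upwards [eventually_ge_atTop 1] with n hn
  have hH := hgt_pos (sc_pos n) (sc_le_one n)
  have hD := per_pos (sc_pos n)
  have hs := sc_pos n
  have h1 := infSmoothLength_to_level hn hp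
  have h2 := infSmoothLength_to_level hn hq
  rw [infSmoothLength_comm_s19] at h2
  have h3 := infSmoothLength_travel hn (mem_interior_region.1 hp).1 (mem_interior_region.1 hq).1
  rw [ENNReal.ofReal_add (by positivity) (by positivity),
    ENNReal.ofReal_add (by positivity) (by positivity)]
  exact infSmoothLength_triangle_s19.trans
    (add_le_add (infSmoothLength_triangle_s19.trans (add_le_add h1 h3)) h2)

theorem infSmoothLength_lt_top {p q : E³} (hp : p ∈ interior region) (hq : q ∈ interior region) :
    infSmoothLength (interior region) p q < ⊤ :=
  (infSmoothLength_global hp hq).trans_lt ENNReal.ofReal_lt_top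

theorem interiorLocallyShort_of_pos {p : E³} (hp : 0 < p 1) {ε : ℝ} (hε : 0 < ε) :
    ∃ N ∈ 𝓝 p, ∀ x ∈ N ∩ interior region, ∀ y ∈ N ∩ interior region,
      infSmoothLength (interior region) x y ≤ ENNReal.ofReal ε := by
  obtain ⟨L, hL, h⟩ := exists_infSmoothLength_rpt_fst (half_pos hp)
  set δ := ε / (18 + 2 * L) with hδ
  have hδ0 : 0 < δ := by positivity
  have hδε : (18 + 2 * L) * δ = ε := by rw [hδ]; field_simp
  have hc0 : ContinuousAt (fun q : E³ => q 0) p := (continuous_coord 0).continuousAt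
  have hc1 : ContinuousAt (fun q : E³ => q 1) p := (continuous_coord 1).continuousAt
  have hcr : ContinuousAt rco p := by
    have : Continuous fun q : E³ => 2 ^ 14 * (q 2 - prof (q 0) (q 1)) :=
      continuous_const.mul ((continuous_coord 2).sub
        (continuous_prof.comp ((continuous_coord 0).prodMk (continuous_coord 1))))
    exact this.continuousAt.div (hc1.pow 5) (by positivity)
  have e0 := Metric.tendsto_nhds.1 hc0.tendsto δ hδ0
  have e1 := Metric.tendsto_nhds.1 hc1.tendsto δ hδ0
  have er := Metric.tendsto_nhds.1 hcr.tendsto δ hδ0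
  have el := hc1.tendsto.eventually (lt_mem_nhds (half_lt_self hp))
  refine ⟨_, ((e0.and e1).and er).and el, ?_⟩
  rintro u ⟨⟨⟨⟨hu0, hu1⟩, hur⟩, hul⟩, hu⟩ v ⟨⟨⟨⟨hv0, hv1⟩, hvr⟩, hvl⟩, hv⟩
  rw [Real.dist_eq] at hu0 hu1 hur hv0 hv1 hvr
  have hup := pos_of_mem_interior_region hu
  have hvp := pos_of_mem_interior_region hv
  obtain ⟨hux, huy, -⟩ := mem_interior_region.1 hu
  obtain ⟨hvx, hvy, -⟩ := mem_interior_region.1 hv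
  have hru := abs_rco_lt hu
  have hrv := abs_rco_lt hv
  have d2 : ∀ {s t c : ℝ}, |s - c| < δ → |t - c| < δ → |s - t| ≤ 2 * δ := by
    intro s t c h1 h2
    have := abs_sub_le s c t
    rw [abs_sub_comm c t] at this
    linarith
  have h1 := infSmoothLength_rpt_thd hux hup huy hru hrv
  have h2 := infSmoothLength_rpt_snd hux hup huy hvp hvy hrv
  have h3 := h (u 0) (v 0) (v 1) (rco v) hux hvx hvl.le hvy hrv
  rw [rpt_rco hup] at h1
  rw [rpt_rco hvp] at h3
  refine (infSmoothLength_triangle_s19.trans (add_le_add (infSmoothLength_triangle_s19.trans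
    (add_le_add h1 h2)) h3)).trans ?_
  rw [← ENNReal.ofReal_add (by positivity) (by positivity),
    ← ENNReal.ofReal_add (by positivity) (by positivity)]
  refine ENNReal.ofReal_le_ofReal ?_
  have k1 : u 1 * |rco u - rco v| ≤ 1 * (2 * δ) :=
    mul_le_mul huy.le (d2 hur hvr) (abs_nonneg _) zero_le_one
  have k2 := d2 hu1 hv1
  have k3 := mul_le_mul_of_nonneg_left (d2 hu0 hv0) hL
  linarith

theorem interiorLocallyShort_region : InteriorLocallyShort region := by
  intro p hp ε hε
  rcases (nonneg_of_mem_region hp).lt_or_eq with h | h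
  · exact interiorLocallyShort_of_pos h hε
  have e0 := Metric.tendsto_nhds.1 ((continuous_coord 0).tendsto p) (ε / 100) (by positivity)
  have e1 := Metric.tendsto_nhds.1 ((continuous_coord 1).tendsto p) (ε / 100) (by positivity)
  refine ⟨_, e0.and e1, ?_⟩
  rintro u ⟨⟨hu0, hu1⟩, hu⟩ v ⟨⟨hv0, hv1⟩, hv⟩
  rw [Real.dist_eq, abs_lt] at hu0 hu1 hv0 hv1
  refine (infSmoothLength_global hu hv).trans (ENNReal.ofReal_le_ofReal ?_)
  have : |u 0 - v 0| ≤ 2 * (ε / 100) :=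
    abs_le.2 ⟨by linarith [hu0.1, hv0.2], by linarith [hu0.2, hv0.1]⟩
  rw [← h] at hu1 hv1
  linarith [hu1.2, hv1.2]

theorem region_subset_closure_interior : region ⊆ closure (interior region) :=
  foldRegion_subset_closure_interior continuous_prof

theorem prof_zero (x : ℝ) : prof x 0 = 0 := by
  unfold prof
  simp [cut_eq_zero_of_le]

theorem axis_mem {s : ℝ} (hs : |s| ≤ 1) : pt s 0 0 ∈ region := by
  refine ⟨hs, ?_, ?_⟩ <;> simp [prof_zero]

theorem tendsto_rpt_sc (s : ℝ) : Tendsto (fun n => rpt s (sc n) 0) atTop (𝓝 (pt s 0 0)) := by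
  have h : Continuous fun y : ℝ => rpt s y 0 := by
    have := continuous_prof.comp (continuous_const.prodMk continuous_id : Continuous fun y : ℝ => (s, y))
    exact continuous_pt continuous_const continuous_id (this.add (by fun_prop))
  have := (h.tendsto 0).comp tendsto_sc
  simpa [rpt, prof_zero, Function.comp_def] using this

theorem rhoY_axis_le {s t : ℝ} (hs : |s| < 1) (ht : |t| < 1) :
    rhoY region (pt s 0 0) (pt t 0 0) ≤ ENNReal.ofReal (3 * |s - t|) := by
  have hl := (((tendsto_hgt_div_per.const_mul 2).const_add 1).mul_const |s - t|).add
        (tendsto_hgt.const_mul 2)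
  rw [show (1 + 2 * 1) * |s - t| + 2 * 0 = 3 * |s - t| by ring] at hl
  refine rhoY_le_of_tendsto region_subset_closure_interior interiorLocallyShort_region
    (axis_mem hs.le) (axis_mem ht.le) (tendsto_rpt_sc s) (tendsto_rpt_sc t) ?_ ?_ hl ?_
  all_goals filter_upwards [eventually_ge_atTop 1] with n hn
  · exact rpt_mem hs (sc_pos n) (sc_lt_one hn) (by simp)
  · exact rpt_mem ht (sc_pos n) (sc_lt_one hn) (by simp)
  · exact infSmoothLength_travel hn hs ht

end UpperBounds

section Potential

/-- Truncated height above the valley, at scale `a`. -/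
noncomputable def trunc (a z : ℝ) : ℝ := max 0 (min (eff a) (z - mar a))

/-- Signed distance to the top of a fold, as a function of the horizontal displacement from its
centre and of the height. -/
noncomputable def climb (a v z : ℝ) : ℝ :=
  if v < -wid a then v + wid a - eff a
  else if v ≤ 0 then -(eff a - trunc a z)
  else if v ≤ wid a then eff a - trunc a z
  else v - wid a + eff a

/-- A function measuring the distance travelled across the folds of scale `a`. -/
noncomputable def pot (a x z : ℝ) : ℝ :=
  3 * ctr a (round (x / per a - 1 / 2)) +
    (1 - a / 2) * climb a (x - ctr a (round (x / per a - 1 / 2))) z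

variable {a : ℝ}

theorem abs_trunc_sub_le (a z z' : ℝ) : |trunc a z - trunc a z'| ≤ |z - z'| := by
  unfold trunc
  refine (abs_max_sub_max_le_max _ _ _ _).trans (max_le (by simp) ?_)
  refine (abs_min_sub_min_le_max _ _ _ _).trans (max_le (by simp) ?_)
  rw [sub_sub_sub_cancel_right]

theorem trunc_nonneg (a z : ℝ) : 0 ≤ trunc a z := le_max_left _ _

theorem trunc_le (h : 0 < a) (h1 : a ≤ 1) (z : ℝ) : trunc a z ≤ eff a :=
  max_le (eff_pos h h1).le (min_le_left _ _)

theorem trunc_eq_zero {z : ℝ} (hz : z < mar a) : trunc a z = 0 :=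
  max_eq_left ((min_le_right _ _).trans (by linarith))

theorem trunc_eq_eff (h : 0 < a) (h1 : a ≤ 1) {z : ℝ} (hz : hgt a - mar a < z) :
    trunc a z = eff a := by
  unfold hgt at hz
  rw [trunc, min_eq_left (by linarith), max_eq_right (eff_pos h h1).le]

theorem abs_ctr_round_sub_le (h : 0 < a) (x : ℝ) :
    |x - ctr a (round (x / per a - 1 / 2))| ≤ per a / 2 := by
  have h2 := per_pos h
  have h3 := abs_sub_round (x / per a - 1 / 2)
  have h4 : x - ctr a (round (x / per a - 1 / 2)) =
      per a * (x / per a - 1 / 2 - round (x / per a - 1 / 2)) := by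
    unfold ctr; field_simp; ring
  rw [h4, abs_mul, abs_of_pos h2]
  nlinarith

theorem pot_eq (h : 0 < a) (h1 : a ≤ 1) {x : ℝ} (z : ℝ) {j : ℤ}
    (hx : |x - ctr a j| < per a - wid a) :
    pot a x z = 3 * ctr a j + (1 - a / 2) * climb a (x - ctr a j) z := by
  have hD := per_pos h
  have hw := wid_pos h
  have hwD := wid_le h h1
  have he := eff_eq h1
  have hr := abs_ctr_round_sub_le h x
  unfold pot
  set i := round (x / per a - 1 / 2)
  rw [abs_le] at hr
  rw [abs_lt] at hx
  have hij : |((i - j : ℤ) : ℝ)| < 2 := by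
    have e : ctr a i - ctr a j = per a * ((i - j : ℤ) : ℝ) := by
      unfold ctr; push_cast; ring
    rw [abs_lt]
    constructor <;> by_contra! hc
    · nlinarith
    · nlinarith
  have hij' : |i - j| < 2 := by exact_mod_cast hij
  rw [abs_lt] at hij'
  have hcases : i = j ∨ i = j + 1 ∨ i = j - 1 := by omega
  rcases hcases with hij | hij | hij
  · rw [hij]
  · have hc : ctr a i = ctr a j + per a := by rw [hij]; unfold ctr; push_cast; ring
    rw [hc] at hr ⊢
    have e1 : climb a (x - (ctr a j + per a)) z = x - (ctr a j + per a) + wid a - eff a := by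
      rw [climb, if_pos (by linarith)]
    have e2 : climb a (x - ctr a j) z = x - ctr a j - wid a + eff a := by
      rw [climb, if_neg (by linarith), if_neg (by linarith), if_neg (by linarith)]
    rw [e1, e2]
    linarith
  · have hc : ctr a i = ctr a j - per a := by rw [hij]; unfold ctr; push_cast; ring
    rw [hc] at hr ⊢
    have e1 : climb a (x - ctr a j) z = x - ctr a j + wid a - eff a := by
      rw [climb, if_pos (by linarith)]
    have e2 : climb a (x - (ctr a j - per a)) z = x - (ctr a j - per a) - wid a + eff a := by
      rw [climb, if_neg (by linarith), if_neg (by linarith), if_neg (by linarith)]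
    rw [e1, e2]
    linarith

theorem abs_climb_le (h : 0 < a) (h1 : a ≤ 1) {v : ℝ} (hv : |v| ≤ per a / 2) (z : ℝ) :
    |climb a v z| ≤ per a / 2 - wid a + eff a := by
  have hD := per_pos h
  have hw := wid_pos h
  have hwD := wid_le h h1
  have hB := eff_pos h h1
  have ht := trunc_nonneg a z
  have ht' := trunc_le h h1 z
  rw [abs_le] at hv ⊢
  unfold climb
  split_ifs <;> constructor <;> linarith

theorem abs_pot_sub_le (h : 0 < a) (h1 : a ≤ 1) (x z : ℝ) : |pot a x z - 3 * x| ≤ 3 * per a := by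
  have hr := abs_ctr_round_sub_le h x
  have hs := abs_climb_le h h1 hr z
  have he := eff_eq h1
  unfold pot
  set c := ctr a (round (x / per a - 1 / 2))
  rw [abs_le] at hr hs ⊢
  have hk : 0 ≤ 1 - a / 2 := by linarith
  have i1 := mul_le_mul_of_nonneg_left hs.1 hk
  have i2 := mul_le_mul_of_nonneg_left hs.2 hk
  constructor <;> linarith

theorem exists_climb_eventuallyEq (h : 0 < a) (h1 : a ≤ 1) {v₀ z₀ : ℝ}
    (hz : v₀ = 0 → hgt a - mar a < z₀) (hz' : |v₀| = wid a → z₀ < mar a) :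
    ∃ E : ℝ → ℝ → ℝ, (∀ v z v' z', |E v z - E v' z'| ≤ max |v - v'| |z - z'|) ∧
      ∀ᶠ q : ℝ × ℝ in 𝓝 (v₀, z₀), climb a q.1 q.2 = E q.1 q.2 := by
  have hw := wid_pos h
  have c1 : Tendsto (fun q : ℝ × ℝ => q.1) (𝓝 (v₀, z₀)) (𝓝 v₀) := continuous_fst.tendsto _
  have c2 : Tendsto (fun q : ℝ × ℝ => q.2) (𝓝 (v₀, z₀)) (𝓝 z₀) := continuous_snd.tendsto _
  rcases lt_trichotomy v₀ (-wid a) with h2 | h2 | h2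
  · refine ⟨fun v _ => v + wid a - eff a, fun v z v' z' => ?_, ?_⟩
    · rw [show v + wid a - eff a - (v' + wid a - eff a) = v - v' by ring]; exact le_max_left _ _
    · filter_upwards [c1.eventually_lt_const h2] with q hq
      rw [climb, if_pos hq]
  · have hz0 : z₀ < mar a := hz' (by rw [h2, abs_neg, abs_of_pos hw])
    refine ⟨fun v _ => min (v + wid a) 0 - eff a, fun v z v' z' => ?_, ?_⟩
    · rw [sub_sub_sub_cancel_right]
      refine (abs_min_sub_min_le_max _ _ _ _).trans (max_le ?_ (by simp))
      rw [add_sub_add_right_eq_sub]; exact le_max_left _ _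
    · filter_upwards [c1.eventually_lt_const (show v₀ < 0 by linarith),
        c2.eventually_lt_const hz0] with q hq hq2
      rw [climb]
      split_ifs with h3
      · rw [min_eq_left (by linarith)]
      · rw [min_eq_right (by linarith), trunc_eq_zero hq2]; ring
      · linarith
      · linarith
  rcases lt_trichotomy v₀ 0 with h3 | h3 | h3
  · refine ⟨fun _ z => -(eff a - trunc a z), fun v z v' z' => ?_, ?_⟩
    · rw [show -(eff a - trunc a z) - -(eff a - trunc a z') = trunc a z - trunc a z' by ring]
      exact (abs_trunc_sub_le a z z').trans (le_max_right _ _)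
    · filter_upwards [c1.eventually_lt_const h3, c1.eventually_const_lt h2] with q hq hq2
      rw [climb, if_neg hq2.le.not_gt, if_pos hq.le]
  · refine ⟨fun _ _ => 0, fun v z v' z' => by simp, ?_⟩
    filter_upwards [c2.eventually_const_lt (hz h3), c1.eventually_const_lt h2,
      c1.eventually_lt_const (show v₀ < wid a by linarith)] with q hq hq2 hq3
    rw [climb, if_neg hq2.le.not_gt, if_pos hq3.le, trunc_eq_eff h h1 hq]
    simp
  rcases lt_trichotomy v₀ (wid a) with h4 | h4 | h4
  · refine ⟨fun _ z => eff a - trunc a z, fun v z v' z' => ?_, ?_⟩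
    · rw [show eff a - trunc a z - (eff a - trunc a z') = -(trunc a z - trunc a z') by ring, abs_neg]
      exact (abs_trunc_sub_le a z z').trans (le_max_right _ _)
    · filter_upwards [c1.eventually_const_lt h3, c1.eventually_lt_const h4] with q hq hq2
      rw [climb, if_neg (by linarith), if_neg hq.not_ge, if_pos hq2.le]
  · have hz0 : z₀ < mar a := hz' (by rw [h4, abs_of_pos hw])
    refine ⟨fun v _ => max (v - wid a) 0 + eff a, fun v z v' z' => ?_, ?_⟩
    · rw [add_sub_add_right_eq_sub]
      refine (abs_max_sub_max_le_max _ _ _ _).trans (max_le ?_ (by simp))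
      rw [sub_sub_sub_cancel_right]; exact le_max_left _ _
    · filter_upwards [c1.eventually_const_lt h3, c2.eventually_lt_const hz0] with q hq hq2
      rw [climb, if_neg (by linarith), if_neg hq.not_ge]
      split_ifs with h5
      · rw [max_eq_right (by linarith), trunc_eq_zero hq2]; ring
      · rw [max_eq_left (by linarith)]
  · refine ⟨fun v _ => v - wid a + eff a, fun v z v' z' => ?_, ?_⟩
    · rw [show v - wid a + eff a - (v' - wid a + eff a) = v - v' by ring]; exact le_max_left _ _
    · filter_upwards [c1.eventually_const_lt h4] with q hq
      rw [climb, if_neg (by linarith), if_neg (by linarith), if_neg hq.not_ge]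

theorem exists_pot_eventuallyEq (h : 0 < a) (h1 : a ≤ 1) {x₀ z₀ : ℝ}
    (hz : ∀ j : ℤ, x₀ - ctr a j = 0 → hgt a - mar a < z₀)
    (hz' : ∀ j : ℤ, |x₀ - ctr a j| = wid a → z₀ < mar a) :
    ∃ E : ℝ → ℝ → ℝ, (∀ x z x' z', |E x z - E x' z'| ≤ (1 - a / 2) * max |x - x'| |z - z'|) ∧
      ∀ᶠ q : ℝ × ℝ in 𝓝 (x₀, z₀), pot a q.1 q.2 = E q.1 q.2 := by
  have hD := per_pos h
  have hw := wid_pos h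
  have hwD := wid_le h h1
  have hr := abs_ctr_round_sub_le h x₀
  set j := round (x₀ / per a - 1 / 2)
  obtain ⟨E, hE, hev⟩ := exists_climb_eventuallyEq h h1 (hz j) (hz' j)
  refine ⟨fun x z => 3 * ctr a j + (1 - a / 2) * E (x - ctr a j) z, fun x z x' z' => ?_, ?_⟩
  · rw [add_sub_add_left_eq_sub, ← mul_sub, abs_mul, abs_of_nonneg (by linarith)]
    refine mul_le_mul_of_nonneg_left ?_ (by linarith)
    simpa using hE (x - ctr a j) z (x' - ctr a j) z'
  · have hc : Tendsto (fun q : ℝ × ℝ => (q.1 - ctr a j, q.2)) (𝓝 (x₀, z₀))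
        (𝓝 (x₀ - ctr a j, z₀)) :=
      (show Continuous fun q : ℝ × ℝ => (q.1 - ctr a j, q.2) by fun_prop).tendsto _
    have hc2 : Tendsto (fun q : ℝ × ℝ => |q.1 - ctr a j|) (𝓝 (x₀, z₀)) (𝓝 |x₀ - ctr a j|) :=
      (show Continuous fun q : ℝ × ℝ => |q.1 - ctr a j| by fun_prop).tendsto (x₀, z₀)
    filter_upwards [hc.eventually hev,
      hc2.eventually_lt_const (show |x₀ - ctr a j| < per a - wid a by linarith)] with q hq hq2
    rw [pot_eq h h1 q.2 hq2, hq]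

/-- Inside the region, at heights where the folds of scale `8⁻ⁿ` are fully developed, the potential
of that scale is locally contracting. -/
theorem exists_pot_eventuallyEq_of_mem {p : E³} (hp : p ∈ interior region) {n : ℕ}
    (hn1 : 1 / 4 ≤ 8 ^ n * p 1) (hn2 : 8 ^ n * p 1 ≤ 4) :
    ∃ E : ℝ → ℝ → ℝ,
      (∀ x z x' z', |E x z - E x' z'| ≤ (1 - sc n / 2) * max |x - x'| |z - z'|) ∧
      ∀ᶠ q : E³ in 𝓝 p, pot (sc n) (q 0) (q 2) = E (q 0) (q 2) := by
  have h0 := sc_pos n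
  have h1 := sc_le_one n
  have hp1 := pos_of_mem_interior_region hp
  have hD := per_pos h0
  have hw := wid_pos h0
  have hwD := wid_le h0 h1
  have hmar : p 1 ^ 5 / 2 ^ 14 < mar (sc n) := by
    have h2 : p 1 ≤ 4 * sc n := by
      have := sc_mul_pow n
      nlinarith
    have h3 : p 1 ^ 5 ≤ (4 * sc n) ^ 5 := by gcongr
    have h4 : 0 < sc n ^ 5 := by positivity
    unfold mar
    rw [mul_pow] at h3
    linarith
  have hz := (mem_interior_region.1 hp).2.2
  have hz2 : |p 2 - prof (p 0) (p 1)| < mar (sc n) := by linarith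
  have hprof : ∀ j : ℤ, |p 0 - ctr (sc n) j| ≤ wid (sc n) →
      prof (p 0) (p 1) = hgt (sc n) * max 0 (1 - |p 0 - ctr (sc n) j| / wid (sc n)) := by
    intro j hj
    have hj2 : |p 0 - ctr (sc n) j| ≤ per (sc n) / 2 := by linarith
    rw [prof_eq_tent hn1 hn2 (by rwa [per_mul_nd_eq h0 hj2]), tent_eq h0 hj2]
  rw [abs_lt] at hz2
  obtain ⟨E, hE, hev⟩ := exists_pot_eventuallyEq h0 h1 (x₀ := p 0) (z₀ := p 2)
    (fun j hj => by
      have h2 := hprof j (by rw [hj, abs_zero]; exact hw.le)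
      rw [hj] at h2
      simp only [abs_zero, zero_div, sub_zero, zero_le_one, sup_of_le_right, mul_one] at h2
      linarith)
    (fun j hj => by
      have h2 := hprof j hj.le
      rw [hj, div_self hw.ne', sub_self, max_self, mul_zero] at h2
      linarith)
  exact ⟨E, hE, (((continuous_coord 0).prodMk (continuous_coord 2)).tendsto p).eventually hev⟩

end Potential

section GlobalPotential

/-- A member of a partition of unity in the scale variable. -/
noncomputable def bump (v : ℝ) : ℝ := max 0 (min 1 (min (4 * v - 1) ((4 - v) / 2)))

theorem bump_nonneg (v : ℝ) : 0 ≤ bump v := le_max_left _ _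

theorem bump_eq_one {v : ℝ} (h : 1 / 2 ≤ v) (h' : v ≤ 2) : bump v = 1 := by
  unfold bump
  rw [min_eq_left, max_eq_right zero_le_one]
  exact le_min (by linarith) (by linarith)

theorem bump_eq_zero_of_le {v : ℝ} (h : v ≤ 1 / 4) : bump v = 0 :=
  max_eq_left ((min_le_right _ _).trans ((min_le_left _ _).trans (by linarith)))

theorem bump_eq_zero_of_ge {v : ℝ} (h : 4 ≤ v) : bump v = 0 :=
  max_eq_left ((min_le_right _ _).trans ((min_le_right _ _).trans (by linarith)))

theorem bump_add_bump {v : ℝ} (h : 1 / 8 ≤ v) (h' : v ≤ 2) : bump v + bump (8 * v) = 1 := by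
  rcases le_total v (1 / 4) with h1 | h1
  · rw [bump_eq_zero_of_le h1, bump_eq_one (by linarith) (by linarith), zero_add]
  rcases le_total (1 / 2) v with h2 | h2
  · rw [bump_eq_zero_of_ge (v := 8 * v) (by linarith), bump_eq_one h2 h', add_zero]
  unfold bump
  rw [min_eq_left (a := 4 * v - 1) (by linarith), min_eq_right (b := 4 * v - 1) (by linarith),
    max_eq_right (b := 4 * v - 1) (by linarith), min_eq_right (a := 4 * (8 * v) - 1) (by linarith),
    min_eq_right (b := (4 - 8 * v) / 2) (by linarith), max_eq_right (by linarith)]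
  ring

theorem abs_bump_sub_le (v v' : ℝ) : |bump v - bump v'| ≤ 4 * |v - v'| := by
  have hn := abs_nonneg (v - v')
  have h1 : |(4 * v - 1) - (4 * v' - 1)| ≤ 4 * |v - v'| := by
    rw [show (4 * v - 1) - (4 * v' - 1) = 4 * (v - v') by ring, abs_mul]; norm_num
  have h2 : |(4 - v) / 2 - (4 - v') / 2| ≤ 4 * |v - v'| := by
    rw [show (4 - v) / 2 - (4 - v') / 2 = -((v - v') / 2) by ring, abs_neg, abs_div]
    norm_num; linarith
  unfold bump
  refine (abs_max_sub_max_le_max _ _ _ _).trans (max_le (by simp) ?_)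
  refine (abs_min_sub_min_le_max _ _ _ _).trans (max_le (by simp) ?_)
  exact (abs_min_sub_min_le_max _ _ _ _).trans (max_le h1 h2)

/-- The potential on the whole region, interpolating the potentials of the different scales. -/
noncomputable def gpot (p : E³) : ℝ :=
  3 * p 0 + ∑' n, bump (8 ^ n * p 1) * (pot (sc n) (p 0) (p 2) - 3 * p 0)

theorem gpot_eq {p : E³} {n : ℕ} (h1 : 3 / 16 ≤ 8 ^ n * p 1) (h2 : 8 ^ n * p 1 ≤ 2) :
    gpot p = bump (8 ^ n * p 1) * pot (sc n) (p 0) (p 2) +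
      (1 - bump (8 ^ n * p 1)) * pot (sc (n + 1)) (p 0) (p 2) := by
  have hp : 0 < p 1 := by
    by_contra! hy
    have : (8:ℝ) ^ n * p 1 ≤ 0 := mul_nonpos_of_nonneg_of_nonpos (by positivity) hy
    linarith
  have hs := bump_add_bump (v := 8 ^ n * p 1) (by linarith) h2
  rw [← mul_assoc, ← pow_succ'] at hs
  have h0 : ∀ m ∉ ({n, n + 1} : Finset ℕ),
      bump (8 ^ m * p 1) * (pot (sc m) (p 0) (p 2) - 3 * p 0) = 0 := by
    intro m hm
    simp only [Finset.mem_insert, Finset.mem_singleton, not_or] at hm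
    have : m + 1 ≤ n ∨ n + 2 ≤ m := by omega
    rcases this with h | h
    · have h3 : (8:ℝ) ^ (m + 1) ≤ 8 ^ n := pow_le_pow_right₀ (by norm_num) h
      rw [pow_add] at h3
      rw [bump_eq_zero_of_le (by nlinarith), zero_mul]
    · have h3 : (8:ℝ) ^ (n + 2) ≤ 8 ^ m := pow_le_pow_right₀ (by norm_num) h
      rw [pow_add] at h3
      rw [bump_eq_zero_of_ge (by nlinarith), zero_mul]
  rw [gpot, tsum_eq_sum h0, Finset.sum_pair (by omega), ← hs, add_sub_cancel_left]
  linear_combination (-3 * p 0) * hs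

theorem exists_scale {y : ℝ} (hy : 0 < y) (hy1 : y < 1) :
    ∃ n : ℕ, 1 / 4 ≤ 8 ^ n * y ∧ 8 ^ n * y < 2 := by
  have hex : ∃ n : ℕ, 1 / 4 ≤ 8 ^ n * y := by
    obtain ⟨n, hn⟩ := pow_unbounded_of_one_lt (1 / y) (by norm_num : (1:ℝ) < 8)
    rw [div_lt_iff₀ hy] at hn
    exact ⟨n, by linarith⟩
  classical
  refine ⟨Nat.find hex, Nat.find_spec hex, ?_⟩
  rcases h : Nat.find hex with _ | m
  · simp; linarith
  · have := Nat.find_min hex (m := m) (by omega)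
    push Not at this
    rw [pow_succ]; linarith

theorem abs_gpot_sub_le {p : E³} (hp : 0 < p 1) (hp1 : p 1 < 1) : |gpot p - 3 * p 0| ≤ p 1 := by
  obtain ⟨n, h1, h2⟩ := exists_scale hp hp1
  have hs := bump_add_bump (v := 8 ^ n * p 1) (by linarith) h2.le
  have b0 := bump_nonneg (8 ^ n * p 1)
  have b1 := bump_nonneg (8 * (8 ^ n * p 1))
  have e1 := abs_pot_sub_le (sc_pos n) (sc_le_one n) (p 0) (p 2)
  have e2 := abs_pot_sub_le (sc_pos (n + 1)) (sc_le_one (n + 1)) (p 0) (p 2)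
  have hsc := sc_pos n
  have hsc1 := sc_le_one n
  have e3 : per (sc (n + 1)) ≤ per (sc n) := by
    unfold per; rw [sc_succ]; gcongr; linarith
  have e4 : 3 * per (sc n) ≤ p 1 := by
    have h3 : sc n ≤ 4 * p 1 := by
      have := sc_mul_pow n
      nlinarith
    have h4 : sc n ^ 3 ≤ sc n := by simpa using pow_le_pow_of_le_one hsc.le hsc1 (show 1 ≤ 3 by norm_num)
    unfold per; linarith
  rw [gpot_eq (by linarith) h2.le]
  set u := bump (8 ^ n * p 1)
  rw [abs_le] at e1 e2 ⊢
  have hu : 0 ≤ 1 - u := by linarith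
  have i1 := mul_le_mul_of_nonneg_left e1.1 b0
  have i2 := mul_le_mul_of_nonneg_left e1.2 b0
  have i3 := mul_le_mul_of_nonneg_left e2.1 hu
  have i4 := mul_le_mul_of_nonneg_left e2.2 hu
  have i5 := mul_le_mul_of_nonneg_left e3 hu
  constructor <;> linarith

theorem max_sq_add_sq_le_dist_sq (p q : E³) :
    max |p 0 - q 0| |p 2 - q 2| ^ 2 + |p 1 - q 1| ^ 2 ≤ dist p q ^ 2 := by
  rw [dist_pt_sq, sq_abs]
  rcases max_cases |p 0 - q 0| |p 2 - q 2| with h | h <;> rw [h.1, sq_abs] <;>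
    nlinarith [sq_nonneg (p 0 - q 0), sq_nonneg (p 2 - q 2)]

theorem mul_add_mul_le_of_sq_add_sq_le_sq {a M d r : ℝ} (ha : 0 < a) (ha1 : a ≤ 1)
    (hr : 0 ≤ r) (h : M ^ 2 + d ^ 2 ≤ r ^ 2) :
    (1 - a / 16) * M + 3 / 128 * a ^ 2 * d ≤ r := by
  refine le_of_sq_le_sq ?_ hr
  have q2 : a ^ 2 ≤ a := by nlinarith
  have q4 : (a ^ 2) ^ 2 ≤ a := by nlinarith
  have k1 : (1 - a / 16) ^ 2 + (3 / 128 * a ^ 2) ^ 2 ≤ 1 := by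
    rw [mul_pow, sub_sq, div_pow]
    linarith
  have k2 := mul_le_mul_of_nonneg_right k1 (add_nonneg (sq_nonneg M) (sq_nonneg d))
  generalize 1 - a / 16 = c at *
  generalize 3 / 128 * a ^ 2 = e at *
  linear_combination sq_nonneg (c * d - e * M) + k2 + h

theorem abs_interp_sub_le {u u' A A' B B' : ℝ} (h0 : 0 ≤ u) (h1 : 0 ≤ 1 - u) :
    |u * A + (1 - u) * B - (u' * A' + (1 - u') * B')| ≤
      u * |A - A'| + (1 - u) * |B - B'| + |u - u'| * |A' - B'| := by
  rw [show u * A + (1 - u) * B - (u' * A' + (1 - u') * B') =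
    u * (A - A') + (1 - u) * (B - B') + (u - u') * (A' - B') by ring]
  refine (abs_add_le _ _).trans (add_le_add ((abs_add_le _ _).trans (le_of_eq ?_)) ?_)
  · rw [abs_mul, abs_mul, abs_of_nonneg h0, abs_of_nonneg h1]
  · rw [abs_mul]

theorem gpot_local {p : E³} (hp : p ∈ interior region) :
    ∃ N ∈ 𝓝 p, ∀ x ∈ N, ∀ y ∈ N, dist (gpot x) (gpot y) ≤ dist x y := by
  have hp0 := pos_of_mem_interior_region hp
  obtain ⟨n, h1, h2⟩ := exists_scale hp0 (mem_interior_region.1 hp).2.1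
  have hsc := sc_pos n
  have hsc1 := sc_le_one n
  have hv : Tendsto (fun q : E³ => 8 ^ n * q 1) (𝓝 p) (𝓝 (8 ^ n * p 1)) :=
    ((continuous_coord 1).const_mul _).tendsto p
  obtain ⟨A, hA, hAev⟩ := exists_pot_eventuallyEq_of_mem hp h1 (by linarith)
  rcases lt_or_ge (1 / 2) (8 ^ n * p 1) with h3 | h3
  · refine ⟨_, (hAev.and (hv.eventually_const_lt h3)).and (hv.eventually_lt_const h2), ?_⟩
    rintro x ⟨⟨hx1, hx2⟩, hx3⟩ y ⟨⟨hy1, hy2⟩, hy3⟩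
    rw [gpot_eq (p := x) (by linarith) hx3.le, gpot_eq (p := y) (by linarith) hy3.le,
      bump_eq_one hx2.le hx3.le, bump_eq_one hy2.le hy3.le, hx1, hy1, Real.dist_eq]
    simp only [one_mul, sub_self, zero_mul, add_zero]
    have e1 := hA (x 0) (x 2) (y 0) (y 2)
    have e2 := max_sq_add_sq_le_dist_sq x y
    set M := max |x 0 - y 0| |x 2 - y 2|
    have hM : 0 ≤ M := (abs_nonneg _).trans (le_max_left _ _)
    have e3 : M ≤ dist x y := le_of_sq_le_sq (by nlinarith [sq_nonneg |x 1 - y 1|]) dist_nonneg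
    nlinarith
  · obtain ⟨B, hB, hBev⟩ := exists_pot_eventuallyEq_of_mem hp (n := n + 1)
      (by rw [pow_succ]; linarith) (by rw [pow_succ]; linarith)
    refine ⟨_, ((hAev.and hBev).and (hv.eventually_const_lt
      (show 3 / 16 < 8 ^ n * p 1 by linarith))).and (hv.eventually_lt_const h2), ?_⟩
    rintro x ⟨⟨⟨hxA, hxB⟩, hx2⟩, hx3⟩ y ⟨⟨⟨hyA, hyB⟩, hy2⟩, hy3⟩
    have hs := bump_add_bump (v := 8 ^ n * x 1) (by linarith) hx3.le
    have b0 := bump_nonneg (8 ^ n * x 1)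
    have b1 := bump_nonneg (8 * (8 ^ n * x 1))
    have e1 := hA (x 0) (x 2) (y 0) (y 2)
    have e2 := hB (x 0) (x 2) (y 0) (y 2)
    have e3 := max_sq_add_sq_le_dist_sq x y
    have e4 := abs_bump_sub_le (8 ^ n * x 1) (8 ^ n * y 1)
    have e5 := abs_pot_sub_le hsc hsc1 (y 0) (y 2)
    have e6 := abs_pot_sub_le (sc_pos (n + 1)) (sc_le_one (n + 1)) (y 0) (y 2)
    rw [gpot_eq hx2.le hx3.le, gpot_eq hy2.le hy3.le, hxA, hxB, hyA, hyB, Real.dist_eq]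
    rw [hyA] at e5
    rw [hyB] at e6
    rw [sc_succ] at e2 e6
    rw [← mul_sub, abs_mul, abs_of_pos (show (0:ℝ) < 8 ^ n by positivity)] at e4
    set M := max |x 0 - y 0| |x 2 - y 2|
    set d := |x 1 - y 1|
    set u := bump (8 ^ n * x 1)
    set u' := bump (8 ^ n * y 1)
    set a := sc n
    have hM : 0 ≤ M := (abs_nonneg _).trans (le_max_left _ _)
    have hd : 0 ≤ d := abs_nonneg _
    have hu : 0 ≤ 1 - u := by linarith
    have e7 : |A (y 0) (y 2) - B (y 0) (y 2)| ≤ 6 * per a := by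
      have h8 : per (a / 8) ≤ per a := by unfold per; gcongr; linarith
      have := abs_sub_le (A (y 0) (y 2)) (3 * y 0) (B (y 0) (y 2))
      rw [abs_sub_comm (3 * y 0)] at this
      linarith
    have e8 : |u - u'| * |A (y 0) (y 2) - B (y 0) (y 2)| ≤ 3 / 128 * a ^ 2 * d := by
      calc |u - u'| * |A (y 0) (y 2) - B (y 0) (y 2)|
          ≤ (4 * (8 ^ n * d)) * (6 * per a) := mul_le_mul e4 e7 (abs_nonneg _) (by positivity)
        _ = 3 / 128 * a ^ 2 * d * (8 ^ n * a) := by unfold per; ring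
        _ = _ := by rw [sc_mul_pow, mul_one]
    have e10 : u * |A (x 0) (x 2) - A (y 0) (y 2)| ≤ u * ((1 - a / 8 / 2) * M) := by
      refine mul_le_mul_of_nonneg_left (e1.trans ?_) b0
      exact mul_le_mul_of_nonneg_right (by linarith) hM
    have e11 := mul_le_mul_of_nonneg_left e2 hu
    refine (abs_interp_sub_le b0 hu).trans ?_
    have e12 := mul_add_mul_le_of_sq_add_sq_le_sq hsc hsc1 dist_nonneg e3
    have e13 : (1 - u) * ((1 - a / 8 / 2) * M) + u * ((1 - a / 8 / 2) * M) = (1 - a / 16) * M := by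
      ring
    linarith

theorem tendsto_gpot_axis (s : ℝ) :
    Tendsto gpot (𝓝 (pt s 0 0) ⊓ 𝓟 (interior region)) (𝓝 (3 * s)) := by
  have h0 : Tendsto (fun p : E³ => 3 * p 0) (𝓝 (pt s 0 0)) (𝓝 (3 * s)) :=
    ((continuous_coord 0).const_mul 3).tendsto (pt s 0 0)
  have h1 : Tendsto (fun p : E³ => p 1) (𝓝 (pt s 0 0)) (𝓝 0) :=
    (continuous_coord 1).tendsto (pt s 0 0)
  have h2 : Tendsto (fun p : E³ => gpot p - 3 * p 0) (𝓝 (pt s 0 0) ⊓ 𝓟 (interior region))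
      (𝓝 0) := by
    refine squeeze_zero_norm' ?_ (h1.mono_left inf_le_left)
    filter_upwards [mem_inf_of_right (mem_principal_self _)] with p hp
    exact abs_gpot_sub_le (pos_of_mem_interior_region hp) (mem_interior_region.1 hp).2.1
  simpa using h2.add (h0.mono_left inf_le_left)

theorem rhoY_axis {s t : ℝ} (hs : |s| < 1) (ht : |t| < 1) :
    rhoY region (pt s 0 0) (pt t 0 0) = ENNReal.ofReal (3 * |s - t|) := by
  refine le_antisymm (rhoY_axis_le hs ht) ?_
  have := le_rhoY_of_tendsto (fun p hp => gpot_local hp) region_subset_closure_interior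
    (axis_mem hs.le) (axis_mem ht.le) (tendsto_gpot_axis s) (tendsto_gpot_axis t)
  rwa [edist_dist, Real.dist_eq, ← mul_sub, abs_mul, abs_of_pos (by norm_num : (0:ℝ) < 3)] at this

end GlobalPotential

/-- there is a compact connected `C⁰`-submanifold `Y ⊆ ℝ³` with boundary on
which `ρ_Y` is a finite metric, and a `ρ_Y`-shortest curve (geodesic) `γ : [0,L] → Y`
between two points of `Y` whose Euclidean (Riemannian) length is strictly smaller than its
`ρ_Y`-length `L`: so `(Y, ρ_Y)` is intrinsic (geodesic) but not a length space for the
ambient Riemannian length. -/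
theorem stmt19 :
    ∃ Y : Set (EuclideanSpace ℝ (Fin 3)),
      IsC0SubmanifoldWithBoundary 3 Y ∧
      -- ρ_Y is finite and a metric on Y
      (∀ x ∈ Y, ∀ y ∈ Y, rhoY Y x y < ⊤) ∧
      (∀ x ∈ Y, ∀ y ∈ Y, (rhoY Y x y = 0 ↔ x = y)) ∧
      (∀ x ∈ Y, ∀ y ∈ Y, rhoY Y x y = rhoY Y y x) ∧
      (∀ x ∈ Y, ∀ y ∈ Y, ∀ z ∈ Y, rhoY Y x z ≤ rhoY Y x y + rhoY Y y z) ∧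
      -- a ρ_Y-geodesic whose ambient length is < its ρ_Y-length
      ∃ x ∈ Y, ∃ y ∈ Y, ∃ L : ℝ, 0 < L ∧ ∃ γ : ℝ → EuclideanSpace ℝ (Fin 3),
        ContinuousOn γ (Icc 0 L) ∧ (∀ t ∈ Icc (0:ℝ) L, γ t ∈ Y) ∧
        γ 0 = x ∧ γ L = y ∧ rhoY Y x y = ENNReal.ofReal L ∧
        (∀ s t : ℝ, 0 ≤ s → s < t → t ≤ L →
          rhoY Y (γ s) (γ t) = ENNReal.ofReal (t - s)) ∧
        eVariationOn γ (Icc 0 L) < ENNReal.ofReal L := by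
  refine ⟨region, isC0SubmanifoldWithBoundary_foldRegion continuous_prof,
    fun x hx y hy => rhoY_lt_top region_subset_closure_interior interiorLocallyShort_region
      (fun p hp q hq => infSmoothLength_lt_top hp hq) hx hy,
    fun x hx y hy => rhoY_eq_zero_iff region_subset_closure_interior interiorLocallyShort_region
      hx hy,
    fun x hx y hy => rhoY_comm _ _,
    fun x hx y hy z hz => rhoY_triangle region_subset_closure_interior
      interiorLocallyShort_region hx hy hz,
    pt 0 0 0, axis_mem (by simp), pt (1 / 3) 0 0, axis_mem (by norm_num [abs_of_pos]),
    1, one_pos, fun t => pt (t / 3) 0 0, ?_, fun t ht => axis_mem ?_, by simp, rfl, ?_,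
    fun s t hs hst ht => ?_, ?_⟩
  · exact (continuous_pt (by fun_prop) continuous_const continuous_const).continuousOn
  · rw [abs_le]
    constructor <;> linarith [ht.1, ht.2]
  · rw [rhoY_axis (by norm_num) (by norm_num [abs_of_pos])]
    norm_num [abs_of_pos]
  · rw [rhoY_axis (by rw [abs_lt]; constructor <;> linarith)
      (by rw [abs_lt]; constructor <;> linarith), abs_sub_comm, abs_of_pos (by linarith)]
    congr 1
    ring
  · refine (eVariationOn_Icc_le_of_edist_le (f := fun t => t / 3) zero_le_one
      (fun s t _ hst _ => ?_) (fun s _ t _ hst => ?_)).trans_lt ?_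
    · rw [edist_dist]
      refine ENNReal.ofReal_le_ofReal ((dist_le_abs_add _ _).trans ?_)
      simp only [pt_zero, pt_one, pt_two]
      rw [abs_sub_comm, abs_of_nonneg (by linarith)]
      simp
    · dsimp only
      linarith
    · rw [ENNReal.ofReal_lt_ofReal_iff one_pos]
      norm_num
end
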